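/- (Existence of a heteroclinic loop for the Lomelí map.) Let f be the Lomelí map with parameters a = 1/2, b = −1/2, c = 1, α = −8999/100000, τ = 8/10 (which is a bijection of ℝ³). Then there exist two distinct fixed points p_1 ≠ p_2 of f and an injective continuous closed curve γ : ℝ/ℤ → ℝ³ (a Jordan loop) such that every point on the loop is heteroclinic from p_1 to p_2: lim_{n→∞} f^n(γ(s)) = p_2 and lim_{n→∞} f^{−n}(γ(s)) = p_1 for all s. Consequently W^u(p_1) ∩ W^s(p_2) contains a countable family of pairwise disjoint closed loops {f^n(γ)}_{n∈ℤ} accumulating at p_1 and p_2. -/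

import Mathlib

open Filter

/-- The `n`-th iterate of an invertible map for `n : ℤ`, where `g` is the inverse of `f`:
`f^[n]` for `n ≥ 0` and `g^[|n|]` for `n < 0`. -/
def iterZ {α : Type*} (f g : α → α) : ℤ → α → α
  | Int.ofNat n => f^[n]
  | Int.negSucc n => g^[n + 1]

namespace Lom

/-! ### Kernel-friendly signed integers and the interval checker -/

/-- Signed integers in sign-magnitude form. -/
inductive Z where
  | p (n : Nat)
  | m (n : Nat)

namespace Z

@[reducible] noncomputable def mul (a b : Z) : Z :=
  Z.rec (motive := fun _ => Z)
    (fun x => Z.rec (motive := fun _ => Z) (fun y => p (Nat.mul x y)) (fun y => m (Nat.mul x y)) b)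
    (fun x => Z.rec (motive := fun _ => Z) (fun y => m (Nat.mul x y)) (fun y => p (Nat.mul x y)) b) a

@[reducible] noncomputable def dif (x y : Nat) : Z :=
  Bool.rec (motive := fun _ => Z) (m (Nat.sub y x)) (p (Nat.sub x y)) (Nat.ble y x)

@[reducible] noncomputable def add (a b : Z) : Z :=
  Z.rec (motive := fun _ => Z)
    (fun x => Z.rec (motive := fun _ => Z) (fun y => p (Nat.add x y)) (fun y => dif x y) b)
    (fun x => Z.rec (motive := fun _ => Z) (fun y => dif y x) (fun y => m (Nat.add x y)) b) a

@[reducible] noncomputable def neg (a : Z) : Z :=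
  Z.rec (motive := fun _ => Z) (fun x => m x) (fun x => p x) a

@[reducible] noncomputable def sub (a b : Z) : Z := add a (neg b)

@[reducible] noncomputable def abs (a : Z) : Nat :=
  Z.rec (motive := fun _ => Nat) (fun x => x) (fun x => x) a

@[reducible] noncomputable def dv (a : Z) (k : Nat) : Z :=
  Z.rec (motive := fun _ => Z) (fun x => p (Nat.div x k)) (fun x => m (Nat.div x k)) a

/-- `a ≥ n` for a natural number `n`. -/
@[reducible] noncomputable def geN (a : Z) (n : Nat) : Bool :=
  Z.rec (motive := fun _ => Bool) (fun x => Nat.ble n x) (fun _ => false) a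

end Z


/-- Lists of noise generators: coefficients `x y z`, magnitudes `m` (existence), `u` (uniqueness). -/
inductive EL where
  | nil : EL
  | cons (x y z : Z) (m u : Nat) (t : EL) : EL

structure Tr where
  l : EL
  s1 : Nat
  s2 : Nat

noncomputable def goL (A B : Z) (l : EL) : Tr :=
  EL.rec (motive := fun _ => Tr) ⟨EL.nil, 0, 0⟩
    (fun x y z m u _ ih =>
      Tr.rec (motive := fun _ => Tr) (fun t s1 s2 =>
        (fun w => ⟨EL.cons w x y m u t, Nat.add s1 (Nat.mul w.abs m), Nat.add s2 (Nat.mul w.abs u)⟩)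
          (Z.add (Z.dv (Z.add (Z.mul A x) (Z.mul B y)) 1099511627776) z)) ih) l

/-- Parameters of the quadratic recurrence, in units of `10⁻⁵`. -/
structure Par where
  al : Z
  t1 : Z
  t2 : Z
  a : Z
  b : Z
  c : Z

structure St where
  P0 : Z
  P1 : Z
  P2 : Z
  Q0 : Z
  Q1 : Z
  Q2 : Z
  M0 : Z
  M1 : Z
  M2 : Z
  T0 : Z
  T1 : Z
  T2 : Z
  L : EL
  TE : Nat
  TU : Nat
  rE0 : Nat
  rE1 : Nat
  rU0 : Nat
  rU1 : Nat

/-- the scale `2^40` -/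
noncomputable abbrev zS : Z := Z.p 1099511627776

noncomputable def quad (q : Par) (x y : Z) : Z :=
  Z.add (Z.mul q.a (Z.mul x x)) (Z.add (Z.mul q.b (Z.mul x y)) (Z.mul q.c (Z.mul y y)))

noncomputable def nxt (q : Par) (x y z : Z) : Z :=
  Z.add z (Z.dv (Z.add (Z.mul zS (Z.add (Z.mul q.al zS) (Z.add (Z.mul q.t1 x) (Z.mul q.t2 y)))) (quad q x y)) 109951162777600000)

noncomputable def cA (q : Par) (x y : Z) : Z :=
  Z.dv (Z.add (Z.mul q.t1 (Z.p 2199023255552)) (Z.add (Z.mul (Z.mul q.a x) (Z.p 2)) (Z.mul q.b y))) 200000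

noncomputable def cB (q : Par) (x y : Z) : Z :=
  Z.dv (Z.add (Z.mul q.t2 (Z.p 2199023255552)) (Z.add (Z.mul q.b x) (Z.mul (Z.mul q.c y) (Z.p 2)))) 200000

noncomputable def lin (A B x y z : Z) : Z :=
  Z.add (Z.dv (Z.add (Z.mul A x) (Z.mul B y)) 1099511627776) z

/-- bound for the new noise -/
noncomputable def noise (q : Par) (D0 D1 r0 r1 T : Nat) : Nat :=
  (((2 * q.a.abs * D0 + q.b.abs * D1) / 100000 + 2) * r0 +
    ((q.b.abs * D0 + 2 * q.c.abs * D1) / 100000 + 2) * r1 + T) / 1099511627776 + 5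

noncomputable def fin (r : Nat) (M0 T0 : Z) (s : Nat) (e : Nat) : Nat :=
  (M0.abs * r + T0.abs * 274877906944 + s) / 1099511627776 + 1 + e

noncomputable def fin2 (M0 : Z) (s : Nat) (e : Nat) : Nat :=
  M0.abs + s / 1099511627776 + 1 + e

noncomputable def stp2 (r : Nat) (σ : St) (Pn Qn Mn Tn : Z) (eE eU : Nat) (g : Tr) : St :=
  ⟨Pn, σ.P0, σ.P1, Qn, σ.Q0, σ.Q1, Mn, σ.M0, σ.M1, Tn, σ.T0, σ.T1,
    EL.cons zS (Z.p 0) (Z.p 0) eE eU g.l, σ.TE + eE, σ.TU + eU,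
    fin r Mn Tn g.s1 eE, σ.rE0, fin2 Mn g.s2 eU, σ.rU0⟩

noncomputable def stp1 (q : Par) (r : Nat) (σ : St) (A B d0 d1 : Z) : St :=
  stp2 r σ (nxt q σ.P0 σ.P1 σ.P2) (nxt q σ.Q0 σ.Q1 σ.Q2) (lin A B σ.M0 σ.M1 σ.M2) (Z.sub (lin A B σ.T0 σ.T1 σ.T2) (Z.dv (quad q d0 d1) 109951162777600000)) (noise q ((d0.abs + σ.rE0) / 2 + 1) ((d1.abs + σ.rE1) / 2 + 1) σ.rE0 σ.rE1 σ.TE) (noise q (d0.abs / 2 + σ.rE0 + 1) (d1.abs / 2 + σ.rE1 + 1) σ.rU0 σ.rU1 σ.TU) (goL A B σ.L)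

noncomputable def stp (q : Par) (r : Nat) (σ : St) : St :=
  stp1 q r σ (cA q (Z.add σ.P0 σ.Q0) (Z.add σ.P1 σ.Q1)) (cB q (Z.add σ.P0 σ.Q0) (Z.add σ.P1 σ.Q1)) (Z.sub σ.P0 σ.Q0) (Z.sub σ.P1 σ.Q1)

/-- lower bound check: newest coordinate is `≥ -lo` on the whole cell -/
noncomputable def okLo (lo : Nat) (σ : St) : Bool :=
  and (Z.geN (Z.add σ.P0 (Z.p lo)) σ.rE0) (Z.geN (Z.add σ.Q0 (Z.p lo)) σ.rE0)

/-- upper bound check: newest coordinate is `≤ -lo` on the whole cell -/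
noncomputable def okHi (lo : Nat) (σ : St) : Bool :=
  and (Z.geN (Z.sub (Z.m lo) σ.P0) σ.rE0) (Z.geN (Z.sub (Z.m lo) σ.Q0) σ.rE0)

noncomputable def run (q : Par) (r lo : Nat) (k : St → Bool) (n : Nat) : St → Bool :=
  Nat.rec (motive := fun _ => St → Bool) k
    (fun _ ih σ => (fun σ' => Bool.rec (motive := fun _ => Bool) false (ih σ') (okLo lo σ'))
      (stp q r σ)) n

/-- functional -/
noncomputable def dot (a b c x y z : Z) : Z :=
  Z.add (Z.mul a x) (Z.add (Z.mul b y) (Z.mul c z))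

structure Pr where
  s1 : Nat
  s2 : Nat

noncomputable def dotL (a b c : Z) (l : EL) : Pr :=
  EL.rec (motive := fun _ => Pr) ⟨0, 0⟩
    (fun x y z m u _ ih =>
      Pr.rec (motive := fun _ => Pr) (fun s1 s2 =>
        (fun w => ⟨Nat.add s1 (Nat.mul w m), Nat.add s2 (Nat.mul w u)⟩)
          (Z.abs (dot a b c x y z))) ih) l

/-- A functional with denominators: value `(a,b,c)/d`; `cp` is the value at the fixed point. -/
structure Fn where
  a : Z
  b : Z
  c : Z
  d : Nat
  cp : Z

noncomputable def fM (φ : Fn) (σ : St) : Z := dot φ.a φ.b φ.c σ.M0 σ.M1 σ.M2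

/-- bound of everything but the main generator (existence) -/
noncomputable def fE (φ : Fn) (σ : St) : Nat :=
  max (Z.abs (Z.sub (dot φ.a φ.b φ.c σ.P0 σ.P1 σ.P2) φ.cp)) (Z.abs (Z.sub (dot φ.a φ.b φ.c σ.Q0 σ.Q1 σ.Q2) φ.cp)) + (Z.abs (dot φ.a φ.b φ.c σ.T0 σ.T1 σ.T2) / 4 + 1) + ((dotL φ.a φ.b φ.c σ.L).s1 / 1099511627776 + 1)

noncomputable def fU (φ : Fn) (σ : St) : Nat :=
  (dotL φ.a φ.b φ.c σ.L).s2 / 1099511627776 + 1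

/-- `|φ| ≤ bd/S` on the whole box, and `|φ w| /den ≤ ρ (cn/cd) * uq / dl`. -/
noncomputable def chkS (r : Nat) (φ : Fn) (bd cn cd dl uq : Nat) (σ : St) : Bool :=
  and (Nat.ble (fE φ σ + ((fM φ σ).abs * r / 1099511627776 + 1)) bd)
    (Nat.ble ((((fM φ σ).abs + fU φ σ)) * (dl * cd)) (uq * (cn * φ.d)))

structure Blk where
  l : Fn
  s1 : Fn
  s0 : Fn
  t : Fn
  al : Nat
  b1 : Nat
  b0 : Nat
  bt : Nat
  cn : Nat
  cd : Nat

noncomputable def endB (r : Nat) (β : Blk) (uq : Nat) (σ : St) : Bool :=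
  and (Nat.ble 1 uq)
  (and (chkS r β.s1 β.b1 1 1 β.l.d uq σ)
    (and (chkS r β.s0 β.b0 β.cn β.cd β.l.d uq σ)
      (chkS r β.t β.bt (β.cn * β.cn) (β.cd * β.cd) β.l.d uq σ)))

noncomputable def endA (r : Nat) (β : Blk) (σ : St) : Bool :=
  and (Z.geN (fM β.l σ) (fU β.l σ))
  (and (Z.geN (Z.mul (fM β.l σ) (Z.p r)) ((β.al + fE β.l σ) * 1099511627776))
    (endB r β ((fM β.l σ).abs - fU β.l σ) σ))

structure Node where
  x0 : Z
  x1 : Z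
  x2 : Z
  w : Z

noncomputable def parF : Par :=
  ⟨Z.m 8999, Z.p 80000, Z.p 0, Z.p 50000, Z.m 50000, Z.p 100000⟩
noncomputable def parB : Par :=
  ⟨Z.p 8999, Z.p 0, Z.m 80000, Z.m 100000, Z.p 50000, Z.m 50000⟩

noncomputable abbrev C0 : Z := Z.m 388394785930
noncomputable abbrev C1 : Z := Z.m 1066478999943
/-- radii -/
noncomputable abbrev rF : Nat := 120946279
noncomputable abbrev rB : Nat := 4398047

/-- initial state -/
noncomputable def mkSt (r : Nat) (P0 P1 P2 Q0 Q1 Q2 M0 M1 M2 : Z) (L : EL) (sE sU : Nat)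
    (b0 b1 u0 u1 : Nat) : St :=
  ⟨P0, P1, P2, Q0, Q1, Q2, M0, M1, M2, Z.p 0, Z.p 0, Z.p 0, L,
    r + 274877906944 + sE, 1099511627776 + sU, b0, b1, u0, u1⟩

/-- half-width of an interval coefficient -/
noncomputable def hw (x y : Z) : Nat :=
  Z.abs (Z.sub x y) / 2 + 2
noncomputable def hwE (g : Nat) : Nat := rF * g / 1099511627776 + 1

noncomputable def initF (X Y : Node) (M0 M1 M2 : Z) (g0 g1 g2 : Nat) : St :=
  mkSt rF X.x0 X.x1 X.x2 Y.x0 Y.x1 Y.x2 M0 M1 M2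
    (EL.cons (Z.p 0) (Z.p 0) zS rB 10995116278
      (EL.cons zS (Z.p 0) (Z.p 0) (hwE g0) g0
      (EL.cons (Z.p 0) zS (Z.p 0) (hwE g1) g1
      (EL.cons (Z.p 0) (Z.p 0) zS (hwE g2) g2 EL.nil))))
    (rB + (hwE g0 + (hwE g1 + hwE g2))) (10995116278 + (g0 + (g1 + g2)))
    (M0.abs * rF / 1099511627776 + 1 + hwE g0) (M1.abs * rF / 1099511627776 + 1 + hwE g1)
    (M0.abs + g0) (M1.abs + g1)

noncomputable def initB (X Y : Node) (M0 M1 M2 : Z) (g0 g1 g2 : Nat) : St :=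
  mkSt rB X.x2 X.x1 X.x0 Y.x2 Y.x1 Y.x0 zS (Z.p 0) (Z.p 0)
    (EL.cons M2 M1 M0 rF 109951162777600
      (EL.cons (Z.p 0) (Z.p 0) zS (hwE g0) (100 * g0)
      (EL.cons (Z.p 0) zS (Z.p 0) (hwE g1) (100 * g1)
      (EL.cons zS (Z.p 0) (Z.p 0) (hwE g2) (100 * g2) EL.nil))))
    (rF + (hwE g0 + (hwE g1 + hwE g2))) (109951162777600 + (100 * g0 + (100 * g1 + 100 * g2)))
    (rB + (M2.abs * rF / 1099511627776 + 1 + hwE g2)) (M1.abs * rF / 1099511627776 + 1 + hwE g1)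
    (1099511627776 + (100 * M2.abs + 100 * g2)) (100 * M1.abs + 100 * g1)

noncomputable def blkF : Blk :=
  ⟨⟨Z.p 5750, Z.p 3381, Z.p 4000, 5750, Z.p 1443624340117025⟩,
   ⟨Z.p 0, Z.p 16, Z.m 23, 16, Z.m 769581172860⟩,
   ⟨Z.p 16, Z.m 23, Z.p 0, 16, Z.m 769581172860⟩,
   ⟨Z.p 54096, Z.m 13763, Z.m 92000, 92000, Z.m 5680278636876576⟩,
   37933151158275, 879609302217, 778454232462, 3961358975458341, 177, 200⟩

noncomputable def blkB : Blk :=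
  ⟨⟨Z.p 54000, Z.p 10422, Z.p 35000, 54000, Z.m 98382987383688574⟩,
   ⟨Z.p 0, Z.p 35, Z.m 54, 35, Z.p 18801439925671⟩,
   ⟨Z.p 35, Z.m 54, Z.p 0, 35, Z.p 18801439925671⟩,
   ⟨Z.p 364770, Z.p 662212, Z.m 1890000, 1890000, Z.p 853999004303837641⟩,
   94997804639849, 1269935930078, 1142942337070, 55546997581755184, 9, 10⟩

noncomputable def cellFB (X Y : Node) (M0 M1 M2 : Z) (g0 g1 g2 : Nat) : Bool :=
  and (run parF rF 21990232555520
      (fun σ => and (okHi 1374389534720 σ)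
        (run parF rF 1319413953331 (endA rF blkF) 28 σ)) 2 (initF X Y M0 M1 M2 g0 g1 g2))
    (run parB rB 21990232555520 (endA rB blkB) 17 (initB X Y M0 M1 M2 g0 g1 g2))

/-- orientation and quadrant checks for the projected polygon -/
noncomputable def orient (u v u' v' : Z) : Bool :=
  and (Z.geN (Z.sub (Z.mul u v') (Z.mul v u')) 1)
    (and (Z.geN u 1) (and (Z.geN v 0) (and (Z.geN u' 0) (Z.geN v' 0))))

/-- the quadrant of the `k`-th cell -/
noncomputable def qd (k : Nat) : Nat :=
  cond (Nat.blt k 91) 0 (cond (Nat.blt k 220) 1 (cond (Nat.blt k 263) 2 3))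

/-- rotated coordinates -/
noncomputable def rotU (j : Nat) (X : Node) : Z :=
  Nat.rec (motive := fun _ => Z) (Z.sub X.x1 C1) (fun j _ =>
    Nat.rec (motive := fun _ => Z) (Z.sub C0 X.x0) (fun j _ =>
      Nat.rec (motive := fun _ => Z) (Z.sub C1 X.x1) (fun _ _ => Z.sub X.x0 C0) j) j) j
noncomputable def rotV (j : Nat) (X : Node) : Z :=
  Nat.rec (motive := fun _ => Z) (Z.sub C0 X.x0) (fun j _ =>
    Nat.rec (motive := fun _ => Z) (Z.sub C1 X.x1) (fun j _ =>
      Nat.rec (motive := fun _ => Z) (Z.sub X.x0 C0) (fun _ _ => Z.sub X.x1 C1) j) j) j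

noncomputable def cellOK (X Y : Node) : Bool :=
  cellFB X Y (Z.dv (Z.add (Z.sub X.x0 C0) (Z.sub Y.x0 C0)) 2) (Z.dv (Z.add (Z.sub X.x1 C1) (Z.sub Y.x1 C1)) 2) (Z.dv (Z.add X.w Y.w) 2) (hw X.x0 Y.x0) (hw X.x1 Y.x1) (hw X.w Y.w)

inductive NL where
  | nil : NL
  | cons (x0 x1 x2 w : Z) (t : NL)

noncomputable def NL.get (l : NL) : Nat → Node :=
  NL.rec (motive := fun _ => Nat → Node) (fun _ => ⟨Z.p 0, Z.p 0, Z.p 0, Z.p 0⟩)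
    (fun x0 x1 x2 w _ ih n => Nat.rec (motive := fun _ => Node) ⟨x0, x1, x2, w⟩ (fun k _ => ih k) n) l


noncomputable def orOK (j : Nat) (X Y : Node) : Bool :=
  orient (rotU j X) (rotV j X) (rotU j Y) (rotV j Y)

/-! ### Node data -/

noncomputable def nodes0 : NL :=
  NL.cons (Z.m 388394785930) (Z.m 932260812291) (Z.m 1287275902638) (Z.m 11834281431) <|
  NL.cons (Z.m 392685705291) (Z.m 932651193163) (Z.m 1285652475072) (Z.m 10227979448) <|
  NL.cons (Z.m 396896511790) (Z.m 933081809503) (Z.m 1284049876541) (Z.m 8643548595) <|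
  NL.cons (Z.m 401024797698) (Z.m 933554575347) (Z.m 1282469089271) (Z.m 7082417181) <|
  NL.cons (Z.m 404867606067) (Z.m 934044705490) (Z.m 1280988580753) (Z.m 5622398566) <|
  NL.cons (Z.m 408631294940) (Z.m 934577012250) (Z.m 1279529564934) (Z.m 4186101348) <|
  NL.cons (Z.m 412121037299) (Z.m 935122333878) (Z.m 1278168242461) (Z.m 2848794732) <|
  NL.cons (Z.m 415534633576) (Z.m 935709957760) (Z.m 1276828100577) (Z.m 1535549956) <|
  NL.cons (Z.m 418685606556) (Z.m 936305990343) (Z.m 1275582966086) (Z.m 318892417) <|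
  NL.cons (Z.m 421762180881) (Z.m 936944140596) (Z.m 1274359063487) (Z.p 873113703) <|
  NL.cons (Z.m 424586633516) (Z.m 937585373037) (Z.m 1273227682736) (Z.p 1970945489) <|
  NL.cons (Z.m 427339956460) (Z.m 938268470233) (Z.m 1272116902755) (Z.p 3044332418) <|
  NL.cons (Z.m 429853752506) (Z.m 938949044352) (Z.m 1271095230012) (Z.p 4027078052) <|
  NL.cons (Z.m 432291111985) (Z.m 939668106014) (Z.m 1270096990524) (Z.p 4982422911) <|
  NL.cons (Z.m 434492514321) (Z.m 940374681092) (Z.m 1269188179886) (Z.p 5847377040) <|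
  NL.cons (Z.m 436620170881) (Z.m 941116480097) (Z.m 1268302520056) (Z.p 6685249730) <|
  NL.cons (Z.m 438669772128) (Z.m 941893750952) (Z.m 1267441711893) (Z.p 7494160790) <|
  NL.cons (Z.m 440491394594) (Z.m 942643755141) (Z.m 1266669534669) (Z.p 8214585275) <|
  NL.cons (Z.m 442231784988) (Z.m 943419999317) (Z.m 1265924692475) (Z.p 8904230246) <|
  NL.cons (Z.m 443888670041) (Z.m 944221156388) (Z.m 1265208259166) (Z.p 9562058879) <|
  NL.nil

noncomputable def nodes1 : NL :=
  NL.cons (Z.m 443888670041) (Z.m 944221156388) (Z.m 1265208259166) (Z.p 9562058879) <|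
  NL.cons (Z.m 445463049581) (Z.m 945047052102) (Z.m 1264519931232) (Z.p 10188348076) <|
  NL.cons (Z.m 446956840458) (Z.m 945897868566) (Z.m 1263859005907) (Z.p 10783760646) <|
  NL.cons (Z.m 448371935858) (Z.m 946773717180) (Z.m 1263224784784) (Z.p 11348972229) <|
  NL.cons (Z.m 449709782092) (Z.m 947674310823) (Z.m 1262616771343) (Z.p 11884500894) <|
  NL.cons (Z.m 450878767795) (Z.m 948528186862) (Z.m 1262077738191) (Z.p 12353501308) <|
  NL.cons (Z.m 451985639021) (Z.m 949403356810) (Z.m 1261559610938) (Z.p 12798643803) <|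
  NL.cons (Z.m 453031879881) (Z.m 950299532392) (Z.m 1261061848696) (Z.p 13220519803) <|
  NL.cons (Z.m 454019448470) (Z.m 951216704790) (Z.m 1260583691647) (Z.p 13619924893) <|
  NL.cons (Z.m 454948021995) (Z.m 952152399347) (Z.m 1260125517191) (Z.p 13996740704) <|
  NL.cons (Z.m 455817618632) (Z.m 953103613668) (Z.m 1259687629672) (Z.p 14350985042) <|
  NL.cons (Z.m 456631082677) (Z.m 954069847804) (Z.m 1259268973872) (Z.p 14683827356) <|
  NL.cons (Z.m 457390774677) (Z.m 955049945643) (Z.m 1258868748519) (Z.p 14996246839) <|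
  NL.cons (Z.m 458099825174) (Z.m 956043663625) (Z.m 1258485752487) (Z.p 15289545432) <|
  NL.cons (Z.m 458761340967) (Z.m 957050873256) (Z.m 1258118776672) (Z.p 15565024803) <|
  NL.cons (Z.m 459378016974) (Z.m 958070937016) (Z.m 1257766823856) (Z.p 15823822934) <|
  NL.cons (Z.m 459952952508) (Z.m 959104004758) (Z.m 1257428649882) (Z.p 16067254420) <|
  NL.cons (Z.m 460489053736) (Z.m 960150163151) (Z.m 1257103088216) (Z.p 16296562554) <|
  NL.cons (Z.m 460988942559) (Z.m 961209170804) (Z.m 1256789116163) (Z.p 16512877619) <|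
  NL.cons (Z.m 461455041425) (Z.m 962280492541) (Z.m 1256485819993) (Z.p 16717248712) <|
  NL.nil

noncomputable def nodes2 : NL :=
  NL.cons (Z.m 461455041425) (Z.m 962280492541) (Z.m 1256485819993) (Z.p 16717248712) <|
  NL.cons (Z.m 461889998136) (Z.m 963364276419) (Z.m 1256192118802) (Z.p 16910829335) <|
  NL.cons (Z.m 462296305278) (Z.m 964460587917) (Z.m 1255906998553) (Z.p 17094713820) <|
  NL.cons (Z.m 462676264863) (Z.m 965569232856) (Z.m 1255629547304) (Z.p 17269918412) <|
  NL.cons (Z.m 463060818693) (Z.m 966784214829) (Z.m 1255336542268) (Z.p 17451112640) <|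
  NL.cons (Z.m 463419951360) (Z.m 968013741064) (Z.m 1255050287609) (Z.p 17624574687) <|
  NL.cons (Z.m 463756334599) (Z.m 969257774571) (Z.m 1254769691898) (Z.p 17791508951) <|
  NL.cons (Z.m 464096106829) (Z.m 970613715166) (Z.m 1254472625381) (Z.p 17965325767) <|
  NL.cons (Z.m 464415597564) (Z.m 971986536215) (Z.m 1254179597995) (Z.p 18134354202) <|
  NL.cons (Z.m 464738754782) (Z.m 973476029424) (Z.m 1253868744744) (Z.p 18311685578) <|
  NL.cons (Z.m 465065181825) (Z.m 975084483450) (Z.m 1253539410648) (Z.p 18498159590) <|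
  NL.cons (Z.m 465394336239) (Z.m 976807423107) (Z.m 1253191802348) (Z.p 18694424921) <|
  NL.cons (Z.m 465746228722) (Z.m 978748003073) (Z.m 1252804105102) (Z.p 18913945215) <|
  NL.cons (Z.m 466158167255) (Z.m 981116838787) (Z.m 1252332617788) (Z.p 19183711564) <|
  NL.cons (Z.m 466688066914) (Z.m 984237872989) (Z.m 1251707792188) (Z.p 19549290460) <|
  NL.cons (Z.m 467135018277) (Z.m 986857077424) (Z.m 1251174909016) (Z.p 19870795402) <|
  NL.cons (Z.m 467540790017) (Z.m 989174522635) (Z.m 1250693528711) (Z.p 20170162380) <|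
  NL.cons (Z.m 467944241371) (Z.m 991394454730) (Z.m 1250221442770) (Z.p 20472521330) <|
  NL.cons (Z.m 468346770024) (Z.m 993512514793) (Z.m 1249759375794) (Z.p 20777037878) <|
  NL.cons (Z.m 468748677543) (Z.m 995527102304) (Z.m 1249308090031) (Z.p 21082579328) <|
  NL.nil

noncomputable def nodes3 : NL :=
  NL.cons (Z.m 468748677543) (Z.m 995527102304) (Z.m 1249308090031) (Z.p 21082579328) <|
  NL.cons (Z.m 469172432344) (Z.m 997545057406) (Z.m 1248843496408) (Z.p 21405319627) <|
  NL.cons (Z.m 469620225635) (Z.m 999565809482) (Z.m 1248364776459) (Z.p 21746246186) <|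
  NL.cons (Z.m 470094205747) (Z.m 1001589781454) (Z.m 1247870979658) (Z.p 22106404540) <|
  NL.cons (Z.m 470596176442) (Z.m 1003616838478) (Z.m 1247361372028) (Z.p 22486658684) <|
  NL.cons (Z.m 471127985592) (Z.m 1005647773693) (Z.m 1246835055551) (Z.p 22887976544) <|
  NL.cons (Z.m 471690984725) (Z.m 1007682082138) (Z.m 1246291525459) (Z.p 23311013423) <|
  NL.cons (Z.m 472286580910) (Z.m 1009720057068) (Z.m 1245730128429) (Z.p 23756522641) <|
  NL.cons (Z.m 472916081285) (Z.m 1011762045231) (Z.m 1245150236913) (Z.p 24225230918) <|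
  NL.cons (Z.m 473580689169) (Z.m 1013808369185) (Z.m 1244551262844) (Z.p 24717829970) <|
  NL.cons (Z.m 474281516364) (Z.m 1015859323295) (Z.m 1243932653593) (Z.p 25234981103) <|
  NL.cons (Z.m 474979746530) (Z.m 1017806688690) (Z.m 1243328066734) (Z.p 25748095663) <|
  NL.cons (Z.m 475712259929) (Z.m 1019758745120) (Z.m 1242704940705) (Z.p 26284361275) <|
  NL.cons (Z.m 476479604050) (Z.m 1021715108353) (Z.m 1242063059702) (Z.p 26844123486) <|
  NL.cons (Z.m 477282461941) (Z.m 1023675894913) (Z.m 1241402067011) (Z.p 27427847697) <|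
  NL.cons (Z.m 478169282195) (Z.m 1025750800859) (Z.m 1240683144131) (Z.p 28070586171) <|
  NL.cons (Z.m 479097354499) (Z.m 1027831377510) (Z.m 1239941963721) (Z.p 28741233819) <|
  NL.cons (Z.m 480067774187) (Z.m 1029918523356) (Z.m 1239177834700) (Z.p 29440605002) <|
  NL.cons (Z.m 481135912925) (Z.m 1032122887894) (Z.m 1238348178222) (Z.p 30208505143) <|
  NL.cons (Z.m 482252990217) (Z.m 1034335417932) (Z.m 1237491888764) (Z.p 31009792603) <|
  NL.nil

noncomputable def nodes4 : NL :=
  NL.cons (Z.m 482252990217) (Z.m 1034335417932) (Z.m 1237491888764) (Z.p 31009792603) <|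
  NL.cons (Z.m 483420223604) (Z.m 1036556859832) (Z.m 1236608205337) (Z.p 31845423618) <|
  NL.cons (Z.m 484638901035) (Z.m 1038787994813) (Z.m 1235696319029) (Z.p 32716419277) <|
  NL.cons (Z.m 485910396895) (Z.m 1041029646624) (Z.m 1234755364087) (Z.p 33623876145) <|
  NL.cons (Z.m 487236202981) (Z.m 1043282712902) (Z.m 1233784398130) (Z.p 34568987802) <|
  NL.cons (Z.m 488617873993) (Z.m 1045548052373) (Z.m 1232782444734) (Z.p 35553005737) <|
  NL.cons (Z.m 490056936238) (Z.m 1047826337678) (Z.m 1231748559470) (Z.p 36577174582) <|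
  NL.cons (Z.m 491555296222) (Z.m 1050118690063) (Z.m 1230681537843) (Z.p 37643023255) <|
  NL.cons (Z.m 493115183679) (Z.m 1052426513631) (Z.m 1229579965092) (Z.p 38752324746) <|
  NL.cons (Z.m 494656026061) (Z.m 1054634248398) (Z.m 1228500248734) (Z.p 39847987306) <|
  NL.cons (Z.m 496254987145) (Z.m 1056856024988) (Z.m 1227387837567) (Z.p 40985078979) <|
  NL.cons (Z.m 497905265338) (Z.m 1059081116624) (Z.m 1226247547381) (Z.p 42158962907) <|
  NL.cons (Z.m 499606583314) (Z.m 1061308403051) (Z.m 1225079589377) (Z.p 43369650390) <|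
  NL.cons (Z.m 501360093589) (Z.m 1063538655622) (Z.m 1223883187860) (Z.p 44618179885) <|
  NL.cons (Z.m 503167040316) (Z.m 1065772648581) (Z.m 1222657513884) (Z.p 45905667437) <|
  NL.cons (Z.m 503748950458) (Z.m 1066478999943) (Z.m 1222264249475) (Z.p 46320512924) <|
  NL.cons (Z.m 505628924520) (Z.m 1068719885421) (Z.m 1220998256757) (Z.p 47661572363) <|
  NL.cons (Z.m 507565629040) (Z.m 1070966353375) (Z.m 1219700824043) (Z.p 49044532218) <|
  NL.cons (Z.m 509557805814) (Z.m 1073216076908) (Z.m 1218372801080) (Z.p 50468780911) <|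
  NL.cons (Z.m 511602512304) (Z.m 1075465147403) (Z.m 1217016116799) (Z.p 51932517751) <|
  NL.nil

noncomputable def nodes5 : NL :=
  NL.cons (Z.m 511602512304) (Z.m 1075465147403) (Z.m 1217016116799) (Z.p 51932517751) <|
  NL.cons (Z.m 513698706909) (Z.m 1077712090845) (Z.m 1215631391400) (Z.p 53435319197) <|
  NL.cons (Z.m 515839960298) (Z.m 1079950070538) (Z.m 1214222748188) (Z.p 54972914603) <|
  NL.cons (Z.m 518025804593) (Z.m 1082178994484) (Z.m 1212790320492) (Z.p 56545327910) <|
  NL.cons (Z.m 520256356530) (Z.m 1084399464509) (Z.m 1211333829326) (Z.p 58153042573) <|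
  NL.cons (Z.m 522410706489) (Z.m 1086495749120) (Z.m 1209931613348) (Z.p 59709079061) <|
  NL.cons (Z.m 524605487535) (Z.m 1088585855060) (Z.m 1208507151533) (Z.p 61297858585) <|
  NL.cons (Z.m 526839396497) (Z.m 1090669300061) (Z.m 1207061004370) (Z.p 62918933883) <|
  NL.cons (Z.m 529109710902) (Z.m 1092744587029) (Z.m 1205594583910) (Z.p 64570891197) <|
  NL.cons (Z.m 531415137361) (Z.m 1094811883537) (Z.m 1204108299957) (Z.p 66253431930) <|
  NL.cons (Z.m 533754480094) (Z.m 1096871769469) (Z.m 1202602412326) (Z.p 67966430194) <|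
  NL.cons (Z.m 536125006468) (Z.m 1098923875599) (Z.m 1201078064394) (Z.p 69708754612) <|
  NL.cons (Z.m 538521597807) (Z.m 1100966327682) (Z.m 1199537805045) (Z.p 71477645742) <|
  NL.cons (Z.m 541066750071) (Z.m 1103104453690) (Z.m 1197901995381) (Z.p 73365373385) <|
  NL.cons (Z.m 543744115859) (Z.m 1105324857123) (Z.m 1196179807172) (Z.p 75362807044) <|
  NL.cons (Z.m 546546201779) (Z.m 1107624164398) (Z.m 1194374076697) (Z.p 77468095223) <|
  NL.cons (Z.m 549729105369) (Z.m 1110216284396) (Z.m 1192315965252) (Z.p 79881270420) <|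
  NL.cons (Z.m 553140947480) (Z.m 1112987942776) (Z.m 1190097006738) (Z.p 82499373029) <|
  NL.cons (Z.m 555729366957) (Z.m 1115099416228) (Z.m 1188400779252) (Z.p 84512274413) <|
  NL.cons (Z.m 557892753335) (Z.m 1116879914166) (Z.m 1186971592666) (Z.p 86216198881) <|
  NL.nil

noncomputable def nodes6 : NL :=
  NL.cons (Z.m 557892753335) (Z.m 1116879914166) (Z.m 1186971592666) (Z.p 86216198881) <|
  NL.cons (Z.m 559768134128) (Z.m 1118442479423) (Z.m 1185721873892) (Z.p 87712225141) <|
  NL.cons (Z.m 561365226236) (Z.m 1119792952651) (Z.m 1184647866695) (Z.p 89002549411) <|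
  NL.cons (Z.m 562813168520) (Z.m 1121037973734) (Z.m 1183664838953) (Z.p 90187436145) <|
  NL.cons (Z.m 564233320321) (Z.m 1122283273206) (Z.m 1182690427005) (Z.p 91365698624) <|
  NL.cons (Z.m 565508443699) (Z.m 1123426671898) (Z.m 1181805287848) (Z.p 92439369638) <|
  NL.cons (Z.m 566755612066) (Z.m 1124573362085) (Z.m 1180928473365) (Z.p 93506216255) <|
  NL.cons (Z.m 567862889427) (Z.m 1125619867834) (Z.m 1180139201638) (Z.p 94469448838) <|
  NL.cons (Z.m 568942370326) (Z.m 1126671100669) (Z.m 1179358223041) (Z.p 95425389225) <|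
  NL.cons (Z.m 569992590046) (Z.m 1127729086113) (Z.m 1178585549140) (Z.p 96374069377) <|
  NL.cons (Z.m 571010564221) (Z.m 1128794574476) (Z.m 1177822224034) (Z.p 97314263164) <|
  NL.cons (Z.m 571993890080) (Z.m 1129869108327) (Z.m 1177068795932) (Z.p 98245359228) <|
  NL.cons (Z.m 572847019775) (Z.m 1130845125215) (Z.m 1176399750683) (Z.p 99074914890) <|
  NL.cons (Z.m 573668952758) (Z.m 1131832171864) (Z.m 1175738889497) (Z.p 99897026211) <|
  NL.cons (Z.m 574456227429) (Z.m 1132829978452) (Z.m 1175087761080) (Z.p 100709844589) <|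
  NL.cons (Z.m 575206824088) (Z.m 1133840103566) (Z.m 1174446720591) (Z.p 101513009691) <|
  NL.cons (Z.m 575919198690) (Z.m 1134865086955) (Z.m 1173815597397) (Z.p 102306836134) <|
  NL.cons (Z.m 576586766205) (Z.m 1135899923128) (Z.m 1173198782598) (Z.p 103085889741) <|
  NL.cons (Z.m 577206704229) (Z.m 1136944092241) (Z.m 1172597643634) (Z.p 103848504374) <|
  NL.cons (Z.m 577777416392) (Z.m 1137998746441) (Z.m 1172012483292) (Z.p 104594357248) <|
  NL.nil

noncomputable def nodes7 : NL :=
  NL.cons (Z.m 577777416392) (Z.m 1137998746441) (Z.m 1172012483292) (Z.p 104594357248) <|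
  NL.cons (Z.m 578297346268) (Z.m 1139065041662) (Z.m 1171443576128) (Z.p 105323168324) <|
  NL.cons (Z.m 578813719059) (Z.m 1140265023774) (Z.m 1170830736948) (Z.p 106112789134) <|
  NL.cons (Z.m 579263211538) (Z.m 1141481378414) (Z.m 1170239022108) (Z.p 106880221341) <|
  NL.cons (Z.m 579643920941) (Z.m 1142714837580) (Z.m 1169668946316) (Z.p 107624912308) <|
  NL.cons (Z.m 579954594999) (Z.m 1143967563921) (Z.m 1169120255531) (Z.p 108347319135) <|
  NL.cons (Z.m 580193250340) (Z.m 1145237107357) (Z.m 1168594525989) (Z.p 109045479242) <|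
  NL.cons (Z.m 580358599058) (Z.m 1146517130836) (Z.m 1168094350352) (Z.p 109715984799) <|
  NL.cons (Z.m 580456719081) (Z.m 1147932921704) (Z.m 1167574673204) (Z.p 110420186273) <|
  NL.cons (Z.m 580469527921) (Z.m 1149355864261) (Z.m 1167086182423) (Z.p 111090356584) <|
  NL.cons (Z.m 580390066818) (Z.m 1150912328639) (Z.m 1166588470465) (Z.p 111782898252) <|
  NL.cons (Z.m 580218071519) (Z.m 1152471990945) (Z.m 1166125657026) (Z.p 112437366628) <|
  NL.cons (Z.m 579933333061) (Z.m 1154165481290) (Z.m 1165660886114) (Z.p 113106823571) <|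
  NL.cons (Z.m 579522753929) (Z.m 1155981143096) (Z.m 1165202697544) (Z.p 113781307352) <|
  NL.cons (Z.m 579014669051) (Z.m 1157786749743) (Z.m 1164784527954) (Z.p 114412180424) <|
  NL.cons (Z.m 578372383666) (Z.m 1159711607272) (Z.m 1164375913177) (Z.p 115045863183) <|
  NL.cons (Z.m 577586785061) (Z.m 1161754541622) (Z.m 1163979843571) (Z.p 115679971749) <|
  NL.cons (Z.m 576650146574) (Z.m 1163914793938) (Z.m 1163598435699) (Z.p 116313348521) <|
  NL.cons (Z.m 575556427894) (Z.m 1166190955394) (Z.m 1163233182023) (Z.p 116945690776) <|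
  NL.cons (Z.m 574232018048) (Z.m 1168707274643) (Z.m 1162867505693) (Z.p 117610093221) <|
  NL.nil

noncomputable def nodes8 : NL :=
  NL.cons (Z.m 574232018048) (Z.m 1168707274643) (Z.m 1162867505693) (Z.p 117610093221) <|
  NL.cons (Z.m 572732224578) (Z.m 1171335102608) (Z.m 1162522555521) (Z.p 118272567462) <|
  NL.cons (Z.m 571055419056) (Z.m 1174072102089) (Z.m 1162197746109) (Z.p 118935889677) <|
  NL.cons (Z.m 569203785974) (Z.m 1176910517060) (Z.m 1161892834617) (Z.p 119602036281) <|
  NL.cons (Z.m 567096021976) (Z.m 1179961003015) (Z.m 1161596401701) (Z.p 120300156037) <|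
  NL.cons (Z.m 564901884130) (Z.m 1182974421792) (Z.m 1161331324564) (Z.p 120977543127) <|
  NL.cons (Z.m 562630918471) (Z.m 1185950454340) (Z.m 1161093677741) (Z.p 121639144371) <|
  NL.cons (Z.m 560290347119) (Z.m 1188888343489) (Z.m 1160880730432) (Z.p 122288404355) <|
  NL.cons (Z.m 557885600925) (Z.m 1191786835836) (Z.m 1160690748544) (Z.p 122927485799) <|
  NL.cons (Z.m 555428352800) (Z.m 1194635482290) (Z.m 1160523320772) (Z.p 123555525314) <|
  NL.cons (Z.m 552926116852) (Z.m 1197427973484) (Z.m 1160378291837) (Z.p 124171696545) <|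
  NL.cons (Z.m 550385482612) (Z.m 1200158239767) (Z.m 1160255967722) (Z.p 124774458024) <|
  NL.cons (Z.m 547811115571) (Z.m 1202821640772) (Z.m 1160156992933) (Z.p 125361917952) <|
  NL.cons (Z.m 545202605868) (Z.m 1205417964665) (Z.m 1160082253789) (Z.p 125932579580) <|
  NL.cons (Z.m 542452516598) (Z.m 1208046154838) (Z.m 1160031689144) (Z.p 126505929986) <|
  NL.cons (Z.m 539662775315) (Z.m 1210599596962) (Z.m 1160010805698) (Z.p 127055675144) <|
  NL.cons (Z.m 536831947896) (Z.m 1213075691539) (Z.m 1160022080721) (Z.p 127577865907) <|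
  NL.cons (Z.m 533958447363) (Z.m 1215471130297) (Z.m 1160068419787) (Z.p 128067831836) <|
  NL.cons (Z.m 531039744037) (Z.m 1217782575273) (Z.m 1160153167249) (Z.p 128520309449) <|
  NL.cons (Z.m 528187597336) (Z.m 1219922550592) (Z.m 1160274428810) (Z.p 128914500535) <|
  NL.nil

noncomputable def nodes9 : NL :=
  NL.cons (Z.m 528187597336) (Z.m 1219922550592) (Z.m 1160274428810) (Z.p 128914500535) <|
  NL.cons (Z.m 525287420593) (Z.m 1221977688192) (Z.m 1160438558233) (Z.p 129262534626) <|
  NL.cons (Z.m 522455356475) (Z.m 1223866343379) (Z.m 1160640373712) (Z.p 129546925389) <|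
  NL.cons (Z.m 519693901022) (Z.m 1225594833670) (Z.m 1160878379950) (Z.p 129767581969) <|
  NL.cons (Z.m 516884546213) (Z.m 1227238143155) (Z.m 1161163946853) (Z.p 129930837130) <|
  NL.cons (Z.m 514150433888) (Z.m 1228725391914) (Z.m 1161485463176) (Z.p 130026832795) <|
  NL.cons (Z.m 511495474809) (Z.m 1230063396963) (Z.m 1161840187283) (Z.p 130057451474) <|
  NL.cons (Z.m 508793368420) (Z.m 1231317414204) (Z.m 1162245492250) (Z.p 130022205658) <|
  NL.cons (Z.m 506173666694) (Z.m 1232429222291) (Z.m 1162682190403) (Z.p 129921327219) <|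
  NL.cons (Z.m 503505913079) (Z.m 1233456169213) (Z.m 1163172172995) (Z.p 129748527544) <|
  NL.cons (Z.m 500924537800) (Z.m 1234348831427) (Z.m 1163690613639) (Z.p 129511795549) <|
  NL.cons (Z.m 498294421714) (Z.m 1235156371437) (Z.m 1164264391005) (Z.p 129198266646) <|
  NL.cons (Z.m 495757029155) (Z.m 1235838253490) (Z.m 1164862048632) (Z.p 128824982547) <|
  NL.cons (Z.m 493173483936) (Z.m 1236435000072) (Z.m 1165515485533) (Z.p 128372103478) <|
  NL.cons (Z.m 490542835738) (Z.m 1236942220296) (Z.m 1166227660411) (Z.p 127834382211) <|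
  NL.cons (Z.m 488013585250) (Z.m 1237335210164) (Z.m 1166957038725) (Z.p 127243774011) <|
  NL.cons (Z.m 485438436279) (Z.m 1237640999102) (Z.m 1167744579340) (Z.p 126567867980) <|
  NL.cons (Z.m 482815574637) (Z.m 1237855856397) (Z.m 1168593098174) (Z.p 125801963827) <|
  NL.cons (Z.m 480304252385) (Z.m 1237971563289) (Z.m 1169449053444) (Z.p 124995560161) <|
  NL.cons (Z.m 477750399697) (Z.m 1238000425518) (Z.m 1170362672116) (Z.p 124102700683) <|
  NL.nil

noncomputable def nodes10 : NL :=
  NL.cons (Z.m 477750399697) (Z.m 1238000425518) (Z.m 1170362672116) (Z.p 124102700683) <|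
  NL.cons (Z.m 475156871926) (Z.m 1237939795105) (Z.m 1171334377758) (Z.p 123121678240) <|
  NL.cons (Z.m 472526068049) (Z.m 1237787639753) (Z.m 1172364406493) (Z.p 122051262152) <|
  NL.cons (Z.m 469857015847) (Z.m 1237542160079) (Z.m 1173454045519) (Z.p 120889356625) <|
  NL.cons (Z.m 467149240831) (Z.m 1237201781692) (Z.m 1174604226134) (Z.p 119634398746) <|
  NL.cons (Z.m 464575173610) (Z.m 1236795307067) (Z.m 1175738142850) (Z.p 118372336590) <|
  NL.cons (Z.m 461964793125) (Z.m 1236303046303) (Z.m 1176927066091) (Z.p 117026010351) <|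
  NL.cons (Z.m 459317113944) (Z.m 1235724021800) (Z.m 1178171647414) (Z.p 115594641518) <|
  NL.cons (Z.m 456642402413) (Z.m 1235060349111) (Z.m 1179466882621) (Z.p 114084213605) <|
  NL.cons (Z.m 453946334625) (Z.m 1234314227821) (Z.m 1180809344102) (Z.p 112499269232) <|
  NL.cons (Z.m 451227798714) (Z.m 1233486522117) (Z.m 1182198672759) (Z.p 110840938095) <|
  NL.cons (Z.m 449951451373) (Z.m 1233072694157) (Z.m 1182862787720) (Z.p 110042485689) <|
  NL.cons (Z.m 448487489435) (Z.m 1232578762431) (Z.m 1183633483611) (Z.p 109111671491) <|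
  NL.cons (Z.m 445723357475) (Z.m 1231591688762) (Z.m 1185113728369) (Z.p 107312400397) <|
  NL.cons (Z.m 442749825394) (Z.m 1230453509560) (Z.m 1186740763049) (Z.p 105319474795) <|
  NL.cons (Z.m 439759591229) (Z.m 1229233169334) (Z.m 1188410675918) (Z.p 103260044154) <|
  NL.cons (Z.m 436764477854) (Z.m 1227938757781) (Z.m 1190114691906) (Z.p 101146403782) <|
  NL.cons (Z.m 433765809354) (Z.m 1226574572956) (Z.m 1191849677984) (Z.p 98983984332) <|
  NL.cons (Z.m 430578822406) (Z.m 1225054280783) (Z.m 1193722619898) (Z.p 96640178124) <|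
  NL.cons (Z.m 427388012625) (Z.m 1223463965898) (Z.m 1195624924438) (Z.p 94251788419) <|
  NL.nil

noncomputable def nodes11 : NL :=
  NL.cons (Z.m 427388012625) (Z.m 1223463965898) (Z.m 1195624924438) (Z.p 94251788419) <|
  NL.cons (Z.m 424192536164) (Z.m 1221807396968) (Z.m 1197554419266) (Z.p 91823231199) <|
  NL.cons (Z.m 420802253901) (Z.m 1219984683898) (Z.m 1199625266455) (Z.p 89212066786) <|
  NL.cons (Z.m 417403577637) (Z.m 1218094959270) (Z.m 1201722762543) (Z.p 86564309196) <|
  NL.cons (Z.m 413806164225) (Z.m 1216031776855) (Z.m 1203963169576) (Z.p 83734827416) <|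
  NL.cons (Z.m 410196898158) (Z.m 1213901938470) (Z.m 1206228709355) (Z.p 80874110255) <|
  NL.cons (Z.m 406383028589) (Z.m 1211591754129) (Z.m 1208638635460) (Z.p 77833545687) <|
  NL.cons (Z.m 402552790454) (Z.m 1209215488006) (Z.m 1211072114072) (Z.p 74767645741) <|
  NL.cons (Z.m 398508811048) (Z.m 1206651296783) (Z.m 1213652333139) (Z.p 71523475762) <|
  NL.cons (Z.m 394443265055) (Z.m 1204021803369) (Z.m 1216254334649) (Z.p 68260482213) <|
  NL.cons (Z.m 390547535733) (Z.m 1201458513278) (Z.m 1218752351820) (Z.p 65137379566) <|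
  NL.cons (Z.m 388394785930) (Z.m 1200025364841) (Z.m 1220133788854) (Z.p 63414696515) <|
  NL.cons (Z.m 384462841228) (Z.m 1197379811445) (Z.m 1222657357654) (Z.p 60276620720) <|
  NL.cons (Z.m 380504634640) (Z.m 1194683439171) (Z.m 1225196488639) (Z.p 57131608206) <|
  NL.cons (Z.m 376518358835) (Z.m 1191938025462) (Z.m 1227750326493) (Z.p 53981844934) <|
  NL.cons (Z.m 372502821702) (Z.m 1189145552801) (Z.m 1230317749280) (Z.p 50829752433) <|
  NL.cons (Z.m 368659630162) (Z.m 1186450576027) (Z.m 1232768623697) (Z.p 47834910682) <|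
  NL.cons (Z.m 364786728440) (Z.m 1183715269320) (Z.m 1235230848880) (Z.p 44840703952) <|
  NL.cons (Z.m 360883796276) (Z.m 1180941358911) (Z.m 1237703288772) (Z.p 41849216034) <|
  NL.cons (Z.m 356949782538) (Z.m 1178129929467) (Z.m 1240185350491) (Z.p 38861808610) <|
  NL.nil

noncomputable def nodes12 : NL :=
  NL.cons (Z.m 356949782538) (Z.m 1178129929467) (Z.m 1240185350491) (Z.p 38861808610) <|
  NL.cons (Z.m 352983696329) (Z.m 1175281985460) (Z.m 1242676474027) (Z.p 35879750194) <|
  NL.cons (Z.m 348983815491) (Z.m 1172397887162) (Z.m 1245176621167) (Z.p 32903639530) <|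
  NL.cons (Z.m 344949098707) (Z.m 1169478371542) (Z.m 1247685382551) (Z.p 29934479831) <|
  NL.cons (Z.m 340878991274) (Z.m 1166524426097) (Z.m 1250202103478) (Z.p 26973521044) <|
  NL.cons (Z.m 336771738037) (Z.m 1163536068912) (Z.m 1252726922564) (Z.p 24021042355) <|
  NL.cons (Z.m 332626628842) (Z.m 1160513981917) (Z.m 1255259377904) (Z.p 21077997607) <|
  NL.cons (Z.m 328441809837) (Z.m 1157457922726) (Z.m 1257799747492) (Z.p 18144452558) <|
  NL.cons (Z.m 324439608683) (Z.m 1154531564321) (Z.m 1260213584110) (Z.p 15374552381) <|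
  NL.cons (Z.m 320399495766) (Z.m 1151574773377) (Z.m 1262634501500) (Z.p 12613834745) <|
  NL.cons (Z.m 316320056396) (Z.m 1148587248037) (Z.m 1265062708996) (Z.p 9862348569) <|
  NL.cons (Z.m 312200001789) (Z.m 1145568712559) (Z.m 1267498358399) (Z.p 7120200727) <|
  NL.cons (Z.m 308038320787) (Z.m 1142519029233) (Z.m 1269941456075) (Z.p 4387653141) <|
  NL.cons (Z.m 303833786232) (Z.m 1139437836312) (Z.m 1272392154074) (Z.p 1664796090) <|
  NL.cons (Z.m 299592433367) (Z.m 1136330025964) (Z.m 1274846432979) (Z.m 1043697278) <|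
  NL.cons (Z.m 295313752525) (Z.m 1133195621321) (Z.m 1277304157388) (Z.m 3737526220) <|
  NL.cons (Z.m 290996274976) (Z.m 1130033868030) (Z.m 1279765763939) (Z.m 6417023454) <|
  NL.cons (Z.m 286638514300) (Z.m 1126843922001) (Z.m 1282231709354) (Z.m 9082538040) <|
  NL.cons (Z.m 282239258988) (Z.m 1123625060145) (Z.m 1284702305798) (Z.m 11734257575) <|
  NL.cons (Z.m 277809104965) (Z.m 1120385107488) (Z.m 1287171323857) (Z.m 14365420223) <|
  NL.nil

noncomputable def nodes13 : NL :=
  NL.cons (Z.m 277809104965) (Z.m 1120385107488) (Z.m 1287171323857) (Z.m 14365420223) <|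
  NL.cons (Z.m 273353432114) (Z.m 1117127970538) (Z.m 1289635622502) (Z.m 16972716352) <|
  NL.cons (Z.m 268871841704) (Z.m 1113853230893) (Z.m 1292095343928) (Z.m 19556373879) <|
  NL.cons (Z.m 264367352028) (Z.m 1110562865029) (Z.m 1294548801432) (Z.m 22114720897) <|
  NL.cons (Z.m 259840441922) (Z.m 1107256886128) (Z.m 1296995757048) (Z.m 24647634900) <|
  NL.cons (Z.m 255290698904) (Z.m 1103934543526) (Z.m 1299436487698) (Z.m 27155530793) <|
  NL.cons (Z.m 250717856810) (Z.m 1100595072114) (Z.m 1301871216997) (Z.m 29638763300) <|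
  NL.cons (Z.m 246121794523) (Z.m 1097237680564) (Z.m 1304300119775) (Z.m 32097632951) <|
  NL.cons (Z.m 241502514773) (Z.m 1093861522832) (Z.m 1306723337347) (Z.m 34532402656) <|
  NL.cons (Z.m 236860371835) (Z.m 1090465849205) (Z.m 1309140863579) (Z.m 36943185252) <|
  NL.cons (Z.m 232196106477) (Z.m 1087050014372) (Z.m 1311552535810) (Z.m 39329939569) <|
  NL.cons (Z.m 227510091128) (Z.m 1083612903230) (Z.m 1313958430903) (Z.m 41692863276) <|
  NL.cons (Z.m 222803490603) (Z.m 1080153755698) (Z.m 1316358272445) (Z.m 44031807785) <|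
  NL.cons (Z.m 218078262200) (Z.m 1076672141252) (Z.m 1318751448963) (Z.m 46346308491) <|
  NL.cons (Z.m 213335657696) (Z.m 1073166821730) (Z.m 1321137783466) (Z.m 48636332270) <|
  NL.cons (Z.m 208578524243) (Z.m 1069637408070) (Z.m 1323516381502) (Z.m 50901167997) <|
  NL.cons (Z.m 204339638978) (Z.m 1066478999943) (Z.m 1325623767281) (Z.m 52892930261) <|
  NL.cons (Z.m 199561064410) (Z.m 1062900321617) (Z.m 1327986560824) (Z.m 55109494375) <|
  NL.cons (Z.m 194778989501) (Z.m 1059296203601) (Z.m 1330338275705) (Z.m 57298220966) <|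
  NL.cons (Z.m 189998000843) (Z.m 1055665766369) (Z.m 1332677660670) (Z.m 59458171600) <|
  NL.nil

noncomputable def nodes14 : NL :=
  NL.cons (Z.m 189998000843) (Z.m 1055665766369) (Z.m 1332677660670) (Z.m 59458171600) <|
  NL.cons (Z.m 185224024734) (Z.m 1052008494166) (Z.m 1335002984879) (Z.m 61587999173) <|
  NL.cons (Z.m 180728811774) (Z.m 1048529989627) (Z.m 1337183980964) (Z.m 63570056944) <|
  NL.cons (Z.m 176537904935) (Z.m 1045251156178) (Z.m 1339210986358) (Z.m 65398606736) <|
  NL.cons (Z.m 172402236877) (Z.m 1041975800418) (Z.m 1341206446124) (Z.m 67185885317) <|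
  NL.cons (Z.m 168580448437) (Z.m 1038908018783) (Z.m 1343047348899) (Z.m 68823405248) <|
  NL.cons (Z.m 165067844287) (Z.m 1036047965188) (Z.m 1344737777284) (Z.m 70317451429) <|
  NL.cons (Z.m 161611835633) (Z.m 1033190074585) (Z.m 1346400667124) (Z.m 71778114437) <|
  NL.cons (Z.m 158459347965) (Z.m 1030539171007) (Z.m 1347918362454) (Z.m 73103357606) <|
  NL.cons (Z.m 155366077406) (Z.m 1027890727663) (Z.m 1349409523186) (Z.m 74398045737) <|
  NL.cons (Z.m 152568901085) (Z.m 1025449067455) (Z.m 1350760777242) (Z.m 75564881818) <|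
  NL.cons (Z.m 149834355895) (Z.m 1023012312750) (Z.m 1352085600716) (Z.m 76702944380) <|
  NL.cons (Z.m 147385451840) (Z.m 1020781741889) (Z.m 1353276417961) (Z.m 77720804700) <|
  NL.cons (Z.m 144998620234) (Z.m 1018556687053) (Z.m 1354442281427) (Z.m 78712606565) <|
  NL.cons (Z.m 142676718967) (Z.m 1016335912118) (Z.m 1355582776778) (Z.m 79678229465) <|
  NL.cons (Z.m 140627066656) (Z.m 1014321724495) (Z.m 1356596100019) (Z.m 80532295544) <|
  NL.cons (Z.m 138639906524) (Z.m 1012312540944) (Z.m 1357585837238) (Z.m 81362881343) <|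
  NL.cons (Z.m 136719234355) (Z.m 1010308548531) (Z.m 1358550915497) (Z.m 82169265162) <|
  NL.cons (Z.m 135050899550) (Z.m 1008509458246) (Z.m 1359397500528) (Z.m 82873710877) <|
  NL.cons (Z.m 133443236095) (Z.m 1006714961985) (Z.m 1360222250897) (Z.m 83557273509) <|
  NL.nil

noncomputable def nodes15 : NL :=
  NL.cons (Z.m 133443236095) (Z.m 1006714961985) (Z.m 1360222250897) (Z.m 83557273509) <|
  NL.cons (Z.m 131899969646) (Z.m 1004925504318) (Z.m 1361024091724) (Z.m 84219189689) <|
  NL.cons (Z.m 130424425704) (Z.m 1003140838909) (Z.m 1361802201506) (Z.m 84858905851) <|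
  NL.cons (Z.m 129173060764) (Z.m 1001558905284) (Z.m 1362472947809) (Z.m 85408193683) <|
  NL.cons (Z.m 127981272513) (Z.m 999981133768) (Z.m 1363123249546) (Z.m 85938727880) <|
  NL.cons (Z.m 126852448202) (Z.m 998408140804) (Z.m 1363752070505) (Z.m 86449742200) <|
  NL.cons (Z.m 125789397719) (Z.m 996839545302) (Z.m 1364358732535) (Z.m 86940760213) <|
  NL.cons (Z.m 124796049968) (Z.m 995276383806) (Z.m 1364941961676) (Z.m 87410820847) <|
  NL.cons (Z.m 123875743760) (Z.m 993718634103) (Z.m 1365500855511) (Z.m 87859261812) <|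
  NL.cons (Z.m 123133555854) (Z.m 992360756160) (Z.m 1365968920868) (Z.m 88233153031) <|
  NL.cons (Z.m 122452801804) (Z.m 991007737844) (Z.m 1366416706069) (Z.m 88589250595) <|
  NL.cons (Z.m 121836939543) (Z.m 989661695461) (Z.m 1366842855679) (Z.m 88926508314) <|
  NL.cons (Z.m 121287619796) (Z.m 988320795241) (Z.m 1367247264084) (Z.m 89244867443) <|
  NL.cons (Z.m 120808480784) (Z.m 986987718465) (Z.m 1367628419223) (Z.m 89543155705) <|
  NL.cons (Z.m 120401590047) (Z.m 985661108495) (Z.m 1367985998685) (Z.m 89821131996) <|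
  NL.cons (Z.m 120070024707) (Z.m 984342306288) (Z.m 1368318893379) (Z.m 90077934468) <|
  NL.cons (Z.m 119816430832) (Z.m 983031185611) (Z.m 1368626380227) (Z.m 90312996115) <|
  NL.cons (Z.m 119643743593) (Z.m 981729084003) (Z.m 1368907386527) (Z.m 90525476769) <|
  NL.cons (Z.m 119562212133) (Z.m 980621979453) (Z.m 1369126258504) (Z.m 90688919861) <|
  NL.cons (Z.m 119543572853) (Z.m 979522687310) (Z.m 1369324483001) (Z.m 90834833065) <|
  NL.nil

noncomputable def nodes16 : NL :=
  NL.cons (Z.m 119543572853) (Z.m 979522687310) (Z.m 1369324483001) (Z.m 90834833065) <|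
  NL.cons (Z.m 119589000349) (Z.m 978436429927) (Z.m 1369500813053) (Z.m 90962281052) <|
  NL.cons (Z.m 119698913362) (Z.m 977364659339) (Z.m 1369654888758) (Z.m 91071001660) <|
  NL.cons (Z.m 119873700380) (Z.m 976306923016) (Z.m 1369786688016) (Z.m 91160975730) <|
  NL.cons (Z.m 120113298244) (Z.m 975264719810) (Z.m 1369895979968) (Z.m 91232042535) <|
  NL.cons (Z.m 120418152408) (Z.m 974236613878) (Z.m 1369982887128) (Z.m 91284275511) <|
  NL.cons (Z.m 120787786848) (Z.m 973224275625) (Z.m 1370047264496) (Z.m 91317581173) <|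
  NL.cons (Z.m 121221658969) (Z.m 972228364396) (Z.m 1370089159354) (Z.m 91332003990) <|
  NL.cons (Z.m 121719713662) (Z.m 971248125955) (Z.m 1370108712740) (Z.m 91327633668) <|
  NL.cons (Z.m 122380278691) (Z.m 970126034727) (Z.m 1370103465374) (Z.m 91298945585) <|
  NL.cons (Z.m 123124250287) (Z.m 969028457791) (Z.m 1370068414032) (Z.m 91245201430) <|
  NL.cons (Z.m 123950528225) (Z.m 967954435679) (Z.m 1370004027767) (Z.m 91166738522) <|
  NL.cons (Z.m 124856777106) (Z.m 966904501846) (Z.m 1369910884839) (Z.m 91064014361) <|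
  NL.cons (Z.m 125840812083) (Z.m 965878604982) (Z.m 1369789614147) (Z.m 90937512518) <|
  NL.cons (Z.m 126898888444) (Z.m 964877901611) (Z.m 1369641105508) (Z.m 90787963512) <|
  NL.cons (Z.m 128028266104) (Z.m 963902127205) (Z.m 1369466186978) (Z.m 90616011633) <|
  NL.cons (Z.m 129227013891) (Z.m 962950285932) (Z.m 1369265563960) (Z.m 90422177639) <|
  NL.cons (Z.m 130492027653) (Z.m 962022324900) (Z.m 1369040133781) (Z.m 90207167147) <|
  NL.cons (Z.m 131820831111) (Z.m 961117634319) (Z.m 1368790697576) (Z.m 89971590354) <|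
  NL.cons (Z.m 133414227516) (Z.m 960111537300) (Z.m 1368477289602) (Z.m 89677987672) <|
  NL.nil

noncomputable def nodes17 : NL :=
  NL.cons (Z.m 133414227516) (Z.m 960111537300) (Z.m 1368477289602) (Z.m 89677987672) <|
  NL.cons (Z.m 135084068283) (Z.m 959134151647) (Z.m 1368134744329) (Z.m 89359211488) <|
  NL.cons (Z.m 136827578956) (Z.m 958184176064) (Z.m 1367764040850) (Z.m 89015978964) <|
  NL.cons (Z.m 138640232415) (Z.m 957261330516) (Z.m 1367366520512) (Z.m 88649347394) <|
  NL.cons (Z.m 140518435152) (Z.m 956364817734) (Z.m 1366943330681) (Z.m 88260198286) <|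
  NL.cons (Z.m 142459330774) (Z.m 955493565623) (Z.m 1366495441978) (Z.m 87849256892) <|
  NL.cons (Z.m 144709531937) (Z.m 954544328616) (Z.m 1365964349140) (Z.m 87362814842) <|
  NL.cons (Z.m 147026521224) (Z.m 953626279097) (Z.m 1365405772325) (Z.m 86851835724) <|
  NL.cons (Z.m 149404114371) (Z.m 952738805532) (Z.m 1364821616778) (Z.m 86317861653) <|
  NL.cons (Z.m 151836781360) (Z.m 951881066415) (Z.m 1364213636860) (Z.m 85762309718) <|
  NL.cons (Z.m 154599785145) (Z.m 950961235243) (Z.m 1363511742757) (Z.m 85120958429) <|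
  NL.cons (Z.m 157420400053) (Z.m 950074972065) (Z.m 1362783959327) (Z.m 84455758883) <|
  NL.cons (Z.m 160293519349) (Z.m 949220798726) (Z.m 1362032019530) (Z.m 83768098368) <|
  NL.cons (Z.m 163509588217) (Z.m 948316423399) (Z.m 1361178742782) (Z.m 82987124291) <|
  NL.cons (Z.m 166776368987) (Z.m 947447762112) (Z.m 1360300535101) (Z.m 82182476238) <|
  NL.cons (Z.m 170088634309) (Z.m 946613075602) (Z.m 1359399229486) (Z.m 81355644187) <|
  NL.cons (Z.m 173746940522) (Z.m 945739666889) (Z.m 1358391996527) (Z.m 80430306680) <|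
  NL.cons (Z.m 177440931123) (Z.m 944904345721) (Z.m 1357363294513) (Z.m 79483709157) <|
  NL.cons (Z.m 181163172211) (Z.m 944105560322) (Z.m 1356315678122) (Z.m 78518046156) <|
  NL.cons (Z.m 185220280964) (Z.m 943279565912) (Z.m 1355161970998) (Z.m 77452601073) <|
  NL.nil

noncomputable def nodes18 : NL :=
  NL.cons (Z.m 185220280964) (Z.m 943279565912) (Z.m 1355161970998) (Z.m 77452601073) <|
  NL.cons (Z.m 189292231490) (Z.m 942493336744) (Z.m 1353992346889) (Z.m 76370292173) <|
  NL.cons (Z.m 193688327193) (Z.m 941688576572) (Z.m 1352717193813) (Z.m 75187828378) <|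
  NL.cons (Z.m 198091043087) (Z.m 940924772861) (Z.m 1351427862191) (Z.m 73989556125) <|
  NL.cons (Z.m 202495892486) (Z.m 940199617375) (Z.m 1350126218110) (Z.m 72777136333) <|
  NL.cons (Z.m 207213800729) (Z.m 939463103815) (Z.m 1348719673311) (Z.m 71463974570) <|
  NL.cons (Z.m 211925877601) (Z.m 938766179258) (Z.m 1347302599394) (Z.m 70137832557) <|
  NL.cons (Z.m 216940815570) (Z.m 938064176889) (Z.m 1345781498931) (Z.m 68710869822) <|
  NL.cons (Z.m 221940413251) (Z.m 937402632164) (Z.m 1344252235896) (Z.m 67272687735) <|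
  NL.cons (Z.m 227232494057) (Z.m 936741690376) (Z.m 1342620032829) (Z.m 65733830386) <|
  NL.cons (Z.m 232500996260) (Z.m 936121747206) (Z.m 1340981755017) (Z.m 64185313715) <|
  NL.cons (Z.m 237742999801) (Z.m 935540807273) (Z.m 1339338868509) (Z.m 62628572091) <|
  NL.cons (Z.m 243261883616) (Z.m 934966194801) (Z.m 1337595707200) (Z.m 60972676435) <|
  NL.cons (Z.m 248746142705) (Z.m 934431343127) (Z.m 1335850082766) (Z.m 59310277064) <|
  NL.cons (Z.m 254495888583) (Z.m 933907957372) (Z.m 1334005916147) (Z.m 57549625598) <|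
  NL.cons (Z.m 260203829928) (Z.m 933425062936) (Z.m 1332161215143) (Z.m 55784056204) <|
  NL.cons (Z.m 265868680465) (Z.m 932981030980) (Z.m 1330316939642) (Z.m 54014611860) <|
  NL.cons (Z.m 271779066010) (Z.m 932554369154) (Z.m 1328378606554) (Z.m 52150447143) <|
  NL.cons (Z.m 277624117606) (Z.m 932168599929) (Z.m 1326447706158) (Z.m 50289006107) <|
  NL.cons (Z.m 283690450083) (Z.m 931805821120) (Z.m 1324429160104) (Z.m 48338503884) <|
  NL.nil

noncomputable def nodes19 : NL :=
  NL.cons (Z.m 283690450083) (Z.m 931805821120) (Z.m 1324429160104) (Z.m 48338503884) <|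
  NL.cons (Z.m 289684215593) (Z.m 931484727999) (Z.m 1322420350451) (Z.m 46392931049) <|
  NL.cons (Z.m 295605677805) (Z.m 931203882145) (Z.m 1320421819472) (Z.m 44453037889) <|
  NL.cons (Z.m 301731965794) (Z.m 930951478752) (Z.m 1318339650556) (Z.m 42427596714) <|
  NL.cons (Z.m 307779643243) (Z.m 930740674355) (Z.m 1316269789483) (Z.m 40409893038) <|
  NL.cons (Z.m 313749134021) (Z.m 930570458114) (Z.m 1314212682036) (Z.m 38400621787) <|
  NL.cons (Z.m 319640856358) (Z.m 930440010837) (Z.m 1312168736214) (Z.m 36400443968) <|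
  NL.cons (Z.m 325455048217) (Z.m 930348699270) (Z.m 1310138385986) (Z.m 34410050216) <|
  NL.cons (Z.m 331191865355) (Z.m 930296066051) (Z.m 1308122060606) (Z.m 32430132343) <|
  NL.cons (Z.m 337106678128) (Z.m 930282089565) (Z.m 1306029584468) (Z.m 30372216509) <|
  NL.cons (Z.m 342933408621) (Z.m 930309925893) (Z.m 1303954670114) (Z.m 28328579751) <|
  NL.cons (Z.m 348669678246) (Z.m 930379551639) (Z.m 1301898644979) (Z.m 26300876017) <|
  NL.cons (Z.m 354314885590) (Z.m 930491135529) (Z.m 1299862179736) (Z.m 24290129263) <|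
  NL.cons (Z.m 359628892519) (Z.m 930637483609) (Z.m 1297933146726) (Z.m 22383603606) <|
  NL.cons (Z.m 364858237247) (Z.m 930823103766) (Z.m 1296023226153) (Z.m 20494491632) <|
  NL.cons (Z.m 370002209141) (Z.m 931048742528) (Z.m 1294132991019) (Z.m 18623730470) <|
  NL.cons (Z.m 375058817928) (Z.m 931315313200) (Z.m 1292263459273) (Z.m 16772721838) <|
  NL.cons (Z.m 380027163536) (Z.m 931624025198) (Z.m 1290415221021) (Z.m 14942471788) <|
  NL.cons (Z.m 384685440826) (Z.m 931959317426) (Z.m 1288671769923) (Z.m 13216099562) <|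
  NL.cons (Z.m 388394785930) (Z.m 932260812291) (Z.m 1287275902638) (Z.m 11834281431) <|
  NL.nil

noncomputable def chunk : Nat → NL
  | 1 => nodes1
  | 2 => nodes2
  | 3 => nodes3
  | 4 => nodes4
  | 5 => nodes5
  | 6 => nodes6
  | 7 => nodes7
  | 8 => nodes8
  | 9 => nodes9
  | 10 => nodes10
  | 11 => nodes11
  | 12 => nodes12
  | 13 => nodes13
  | 14 => nodes14
  | 15 => nodes15
  | 16 => nodes16
  | 17 => nodes17
  | 18 => nodes18
  | 19 => nodes19
  | _ => nodes0

noncomputable def nd (k : Nat) : Node := (chunk (k / 19)).get (k % 19)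

noncomputable def cellK (k : Nat) (X Y : Node) : Bool :=
  and (orOK (qd k) X Y) (cellOK X Y)

/-- check consecutive cells -/
noncomputable def chk (l : NL) : Node → Nat → Bool :=
  NL.rec (motive := fun _ => Node → Nat → Bool) (fun _ _ => true)
    (fun x0 x1 x2 w _ ih X k => Bool.rec (motive := fun _ => Bool) false
      (ih ⟨x0, x1, x2, w⟩ (Nat.succ k)) (cellK k X ⟨x0, x1, x2, w⟩)) l

noncomputable def chkC (l : NL) (k : Nat) : Bool :=
  NL.rec (motive := fun _ => Bool) false
    (fun x0 x1 x2 w t _ => chk t ⟨x0, x1, x2, w⟩ k) l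


set_option maxRecDepth 100000

theorem chunk_ok0 : chkC nodes0 0 = true := by decide +kernel
theorem chunk_ok1 : chkC nodes1 19 = true := by decide +kernel
theorem chunk_ok2 : chkC nodes2 38 = true := by decide +kernel
theorem chunk_ok3 : chkC nodes3 57 = true := by decide +kernel
theorem chunk_ok4 : chkC nodes4 76 = true := by decide +kernel
theorem chunk_ok5 : chkC nodes5 95 = true := by decide +kernel
theorem chunk_ok6 : chkC nodes6 114 = true := by decide +kernel
theorem chunk_ok7 : chkC nodes7 133 = true := by decide +kernel
theorem chunk_ok8 : chkC nodes8 152 = true := by decide +kernel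
theorem chunk_ok9 : chkC nodes9 171 = true := by decide +kernel
theorem chunk_ok10 : chkC nodes10 190 = true := by decide +kernel
theorem chunk_ok11 : chkC nodes11 209 = true := by decide +kernel
theorem chunk_ok12 : chkC nodes12 228 = true := by decide +kernel
theorem chunk_ok13 : chkC nodes13 247 = true := by decide +kernel
theorem chunk_ok14 : chkC nodes14 266 = true := by decide +kernel
theorem chunk_ok15 : chkC nodes15 285 = true := by decide +kernel
theorem chunk_ok16 : chkC nodes16 304 = true := by decide +kernel
theorem chunk_ok17 : chkC nodes17 323 = true := by decide +kernel
theorem chunk_ok18 : chkC nodes18 342 = true := by decide +kernel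
theorem chunk_ok19 : chkC nodes19 361 = true := by decide +kernel

end Lom

set_option linter.unusedSimpArgs false
namespace Lom

/-! ### Soundness of the integer arithmetic -/

noncomputable def Z.toR : Z → ℝ
  | Z.p n => (n : ℝ)
  | Z.m n => -(n : ℝ)

theorem Z.toR_mul (a b : Z) : (Z.mul a b).toR = a.toR * b.toR := by
  cases a <;> cases b <;> simp [Z.mul, Z.toR]

theorem Z.toR_dif (x y : Nat) : (Z.dif x y).toR = (x : ℝ) - y := by
  unfold Z.dif
  cases h : Nat.ble y x
  · have h' : x ≤ y := by
      by_contra hc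
      have : Nat.ble y x = true := Nat.ble_eq_true_of_le (by omega)
      simp [h] at this
    simp only [Z.toR]
    rw [show Nat.sub y x = y - x from rfl, Nat.cast_sub h']; ring
  · have h' : y ≤ x := Nat.le_of_ble_eq_true h
    simp only [Z.toR]
    rw [show Nat.sub x y = x - y from rfl, Nat.cast_sub h']

theorem Z.toR_add (a b : Z) : (Z.add a b).toR = a.toR + b.toR := by
  cases a <;> cases b <;> simp only [Z.add, Z.toR_dif] <;> simp [Z.toR] <;> ring

theorem Z.toR_neg (a : Z) : (Z.neg a).toR = -a.toR := by
  cases a <;> simp [Z.neg, Z.toR]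

theorem Z.toR_sub (a b : Z) : (Z.sub a b).toR = a.toR - b.toR := by
  rw [Z.sub, Z.toR_add, Z.toR_neg]; ring

theorem Z.abs_toR (a : Z) : |a.toR| = (a.abs : ℝ) := by
  cases a <;> simp [Z.abs, Z.toR]

theorem nat_div_le (n k : ℕ) : ((n / k : ℕ) : ℝ) ≤ (n : ℝ) / k := Nat.cast_div_le

theorem nat_lt_div (n k : ℕ) (hk : 0 < k) : (n : ℝ) / k ≤ ((n / k : ℕ) : ℝ) + 1 := by
  have hk' : (0 : ℝ) < k := by exact_mod_cast hk
  rw [div_le_iff₀ hk']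
  have := Nat.lt_div_mul_add (a := n) hk
  have h2 : n ≤ (n / k + 1) * k := by nlinarith
  exact_mod_cast h2

theorem Z.dv_err (a : Z) (k : Nat) (hk : 0 < k) : |(a.dv k).toR - a.toR / k| ≤ 1 := by
  cases a with
  | p n =>
    simp only [Z.dv, Z.toR]
    have h1 := nat_div_le n k
    have h2 := nat_lt_div n k hk
    rw [show Nat.div n k = n / k from rfl, abs_le]
    constructor <;> linarith
  | m n =>
    simp only [Z.dv, Z.toR]
    have h1 := nat_div_le n k
    have h2 := nat_lt_div n k hk
    rw [show Nat.div n k = n / k from rfl, abs_le, neg_div]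
    constructor <;> linarith

theorem Z.geN_le (a : Z) (n : Nat) (h : Z.geN a n = true) : (n : ℝ) ≤ a.toR := by
  cases a with
  | p x => simp only [Z.geN] at h; simpa [Z.toR] using Nat.le_of_ble_eq_true h
  | m x => simp [Z.geN] at h

/-! ### Noise lists -/

/-- the scale -/
noncomputable abbrev sc : ℝ := 1099511627776

theorem sc_pos : (0 : ℝ) < sc := by norm_num [sc]

def mg (b : Bool) (m u : Nat) : ℝ := if b then (u : ℝ) else (m : ℝ)

theorem mg_nonneg (b : Bool) (m u : Nat) : 0 ≤ mg b m u := by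
  unfold mg; split <;> positivity

def rep (b : Bool) : EL → ℝ → ℝ → ℝ → Prop
  | EL.nil, X, Y, W => X = 0 ∧ Y = 0 ∧ W = 0
  | EL.cons x y z m u t, X, Y, W => ∃ ξ : ℝ, |ξ| ≤ mg b m u ∧
      rep b t (X - x.toR * ξ / sc) (Y - y.toR * ξ / sc) (W - z.toR * ξ / sc)

noncomputable def tot (b : Bool) : EL → ℝ
  | EL.nil => 0
  | EL.cons _ _ _ m u t => mg b m u + tot b t

theorem goL_cons (A B x y z : Z) (m u : Nat) (t : EL) :
    goL A B (EL.cons x y z m u t) = ⟨EL.cons (lin A B x y z) x y m u (goL A B t).l,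
      (goL A B t).s1 + (lin A B x y z).abs * m, (goL A B t).s2 + (lin A B x y z).abs * u⟩ := rfl

theorem lin_err (A B x y z : Z) :
    |(lin A B x y z).toR - ((A.toR * x.toR + B.toR * y.toR) / sc + z.toR)| ≤ 1 := by
  have h := Z.dv_err (Z.add (Z.mul A x) (Z.mul B y)) 1099511627776 (by norm_num)
  rw [Z.toR_add, Z.toR_mul, Z.toR_mul] at h
  rw [lin, Z.toR_add]
  push_cast at h
  have e : ∀ a b c : ℝ, a + c - (b + c) = a - b := by intros; ring
  rw [e]; exact h

theorem tot_goL (b : Bool) (A B : Z) (l : EL) : tot b (goL A B l).l = tot b l := by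
  induction l with
  | nil => rfl
  | cons x y z m u t ih => rw [goL_cons]; simp only [tot, ih]

theorem goL_rep (b : Bool) (A B : Z) (l : EL) : ∀ X Y W : ℝ, rep b l X Y W →
    ∃ err : ℝ, |err| ≤ tot b l / sc ∧
      rep b (goL A B l).l ((A.toR * X + B.toR * Y) / sc + W + err) X Y := by
  induction l with
  | nil =>
    rintro X Y W ⟨rfl, rfl, rfl⟩
    refine ⟨0, by simp [tot], ?_⟩
    change _ ∧ _ ∧ _
    simp
  | cons x y z m u t ih =>
    rintro X Y W ⟨ξ, hξ, hr⟩
    obtain ⟨e, he, h2⟩ := ih _ _ _ hr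
    have hl := lin_err A B x y z
    set w := lin A B x y z with hw
    refine ⟨e + (w.toR - ((A.toR * x.toR + B.toR * y.toR) / sc + z.toR)) * ξ / sc, ?_, ?_⟩
    · have h3 : |(w.toR - ((A.toR * x.toR + B.toR * y.toR) / sc + z.toR)) * ξ / sc| ≤ mg b m u / sc := by
        rw [abs_div, abs_mul, abs_of_pos sc_pos]
        apply div_le_div_of_nonneg_right _ sc_pos.le
        have := mul_le_mul hl hξ (abs_nonneg _) zero_le_one
        simpa using this
      refine (abs_add_le _ _).trans ?_
      simp only [tot]
      rw [add_div (mg b m u)]; linarith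
    · rw [goL_cons]
      refine ⟨ξ, hξ, ?_⟩
      rw [← hw]
      convert h2 using 1
      field_simp
      ring

noncomputable def smT (b : Bool) (g : Tr) : ℝ := if b then (g.s2 : ℝ) else (g.s1 : ℝ)
noncomputable def smP (b : Bool) (g : Pr) : ℝ := if b then (g.s2 : ℝ) else (g.s1 : ℝ)

theorem abs_split (x ξ X s m S : ℝ) (a : ℕ) (ha : |x| = a) (h : |X - x * ξ / sc| ≤ s / sc)
    (hm : |ξ| ≤ m) (hS : S = s + a * m) : |X| ≤ S / sc := by
  have h1 : |x * ξ / sc| ≤ a * m / sc := by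
    rw [abs_div, abs_mul, abs_of_pos sc_pos, ha]
    apply div_le_div_of_nonneg_right _ sc_pos.le
    exact mul_le_mul_of_nonneg_left hm (by positivity)
  have h2 : X = (X - x * ξ / sc) + x * ξ / sc := by ring
  rw [h2, hS, add_div]
  exact (abs_add_le _ _).trans (add_le_add h h1)

theorem goL_bound (b : Bool) (A B : Z) (l : EL) : ∀ X Y W : ℝ, rep b (goL A B l).l X Y W →
    |X| ≤ smT b (goL A B l) / sc := by
  induction l with
  | nil =>
    rintro X Y W ⟨rfl, rfl, rfl⟩
    simp [smT, goL]
  | cons x y z m u t ih =>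
    intro X Y W h
    rw [goL_cons] at h ⊢
    obtain ⟨ξ, hξ, hr⟩ := h
    refine abs_split _ ξ X _ _ _ _ (Z.abs_toR _) (ih _ _ _ hr) hξ ?_
    cases b <;> simp [smT, mg]

theorem dotL_cons (a b c x y z : Z) (m u : Nat) (t : EL) :
    dotL a b c (EL.cons x y z m u t) =
      ⟨(dotL a b c t).s1 + (dot a b c x y z).abs * m,
       (dotL a b c t).s2 + (dot a b c x y z).abs * u⟩ := rfl

theorem dot_toR (a b c x y z : Z) :
    (dot a b c x y z).toR = a.toR * x.toR + (b.toR * y.toR + c.toR * z.toR) := by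
  simp only [dot, Z.toR_add, Z.toR_mul]

theorem dotL_bound (β : Bool) (a b c : Z) (l : EL) : ∀ X Y W : ℝ, rep β l X Y W →
    |a.toR * X + (b.toR * Y + c.toR * W)| ≤ smP β (dotL a b c l) / sc := by
  induction l with
  | nil =>
    rintro X Y W ⟨rfl, rfl, rfl⟩
    simp [smP, dotL]
  | cons x y z m u t ih =>
    rintro X Y W ⟨ξ, hξ, hr⟩
    rw [dotL_cons]
    refine abs_split (dot a b c x y z).toR ξ _ (smP β (dotL a b c t)) _ _ _ (Z.abs_toR _) ?_ hξ ?_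
    · convert ih _ _ _ hr using 2
      rw [dot_toR]; ring
    · cases β <;> simp [smP, mg]

end Lom

namespace Lom

/-! ### Soundness of one step -/

/-- scaled nonlinearity -/
noncomputable def Hs (q : Par) (X Y : ℝ) : ℝ :=
  (sc * (q.al.toR * sc + (q.t1.toR * X + q.t2.toR * Y)) +
    (q.a.toR * (X * X) + (q.b.toR * (X * Y) + q.c.toR * (Y * Y)))) / 109951162777600000

noncomputable def quadR (q : Par) (X Y : ℝ) : ℝ :=
  q.a.toR * (X * X) + (q.b.toR * (X * Y) + q.c.toR * (Y * Y))

theorem quad_toR (q : Par) (x y : Z) : (quad q x y).toR = quadR q x.toR y.toR := by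
  simp only [quad, quadR, Z.toR_add, Z.toR_mul]

theorem nxt_err (q : Par) (x y z : Z) :
    |(nxt q x y z).toR - (z.toR + Hs q x.toR y.toR)| ≤ 1 := by
  have h := Z.dv_err (Z.add (Z.mul zS (Z.add (Z.mul q.al zS) (Z.add (Z.mul q.t1 x) (Z.mul q.t2 y))))
    (quad q x y)) 109951162777600000 (by norm_num)
  rw [nxt, Z.toR_add]
  rw [show ∀ a b c : ℝ, a + b - (a + c) = b - c by intros; ring]
  convert h using 3
  simp only [Hs, Z.toR_add, Z.toR_mul, quad, show zS.toR = sc by simp [Z.toR]]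
  norm_num

/-- scaled midpoint partial derivatives -/
noncomputable def dA (q : Par) (X Y : ℝ) : ℝ :=
  (q.t1.toR * sc + (2 * q.a.toR * X + q.b.toR * Y)) / 100000
noncomputable def dB (q : Par) (X Y : ℝ) : ℝ :=
  (q.t2.toR * sc + (q.b.toR * X + 2 * q.c.toR * Y)) / 100000

theorem cA_err (q : Par) (x y : Z) :
    |(cA q x y).toR - dA q (x.toR / 2) (y.toR / 2)| ≤ 1 := by
  have h := Z.dv_err (Z.add (Z.mul q.t1 (Z.p 2199023255552)) (Z.add (Z.mul (Z.mul q.a x) (Z.p 2))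
    (Z.mul q.b y))) 200000 (by norm_num)
  rw [cA]
  convert h using 3
  simp only [dA, Z.toR_add, Z.toR_mul]
  simp only [Z.toR, sc]
  push_cast
  ring

theorem cB_err (q : Par) (x y : Z) :
    |(cB q x y).toR - dB q (x.toR / 2) (y.toR / 2)| ≤ 1 := by
  have h := Z.dv_err (Z.add (Z.mul q.t2 (Z.p 2199023255552)) (Z.add (Z.mul q.b x)
    (Z.mul (Z.mul q.c y) (Z.p 2)))) 200000 (by norm_num)
  rw [cB]
  convert h using 3
  simp only [dB, Z.toR_add, Z.toR_mul]
  simp only [Z.toR, sc]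
  push_cast
  ring

theorem Hs_diff (q : Par) (X Y X' Y' : ℝ) :
    Hs q X Y - Hs q X' Y' =
      (dA q ((X + X') / 2) ((Y + Y') / 2) * (X - X') + dB q ((X + X') / 2) ((Y + Y') / 2) * (Y - Y')) / sc := by
  simp only [Hs, dA, dB, sc]
  ring

theorem Hs_conv (q : Par) (X Y X' Y' t : ℝ) :
    Hs q ((1 - t) * X + t * X') ((1 - t) * Y + t * Y') =
      (1 - t) * Hs q X Y + t * Hs q X' Y' - t * (1 - t) * (quadR q (X - X') (Y - Y') / 109951162777600000) := by
  simp only [Hs, quadR, sc]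
  ring

theorem nat_lt_div_real (n : ℕ) (k : ℕ) (hk : 0 < k) (x : ℝ) (h : x ≤ n) :
    x / k ≤ ((n / k : ℕ) : ℝ) + 1 := by
  have hk' : (0 : ℝ) < k := by exact_mod_cast hk
  exact (div_le_div_of_nonneg_right h hk'.le).trans (nat_lt_div n k hk)

/-- the basic estimate behind `noise` -/
theorem noise_ge (q : Par) (D0 D1 r0 r1 T : ℕ) (E0 E1 α β x y : ℝ)
    (h0 : |E0| ≤ D0) (h1 : |E1| ≤ D1)
    (hα : |α - (2 * q.a.toR * E0 + q.b.toR * E1) / 100000| ≤ 1)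
    (hβ : |β - (q.b.toR * E0 + 2 * q.c.toR * E1) / 100000| ≤ 1)
    (hx : |x| ≤ r0) (hy : |y| ≤ r1) :
    |(α * x + β * y) / sc| + T / sc + 4 ≤ (noise q D0 D1 r0 r1 T : ℕ) := by
  have ha : |q.a.toR * E0| ≤ q.a.abs * D0 := by
    rw [abs_mul, Z.abs_toR]; gcongr
  have hb : |q.b.toR * E1| ≤ q.b.abs * D1 := by
    rw [abs_mul, Z.abs_toR]; gcongr
  have hb' : |q.b.toR * E0| ≤ q.b.abs * D0 := by
    rw [abs_mul, Z.abs_toR]; gcongr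
  have hc : |q.c.toR * E1| ≤ q.c.abs * D1 := by
    rw [abs_mul, Z.abs_toR]; gcongr
  have k1 := nat_lt_div (2 * q.a.abs * D0 + q.b.abs * D1) 100000 (by norm_num)
  have k2 := nat_lt_div (q.b.abs * D0 + 2 * q.c.abs * D1) 100000 (by norm_num)
  set n1 := (2 * q.a.abs * D0 + q.b.abs * D1) / 100000
  set n2 := (q.b.abs * D0 + 2 * q.c.abs * D1) / 100000
  push_cast at k1 k2
  rw [abs_le] at ha hb hb' hc hα hβ
  have hα' : |α| ≤ n1 + 2 := by
    rw [abs_le]; constructor <;> linarith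
  have hβ' : |β| ≤ n2 + 2 := by
    rw [abs_le]; constructor <;> linarith
  have hs : |α * x + β * y| ≤ (n1 + 2) * r0 + (n2 + 2) * r1 := by
    refine (abs_add_le _ _).trans ?_
    rw [abs_mul, abs_mul]
    gcongr
  have k3 := nat_lt_div ((n1 + 2) * r0 + (n2 + 2) * r1 + T) 1099511627776 (by norm_num)
  have k4 : |(α * x + β * y) / sc| + T / sc ≤ ((((n1 + 2) * r0 + (n2 + 2) * r1 + T : ℕ)) : ℝ) / (1099511627776 : ℕ) := by
    rw [abs_div, abs_of_pos sc_pos, ← add_div]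
    push_cast
    gcongr
  have : ((noise q D0 D1 r0 r1 T : ℕ) : ℝ) = (((n1 + 2) * r0 + (n2 + 2) * r1 + T) / 1099511627776 : ℕ) + 5 := by
    unfold noise; push_cast; rfl
  rw [this]
  linarith

/-- existence invariant -/
structure EInv (r : ℕ) (σ : St) (t μ X Y W : ℝ) : Prop where
  h : ∃ a b c : ℝ, rep false σ.L a b c ∧
    X = (1 - t) * σ.P0.toR + t * σ.Q0.toR + μ * σ.M0.toR / sc + t * (1 - t) * σ.T0.toR + a ∧
    Y = (1 - t) * σ.P1.toR + t * σ.Q1.toR + μ * σ.M1.toR / sc + t * (1 - t) * σ.T1.toR + b ∧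
    W = (1 - t) * σ.P2.toR + t * σ.Q2.toR + μ * σ.M2.toR / sc + t * (1 - t) * σ.T2.toR + c
  h0 : |X - ((1 - t) * σ.P0.toR + t * σ.Q0.toR)| ≤ σ.rE0
  h1 : |Y - ((1 - t) * σ.P1.toR + t * σ.Q1.toR)| ≤ σ.rE1
  hT : tot false σ.L + r + sc / 4 ≤ σ.TE

/-- uniqueness invariant, for differences -/
structure UInv (σ : St) (x y w : ℝ) : Prop where
  h : ∃ a b c : ℝ, rep true σ.L a b c ∧ x = σ.M0.toR + a ∧ y = σ.M1.toR + b ∧ w = σ.M2.toR + c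
  h0 : |x| ≤ σ.rU0
  h1 : |y| ≤ σ.rU1
  hT : tot true σ.L + sc ≤ σ.TU

theorem half_nat (n : ℕ) : (n : ℝ) / 2 ≤ ((n / 2 + 1 : ℕ) : ℝ) := by
  have := nat_lt_div n 2 (by norm_num)
  push_cast at this ⊢; exact this

theorem dA_shift (q : Par) (A X Y X' Y' : ℝ) (h : |A - dA q X' Y'| ≤ 1) :
    |dA q X Y - A - (2 * q.a.toR * (X - X') + q.b.toR * (Y - Y')) / 100000| ≤ 1 := by
  rw [abs_sub_comm] at h
  convert h using 2
  simp only [dA]; ring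

theorem dB_shift (q : Par) (A X Y X' Y' : ℝ) (h : |A - dB q X' Y'| ≤ 1) :
    |dB q X Y - A - (q.b.toR * (X - X') + 2 * q.c.toR * (Y - Y')) / 100000| ≤ 1 := by
  rw [abs_sub_comm] at h
  convert h using 2
  simp only [dB]; ring

theorem tt_bound {t : ℝ} (h0 : 0 ≤ t) (h1 : t ≤ 1) : 0 ≤ t * (1 - t) ∧ t * (1 - t) ≤ 1 / 4 := by
  constructor
  · exact mul_nonneg h0 (by linarith)
  · nlinarith [sq_nonneg (t - 1 / 2)]

theorem abs_le_add3 {a b c x y z w : ℝ} (hw : w = a + b + c) (ha : |a| ≤ x) (hb : |b| ≤ y) (hc : |c| ≤ z) :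
    |w| ≤ x + y + z := by
  rw [hw]
  exact (abs_add_three _ _ _).trans (by linarith)

theorem stp_E (q : Par) (r : ℕ) (σ : St) (t μ X Y W : ℝ) (ht0 : 0 ≤ t) (ht1 : t ≤ 1)
    (hμ : |μ| ≤ r) (h : EInv r σ t μ X Y W) :
    EInv r (stp q r σ) t μ (W + Hs q X Y) X Y := by
  obtain ⟨⟨a, b, c, hr, hX, hY, hW⟩, hX0, hY0, hT⟩ := h
  have hA := cA_err q (Z.add σ.P0 σ.Q0) (Z.add σ.P1 σ.Q1)
  have hB := cB_err q (Z.add σ.P0 σ.Q0) (Z.add σ.P1 σ.Q1)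
  have hst : stp q r σ = stp1 q r σ (cA q (Z.add σ.P0 σ.Q0) (Z.add σ.P1 σ.Q1))
    (cB q (Z.add σ.P0 σ.Q0) (Z.add σ.P1 σ.Q1)) (Z.sub σ.P0 σ.Q0) (Z.sub σ.P1 σ.Q1) := rfl
  rw [hst]
  set A := cA q (Z.add σ.P0 σ.Q0) (Z.add σ.P1 σ.Q1)
  set B := cB q (Z.add σ.P0 σ.Q0) (Z.add σ.P1 σ.Q1)
  rw [Z.toR_add, Z.toR_add] at hA hB
  have hd0 : |σ.P0.toR - σ.Q0.toR| = ((Z.sub σ.P0 σ.Q0).abs : ℝ) := by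
    rw [← Z.abs_toR, Z.toR_sub]
  have hd1 : |σ.P1.toR - σ.Q1.toR| = ((Z.sub σ.P1 σ.Q1).abs : ℝ) := by
    rw [← Z.abs_toR, Z.toR_sub]
  have hq : |(Z.dv (quad q (Z.sub σ.P0 σ.Q0) (Z.sub σ.P1 σ.Q1)) 109951162777600000).toR -
      quadR q (σ.P0.toR - σ.Q0.toR) (σ.P1.toR - σ.Q1.toR) / 109951162777600000| ≤ 1 := by
    have := Z.dv_err (quad q (Z.sub σ.P0 σ.Q0) (Z.sub σ.P1 σ.Q1)) 109951162777600000 (by norm_num)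
    rw [quad_toR, Z.toR_sub, Z.toR_sub] at this
    convert this using 3
    norm_num
  set d0 := Z.sub σ.P0 σ.Q0
  set d1 := Z.sub σ.P1 σ.Q1
  have hP := nxt_err q σ.P0 σ.P1 σ.P2
  have hQ := nxt_err q σ.Q0 σ.Q1 σ.Q2
  have hM := lin_err A B σ.M0 σ.M1 σ.M2
  have hL := lin_err A B σ.T0 σ.T1 σ.T2
  obtain ⟨e, he, hr'⟩ := goL_rep false A B σ.L a b c hr
  have hgb := goL_bound false A B σ.L _ _ _ hr'
  set c0 := (1 - t) * σ.P0.toR + t * σ.Q0.toR with hc0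
  set c1 := (1 - t) * σ.P1.toR + t * σ.Q1.toR with hc1
  obtain ⟨tt0, tt1⟩ := tt_bound ht0 ht1
  -- deviation
  have hm0 : |(X + c0) / 2 - (σ.P0.toR + σ.Q0.toR) / 2| ≤ (((d0.abs + σ.rE0) / 2 + 1 : ℕ) : ℝ) := by
    refine le_trans ?_ (half_nat _)
    have e1 : (X + c0) / 2 - (σ.P0.toR + σ.Q0.toR) / 2 = (X - c0) / 2 + (1 / 2 - t) * (σ.P0.toR - σ.Q0.toR) := by
      rw [hc0]; ring
    have e2 : |(1 / 2 - t) * (σ.P0.toR - σ.Q0.toR)| ≤ 1 / 2 * d0.abs := by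
      rw [abs_mul, hd0]; gcongr; rw [abs_le]; constructor <;> linarith
    rw [e1]; refine (abs_add_le _ _).trans ?_
    rw [abs_div, abs_two]; push_cast; linarith
  have hm1 : |(Y + c1) / 2 - (σ.P1.toR + σ.Q1.toR) / 2| ≤ (((d1.abs + σ.rE1) / 2 + 1 : ℕ) : ℝ) := by
    refine le_trans ?_ (half_nat _)
    have e1 : (Y + c1) / 2 - (σ.P1.toR + σ.Q1.toR) / 2 = (Y - c1) / 2 + (1 / 2 - t) * (σ.P1.toR - σ.Q1.toR) := by
      rw [hc1]; ring
    have e2 : |(1 / 2 - t) * (σ.P1.toR - σ.Q1.toR)| ≤ 1 / 2 * d1.abs := by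
      rw [abs_mul, hd1]; gcongr; rw [abs_le]; constructor <;> linarith
    rw [e1]; refine (abs_add_le _ _).trans ?_
    rw [abs_div, abs_two]; push_cast; linarith
  have hns := noise_ge q _ _ σ.rE0 σ.rE1 σ.TE _ _ _ _ (X - c0) (Y - c1) hm0 hm1
    (dA_shift q A.toR _ _ _ _ hA) (dB_shift q B.toR _ _ _ _ hB) hX0 hY0
  have hHd := Hs_diff q X Y c0 c1
  have hHc := Hs_conv q σ.P0.toR σ.P1.toR σ.Q0.toR σ.Q1.toR t
  rw [← hc0, ← hc1] at hHc
  set A' := dA q ((X + c0) / 2) ((Y + c1) / 2)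
  set B' := dB q ((X + c0) / 2) ((Y + c1) / 2)
  set ε := ((A' - A.toR) * (X - c0) + (B' - B.toR) * (Y - c1)) / sc with hε
  set eE := noise q ((d0.abs + σ.rE0) / 2 + 1) ((d1.abs + σ.rE1) / 2 + 1) σ.rE0 σ.rE1 σ.TE with heE
  set Pn := nxt q σ.P0 σ.P1 σ.P2
  set Qn := nxt q σ.Q0 σ.Q1 σ.Q2
  set Mn := lin A B σ.M0 σ.M1 σ.M2
  set LT := lin A B σ.T0 σ.T1 σ.T2
  set qn := Z.dv (quad q d0 d1) 109951162777600000
  set Rn := (A.toR * a + B.toR * b) / sc + c + e with hRn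
  have hTn : (Z.sub LT qn).toR = LT.toR - qn.toR := Z.toR_sub _ _
  set u1 := (1 - t) * (Pn.toR - (σ.P2.toR + Hs q σ.P0.toR σ.P1.toR)) with hu1
  set u2 := t * (Qn.toR - (σ.Q2.toR + Hs q σ.Q0.toR σ.Q1.toR)) with hu2
  set u3 := μ * (Mn.toR - ((A.toR * σ.M0.toR + B.toR * σ.M1.toR) / sc + σ.M2.toR)) / sc with hu3
  set u4 := t * (1 - t) * (LT.toR - ((A.toR * σ.T0.toR + B.toR * σ.T1.toR) / sc + σ.T2.toR)) with hu4
  set u5 := t * (1 - t) * (qn.toR - quadR q (σ.P0.toR - σ.Q0.toR) (σ.P1.toR - σ.Q1.toR) / 109951162777600000) with hu5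
  have b1 : |u1| ≤ 1 - t := by
    rw [hu1, abs_mul, abs_of_nonneg (by linarith : 0 ≤ 1 - t)]
    exact mul_le_of_le_one_right (by linarith) hP
  have b2 : |u2| ≤ t := by
    rw [hu2, abs_mul, abs_of_nonneg ht0]
    exact mul_le_of_le_one_right ht0 hQ
  have b3 : |u3| ≤ r / sc := by
    rw [hu3, abs_div, abs_mul, abs_of_pos sc_pos]
    gcongr
    exact (mul_le_of_le_one_right (abs_nonneg _) hM).trans hμ
  have b4 : |u4| ≤ 1 / 4 := by
    rw [hu4, abs_mul, abs_of_nonneg tt0]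
    exact (mul_le_of_le_one_right tt0 hL).trans tt1
  have b5 : |u5| ≤ 1 / 4 := by
    rw [hu5, abs_mul, abs_of_nonneg tt0]
    exact (mul_le_of_le_one_right tt0 hq).trans tt1
  set ξ := W + Hs q X Y - ((1 - t) * Pn.toR + t * Qn.toR + μ * Mn.toR / sc +
    t * (1 - t) * (LT.toR - qn.toR) + Rn) with hξ
  have hξe : ξ = ε - u1 - u2 - u3 - u4 + u5 - e := by
    have k1 : Hs q X Y = Hs q c0 c1 + (A' * (X - c0) + B' * (Y - c1)) / sc := by linarith
    have k2 : X - c0 = μ * σ.M0.toR / sc + t * (1 - t) * σ.T0.toR + a := by rw [hX]; ring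
    have k3 : Y - c1 = μ * σ.M1.toR / sc + t * (1 - t) * σ.T1.toR + b := by rw [hY]; ring
    rw [hξ, hε, k1, hHc, hu1, hu2, hu3, hu4, hu5, hRn, hW, k2, k3]
    ring
  have hξb : |ξ| ≤ eE := by
    have hT' : tot false σ.L / sc + r / sc + 1 / 4 ≤ σ.TE / sc := by
      rw [show (1 / 4 : ℝ) = sc / 4 / sc by norm_num [sc], ← add_div, ← add_div]
      gcongr
    rw [hξe]
    refine le_trans ?_ hns
    rw [abs_le] at *
    have q1 := neg_abs_le ε
    have q2 := le_abs_self ε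
    constructor <;> linarith
  refine ⟨⟨Rn + ξ, a, b, ⟨ξ, hξb, ?_⟩, ?_, ?_, ?_⟩, ?_, ?_, ?_⟩
  · convert hr' using 1
    · have : zS.toR = sc := by simp [Z.toR]
      rw [this]; field_simp; ring
    · simp [Z.toR]
    · simp [Z.toR]
  · change W + Hs q X Y = (1 - t) * Pn.toR + t * Qn.toR + μ * Mn.toR / sc + t * (1 - t) * (Z.sub LT qn).toR + _
    rw [hTn, hξ]; ring
  · exact hX
  · exact hY
  · change |W + Hs q X Y - ((1 - t) * Pn.toR + t * Qn.toR)| ≤ (fin r Mn (Z.sub LT qn) (goL A B σ.L).s1 eE : ℕ)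
    have e1 : W + Hs q X Y - ((1 - t) * Pn.toR + t * Qn.toR) =
        (μ * Mn.toR / sc + t * (1 - t) * (Z.sub LT qn).toR + Rn) + ξ := by
      rw [hTn, hξ]; ring
    have v1 : |μ * Mn.toR / sc| ≤ Mn.abs * r / sc := by
      rw [abs_div, abs_mul, abs_of_pos sc_pos, Z.abs_toR, mul_comm]; gcongr
    have v2 : |t * (1 - t) * (Z.sub LT qn).toR| ≤ (Z.sub LT qn).abs * 274877906944 / sc := by
      rw [abs_mul, abs_of_nonneg tt0, Z.abs_toR]
      have := mul_le_mul_of_nonneg_right tt1 (Nat.cast_nonneg (α := ℝ) (Z.sub LT qn).abs)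
      simp only [sc]
      linarith
    have v4 := abs_le_add3 rfl v1 v2 hgb
    have v5 : (Mn.abs * r / sc + (Z.sub LT qn).abs * 274877906944 / sc + smT false (goL A B σ.L) / sc : ℝ)
      = ((Mn.abs * r + (Z.sub LT qn).abs * 274877906944 + (goL A B σ.L).s1 : ℕ) : ℝ) / (1099511627776 : ℕ) := by
      simp [smT, sc]; ring
    rw [v5] at v4
    have v6 := nat_lt_div (Mn.abs * r + (Z.sub LT qn).abs * 274877906944 + (goL A B σ.L).s1) 1099511627776 (by norm_num)
    rw [e1]
    refine (abs_add_le _ _).trans ?_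
    rw [show ((fin r Mn (Z.sub LT qn) (goL A B σ.L).s1 eE : ℕ) : ℝ) =
      (((Mn.abs * r + (Z.sub LT qn).abs * 274877906944 + (goL A B σ.L).s1) / 1099511627776 : ℕ) : ℝ) + 1 + eE by
      unfold fin; push_cast; rfl]
    linarith
  · exact hX0
  · change mg false eE _ + tot false (goL A B σ.L).l + r + sc / 4 ≤ ((σ.TE + eE : ℕ) : ℝ)
    rw [tot_goL]; push_cast
    simp only [mg, Bool.false_eq_true, if_false]
    linarith

end Lom

namespace Lom

theorem stp_U (q : Par) (r : ℕ) (σ : St) (t μ μ' X Y W X' Y' W' δ x y w : ℝ) (ht0 : 0 ≤ t) (ht1 : t ≤ 1)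
    (h : EInv r σ t μ X Y W) (h' : EInv r σ t μ' X' Y' W')
    (hx : X - X' = δ * x) (hy : Y - Y' = δ * y) (hw : W - W' = δ * w) (hU : UInv σ x y w) :
    ∃ z, (W + Hs q X Y) - (W' + Hs q X' Y') = δ * z ∧ UInv (stp q r σ) z x y := by
  obtain ⟨⟨a, b, c, hr, hX, hY, hW⟩, hX0, hY0, hT⟩ := hU
  have hA := cA_err q (Z.add σ.P0 σ.Q0) (Z.add σ.P1 σ.Q1)
  have hB := cB_err q (Z.add σ.P0 σ.Q0) (Z.add σ.P1 σ.Q1)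
  have hst : stp q r σ = stp1 q r σ (cA q (Z.add σ.P0 σ.Q0) (Z.add σ.P1 σ.Q1))
    (cB q (Z.add σ.P0 σ.Q0) (Z.add σ.P1 σ.Q1)) (Z.sub σ.P0 σ.Q0) (Z.sub σ.P1 σ.Q1) := rfl
  rw [hst]
  set A := cA q (Z.add σ.P0 σ.Q0) (Z.add σ.P1 σ.Q1)
  set B := cB q (Z.add σ.P0 σ.Q0) (Z.add σ.P1 σ.Q1)
  rw [Z.toR_add, Z.toR_add] at hA hB
  have hd0 : |σ.P0.toR - σ.Q0.toR| = ((Z.sub σ.P0 σ.Q0).abs : ℝ) := by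
    rw [← Z.abs_toR, Z.toR_sub]
  have hd1 : |σ.P1.toR - σ.Q1.toR| = ((Z.sub σ.P1 σ.Q1).abs : ℝ) := by
    rw [← Z.abs_toR, Z.toR_sub]
  set d0 := Z.sub σ.P0 σ.Q0
  set d1 := Z.sub σ.P1 σ.Q1
  have hM := lin_err A B σ.M0 σ.M1 σ.M2
  obtain ⟨e, he, hr'⟩ := goL_rep true A B σ.L a b c hr
  have hgb := goL_bound true A B σ.L _ _ _ hr'
  have hm : ∀ (d : Z) (P Q V V' : ℝ) (ρ : ℕ), |P - Q| = (d.abs : ℝ) → |V - ((1 - t) * P + t * Q)| ≤ ρ →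
      |V' - ((1 - t) * P + t * Q)| ≤ ρ → |(V + V') / 2 - (P + Q) / 2| ≤ ((d.abs / 2 + ρ + 1 : ℕ) : ℝ) := by
    intro d P Q V V' ρ h1 h2 h3
    have e1 : (V + V') / 2 - (P + Q) / 2 = (V - ((1 - t) * P + t * Q)) / 2 + (V' - ((1 - t) * P + t * Q)) / 2
      + (1 / 2 - t) * (P - Q) := by ring
    have e2 : |(1 / 2 - t) * (P - Q)| ≤ 1 / 2 * d.abs := by
      rw [abs_mul, h1]; gcongr; rw [abs_le]; constructor <;> linarith
    have e3 := half_nat d.abs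
    rw [e1]; refine (abs_add_three _ _ _).trans ?_
    rw [abs_div, abs_div, abs_two]; push_cast at e3 ⊢; linarith
  have hm0 := hm d0 _ _ _ _ _ hd0 h.h0 h'.h0
  have hm1 := hm d1 _ _ _ _ _ hd1 h.h1 h'.h1
  have hns := noise_ge q _ _ σ.rU0 σ.rU1 σ.TU _ _ _ _ x y hm0 hm1
    (dA_shift q A.toR _ _ _ _ hA) (dB_shift q B.toR _ _ _ _ hB) hX0 hY0
  have hHd := Hs_diff q X Y X' Y'
  set A' := dA q ((X + X') / 2) ((Y + Y') / 2)
  set B' := dB q ((X + X') / 2) ((Y + Y') / 2)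
  set ε := ((A' - A.toR) * x + (B' - B.toR) * y) / sc with hε
  set eU := noise q (d0.abs / 2 + σ.rE0 + 1) (d1.abs / 2 + σ.rE1 + 1) σ.rU0 σ.rU1 σ.TU with heU
  set Mn := lin A B σ.M0 σ.M1 σ.M2
  set Rn := (A.toR * a + B.toR * b) / sc + c + e with hRn
  set z := (A' * x + B' * y) / sc + w with hz
  set u3 := Mn.toR - ((A.toR * σ.M0.toR + B.toR * σ.M1.toR) / sc + σ.M2.toR) with hu3
  set ξ := z - (Mn.toR + Rn) with hξ
  have hξe : ξ = ε - u3 - e := by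
    rw [hξ, hε, hz, hu3, hRn, hX, hY, hW]
    ring
  have hξb : |ξ| ≤ eU := by
    have hT' : tot true σ.L / sc + 1 ≤ σ.TU / sc := by
      rw [show (1 : ℝ) = sc / sc by norm_num [sc], ← add_div]
      gcongr
    rw [hξe]
    refine le_trans ?_ hns
    rw [abs_le] at *
    have q1 := neg_abs_le ε
    have q2 := le_abs_self ε
    constructor <;> linarith
  refine ⟨z, ?_, ⟨Rn + ξ, a, b, ⟨ξ, hξb, ?_⟩, ?_, ?_, ?_⟩, ?_, ?_, ?_⟩
  · rw [show W + Hs q X Y - (W' + Hs q X' Y') = (W - W') + (Hs q X Y - Hs q X' Y') by ring, hHd, hx, hy, hw, hz]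
    ring
  · convert hr' using 1
    · have : zS.toR = sc := by simp [Z.toR]
      rw [this]; field_simp; ring
    · simp [Z.toR]
    · simp [Z.toR]
  · change z = Mn.toR + _
    rw [hξ]; ring
  · exact hX
  · exact hY
  · change |z| ≤ (fin2 Mn (goL A B σ.L).s2 eU : ℕ)
    have v1 : |Mn.toR| ≤ Mn.abs := (Z.abs_toR _).le
    have v4 := abs_le_add3 (show z = Mn.toR + Rn + ξ by rw [hξ]; ring) v1 hgb hξb
    have v6 := nat_lt_div (goL A B σ.L).s2 1099511627776 (by norm_num)
    rw [show ((fin2 Mn (goL A B σ.L).s2 eU : ℕ) : ℝ) =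
      Mn.abs + (((goL A B σ.L).s2 / 1099511627776 : ℕ) : ℝ) + 1 + eU by
      unfold fin2; push_cast; rfl]
    simp only [smT, if_true] at v4
    push_cast at v6
    linarith
  · exact hX0
  · change mg true _ eU + tot true (goL A B σ.L).l + sc ≤ ((σ.TU + eU : ℕ) : ℝ)
    rw [tot_goL]; push_cast
    simp only [mg, if_true]
    linarith

/-! ### Iteration -/

/-- scaled third-order recurrence as a map on triples -/
noncomputable def mp (q : Par) (v : ℝ × ℝ × ℝ) : ℝ × ℝ × ℝ := (v.2.2 + Hs q v.1 v.2.1, v.1, v.2.1)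

def EI (r : ℕ) (σ : St) (t μ : ℝ) (v : ℝ × ℝ × ℝ) : Prop := EInv r σ t μ v.1 v.2.1 v.2.2

def UI (σ : St) (δ : ℝ) (v v' : ℝ × ℝ × ℝ) : Prop :=
  ∃ x y w, v.1 - v'.1 = δ * x ∧ v.2.1 - v'.2.1 = δ * y ∧ v.2.2 - v'.2.2 = δ * w ∧ UInv σ x y w

theorem run_zero (q : Par) (r lo : ℕ) (k : St → Bool) (σ : St) : run q r lo k 0 σ = k σ := rfl

theorem run_succ (q : Par) (r lo : ℕ) (k : St → Bool) (n : ℕ) (σ : St)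
    (h : run q r lo k (n + 1) σ = true) :
    okLo lo (stp q r σ) = true ∧ run q r lo k n (stp q r σ) = true := by
  have h' : Bool.rec (motive := fun _ => Bool) false (run q r lo k n (stp q r σ)) (okLo lo (stp q r σ)) = true := h
  cases hb : okLo lo (stp q r σ)
  · rw [hb] at h'; exact absurd h' (by simp)
  · rw [hb] at h'; exact ⟨rfl, h'⟩

theorem okLo_sound (r lo : ℕ) (σ : St) (t μ : ℝ) (v : ℝ × ℝ × ℝ) (h : okLo lo σ = true)
    (ht0 : 0 ≤ t) (ht1 : t ≤ 1) (hE : EI r σ t μ v) : -(lo : ℝ) ≤ v.1 := by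
  simp only [okLo, Bool.and_eq_true] at h
  have h1 := Z.geN_le _ _ h.1
  have h2 := Z.geN_le _ _ h.2
  rw [Z.toR_add] at h1 h2
  have h3 := hE.h0
  rw [abs_le] at h3
  simp only [Z.toR] at h1 h2
  change _ ≤ σ.P0.toR + _ at h1
  change _ ≤ σ.Q0.toR + _ at h2
  nlinarith [mul_le_mul_of_nonneg_left h1 (by linarith : 0 ≤ 1 - t), mul_le_mul_of_nonneg_left h2 ht0]

theorem okHi_sound (r lo : ℕ) (σ : St) (t μ : ℝ) (v : ℝ × ℝ × ℝ) (h : okHi lo σ = true)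
    (ht0 : 0 ≤ t) (ht1 : t ≤ 1) (hE : EI r σ t μ v) : v.1 ≤ -(lo : ℝ) := by
  simp only [okHi, Bool.and_eq_true] at h
  have h1 := Z.geN_le _ _ h.1
  have h2 := Z.geN_le _ _ h.2
  rw [Z.toR_sub] at h1 h2
  have h3 := hE.h0
  rw [abs_le] at h3
  change _ ≤ -(lo : ℝ) - σ.P0.toR at h1
  change _ ≤ -(lo : ℝ) - σ.Q0.toR at h2
  nlinarith [mul_le_mul_of_nonneg_left h1 (by linarith : 0 ≤ 1 - t), mul_le_mul_of_nonneg_left h2 ht0]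

/-- soundness of a run: there is a final state such that the continuation holds there, and all
trajectories are enclosed. -/
theorem run_sound (q : Par) (r lo : ℕ) (k : St → Bool) (n : ℕ) : ∀ σ : St, run q r lo k n σ = true →
    ∃ σ', k σ' = true ∧ ∀ t : ℝ, 0 ≤ t → t ≤ 1 →
      (∀ (μ : ℝ) (v : ℝ × ℝ × ℝ), |μ| ≤ r → EI r σ t μ v → EI r σ' t μ ((mp q)^[n] v) ∧
        ∀ j, 1 ≤ j → j ≤ n → -(lo : ℝ) ≤ ((mp q)^[j] v).1) ∧
      (∀ (μ μ' : ℝ) (v v' : ℝ × ℝ × ℝ) (δ : ℝ), |μ| ≤ r → |μ'| ≤ r → EI r σ t μ v → EI r σ t μ' v' → UI σ δ v v' →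
        UI σ' δ ((mp q)^[n] v) ((mp q)^[n] v')) := by
  induction n with
  | zero =>
    intro σ h
    refine ⟨σ, h, fun t ht0 ht1 => ⟨fun μ v _ hv => ⟨hv, fun j h1 h2 => ?_⟩, fun μ μ' v v' δ _ _ _ _ h => h⟩⟩
    omega
  | succ n ih =>
    intro σ h
    obtain ⟨hok, hrun⟩ := run_succ _ _ _ _ _ _ h
    obtain ⟨σ', hk, H⟩ := ih _ hrun
    refine ⟨σ', hk, fun t ht0 ht1 => ?_⟩
    obtain ⟨H1, H2⟩ := H t ht0 ht1
    constructor
    · intro μ v hμ hv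
      have hv' : EI r (stp q r σ) t μ (mp q v) := stp_E q r σ t μ _ _ _ ht0 ht1 hμ hv
      obtain ⟨K1, K2⟩ := H1 μ _ hμ hv'
      refine ⟨K1, fun j h1 h2 => ?_⟩
      obtain ⟨j, rfl⟩ : ∃ i, j = i + 1 := ⟨j - 1, by omega⟩
      rw [Function.iterate_succ_apply]
      rcases Nat.eq_zero_or_pos j with h0 | h0
      · subst h0
        exact okLo_sound r lo _ t μ _ hok ht0 ht1 hv'
      · exact K2 j h0 (by omega)
    · intro μ μ' v v' δ hμ hμ' hv hv' hU
      obtain ⟨x, y, w, hx, hy, hw, hU⟩ := hU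
      obtain ⟨z, hz, hUz⟩ := stp_U q r σ t μ μ' _ _ _ _ _ _ δ x y w ht0 ht1 hv hv' hx hy hw hU
      exact H2 μ μ' _ _ δ hμ hμ' (stp_E q r σ t μ _ _ _ ht0 ht1 hμ hv)
        (stp_E q r σ t μ' _ _ _ ht0 ht1 hμ' hv') ⟨z, x, y, hz, hx, hy, hUz⟩

end Lom

namespace Lom

/-! ### Soundness of the final block check -/

noncomputable def Fn.ev (φ : Fn) (v : ℝ × ℝ × ℝ) : ℝ :=
  φ.a.toR * v.1 + (φ.b.toR * v.2.1 + φ.c.toR * v.2.2)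

theorem ble_le {a b : ℕ} (h : Nat.ble a b = true) : (a : ℝ) ≤ b := by
  exact_mod_cast Nat.le_of_ble_eq_true h

theorem fE_sound (r : ℕ) (φ : Fn) (σ : St) (t μ : ℝ) (v : ℝ × ℝ × ℝ)
    (ht0 : 0 ≤ t) (ht1 : t ≤ 1) (hE : EI r σ t μ v) :
    |φ.ev v - φ.cp.toR - μ * (fM φ σ).toR / sc| ≤ fE φ σ := by
  obtain ⟨a, b, c, hr, hX, hY, hW⟩ := hE.h
  have h1 := dotL_bound false φ.a φ.b φ.c σ.L a b c hr
  obtain ⟨tt0, tt1⟩ := tt_bound ht0 ht1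
  have hP := Z.abs_toR (Z.sub (dot φ.a φ.b φ.c σ.P0 σ.P1 σ.P2) φ.cp)
  have hQ := Z.abs_toR (Z.sub (dot φ.a φ.b φ.c σ.Q0 σ.Q1 σ.Q2) φ.cp)
  have hT := Z.abs_toR (dot φ.a φ.b φ.c σ.T0 σ.T1 σ.T2)
  rw [Z.toR_sub, dot_toR] at hP hQ
  rw [dot_toR] at hT
  have v6 := nat_lt_div (dotL φ.a φ.b φ.c σ.L).s1 1099511627776 (by norm_num)
  have v7 := nat_lt_div (Z.abs (dot φ.a φ.b φ.c σ.T0 σ.T1 σ.T2)) 4 (by norm_num)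
  have hfe : (fE φ σ : ℝ) = max ((Z.abs (Z.sub (dot φ.a φ.b φ.c σ.P0 σ.P1 σ.P2) φ.cp) : ℕ) : ℝ)
      ((Z.abs (Z.sub (dot φ.a φ.b φ.c σ.Q0 σ.Q1 σ.Q2) φ.cp) : ℕ) : ℝ) +
      (((Z.abs (dot φ.a φ.b φ.c σ.T0 σ.T1 σ.T2) / 4 : ℕ) : ℝ) + 1) +
      ((((dotL φ.a φ.b φ.c σ.L).s1 / 1099511627776 : ℕ) : ℝ) + 1) := by
    unfold fE; push_cast; rfl
  rw [hfe]
  set nP := Z.abs (Z.sub (dot φ.a φ.b φ.c σ.P0 σ.P1 σ.P2) φ.cp)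
  set nQ := Z.abs (Z.sub (dot φ.a φ.b φ.c σ.Q0 σ.Q1 σ.Q2) φ.cp)
  have w1 : |(1 - t) * (φ.a.toR * σ.P0.toR + (φ.b.toR * σ.P1.toR + φ.c.toR * σ.P2.toR) - φ.cp.toR) +
      t * (φ.a.toR * σ.Q0.toR + (φ.b.toR * σ.Q1.toR + φ.c.toR * σ.Q2.toR) - φ.cp.toR)| ≤ max (nP : ℝ) nQ := by
    refine (abs_add_le _ _).trans ?_
    rw [abs_mul, abs_mul, abs_of_nonneg ht0, abs_of_nonneg (by linarith : 0 ≤ 1 - t), hP, hQ]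
    have m1 := le_max_left (nP : ℝ) nQ
    have m2 := le_max_right (nP : ℝ) nQ
    nlinarith [mul_le_mul_of_nonneg_left m1 (by linarith : 0 ≤ 1 - t), mul_le_mul_of_nonneg_left m2 ht0]
  have w2 : |t * (1 - t) * (φ.a.toR * σ.T0.toR + (φ.b.toR * σ.T1.toR + φ.c.toR * σ.T2.toR))| ≤
      ((Z.abs (dot φ.a φ.b φ.c σ.T0 σ.T1 σ.T2) / 4 : ℕ) : ℝ) + 1 := by
    rw [abs_mul, abs_of_nonneg tt0, hT]
    refine (mul_le_mul_of_nonneg_right tt1 (Nat.cast_nonneg _)).trans ?_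
    push_cast at v7
    linarith
  have w3 : |φ.a.toR * a + (φ.b.toR * b + φ.c.toR * c)| ≤
    (((dotL φ.a φ.b φ.c σ.L).s1 / 1099511627776 : ℕ) : ℝ) + 1 := by
    refine h1.trans ?_
    simpa [smP] using v6
  refine abs_le_add3 ?_ w1 w2 w3
  simp only [Fn.ev, fM, dot_toR, hX, hY, hW]
  ring

theorem fU_sound (φ : Fn) (σ : St) (x y w : ℝ) (hU : UInv σ x y w) :
    |φ.ev (x, y, w) - (fM φ σ).toR| ≤ fU φ σ := by
  obtain ⟨a, b, c, hr, hX, hY, hW⟩ := hU.h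
  have h1 := dotL_bound true φ.a φ.b φ.c σ.L a b c hr
  have v6 := nat_lt_div (dotL φ.a φ.b φ.c σ.L).s2 1099511627776 (by norm_num)
  have : (fU φ σ : ℝ) = (((dotL φ.a φ.b φ.c σ.L).s2 / 1099511627776 : ℕ) : ℝ) + 1 := by
    unfold fU; push_cast; rfl
  rw [this]
  refine le_trans ?_ v6
  have e1 : φ.ev (x, y, w) - (fM φ σ).toR = φ.a.toR * a + (φ.b.toR * b + φ.c.toR * c) := by
    simp only [Fn.ev, fM, dot_toR, hX, hY, hW]; ring
  rw [e1]
  simpa [smP] using h1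

theorem chkS_sound (r : ℕ) (φ : Fn) (bd cn cd dl uq : ℕ) (σ : St) (h : chkS r φ bd cn cd dl uq σ = true) :
    (∀ (t μ : ℝ) (v : ℝ × ℝ × ℝ), 0 ≤ t → t ≤ 1 → |μ| ≤ r → EI r σ t μ v → |φ.ev v - φ.cp.toR| ≤ bd) ∧
    (∀ x y w : ℝ, UInv σ x y w → |φ.ev (x, y, w)| * (dl * cd) ≤ uq * (cn * φ.d)) := by
  simp only [chkS, Bool.and_eq_true] at h
  obtain ⟨h1, h2⟩ := h
  have h1 := ble_le h1
  have h2 := ble_le h2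
  push_cast at h1 h2
  constructor
  · intro t μ v ht0 ht1 hμ hE
    have e1 := fE_sound r φ σ t μ v ht0 ht1 hE
    have e2 : |μ * (fM φ σ).toR / sc| ≤ ((fM φ σ).abs * r : ℕ) / (1099511627776 : ℕ) := by
      rw [abs_div, abs_mul, abs_of_pos sc_pos, Z.abs_toR, mul_comm]
      push_cast
      gcongr
    have e3 := e2.trans (nat_lt_div ((fM φ σ).abs * r) 1099511627776 (by norm_num))
    have e4 : φ.ev v - φ.cp.toR = (φ.ev v - φ.cp.toR - μ * (fM φ σ).toR / sc) + μ * (fM φ σ).toR / sc := by ring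
    rw [e4]
    refine (abs_add_le _ _).trans ?_
    linarith
  · intro x y w hU
    have e1 := fU_sound φ σ x y w hU
    have e2 : |φ.ev (x, y, w)| ≤ (fM φ σ).abs + fU φ σ := by
      rw [← Z.abs_toR]
      have := abs_add_le (φ.ev (x, y, w) - (fM φ σ).toR) (fM φ σ).toR
      rw [sub_add_cancel] at this
      linarith
    refine le_trans ?_ h2
    gcongr

/-- conclusion of the final block check -/
structure EndOK (r : ℕ) (β : Blk) (σ : St) : Prop where
  s1 : ∀ (t μ : ℝ) (v : ℝ × ℝ × ℝ), 0 ≤ t → t ≤ 1 → |μ| ≤ r → EI r σ t μ v → |β.s1.ev v - β.s1.cp.toR| ≤ β.b1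
  s0 : ∀ (t μ : ℝ) (v : ℝ × ℝ × ℝ), 0 ≤ t → t ≤ 1 → |μ| ≤ r → EI r σ t μ v → |β.s0.ev v - β.s0.cp.toR| ≤ β.b0
  st : ∀ (t μ : ℝ) (v : ℝ × ℝ × ℝ), 0 ≤ t → t ≤ 1 → |μ| ≤ r → EI r σ t μ v → |β.t.ev v - β.t.cp.toR| ≤ β.bt
  hi : ∀ (t : ℝ) (v : ℝ × ℝ × ℝ), 0 ≤ t → t ≤ 1 → EI r σ t r v → β.al ≤ β.l.ev v - β.l.cp.toR
  lo : ∀ (t : ℝ) (v : ℝ × ℝ × ℝ), 0 ≤ t → t ≤ 1 → EI r σ t (-r) v → β.l.ev v - β.l.cp.toR ≤ -β.al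
  c : ∀ (δ : ℝ) (v v' : ℝ × ℝ × ℝ), UI σ δ v v' → |δ| ≤ |β.l.ev v - β.l.ev v'| ∧
    |β.s1.ev v - β.s1.ev v'| * β.l.d ≤ |β.l.ev v - β.l.ev v'| * β.s1.d ∧
    |β.s0.ev v - β.s0.ev v'| * (β.l.d * β.cd) ≤ |β.l.ev v - β.l.ev v'| * (β.cn * β.s0.d) ∧
    |β.t.ev v - β.t.ev v'| * (β.l.d * (β.cd * β.cd)) ≤ |β.l.ev v - β.l.ev v'| * (β.cn * β.cn * β.t.d)

theorem Fn.ev_diff (φ : Fn) (v v' : ℝ × ℝ × ℝ) (δ x y w : ℝ) (hx : v.1 - v'.1 = δ * x)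
    (hy : v.2.1 - v'.2.1 = δ * y) (hw : v.2.2 - v'.2.2 = δ * w) :
    φ.ev v - φ.ev v' = δ * φ.ev (x, y, w) := by
  simp only [Fn.ev]
  linear_combination φ.a.toR * hx + φ.b.toR * hy + φ.c.toR * hw

theorem endA_sound (r : ℕ) (β : Blk) (σ : St) (h : endA r β σ = true) : EndOK r β σ := by
  simp only [endA, endB, Bool.and_eq_true] at h
  obtain ⟨h1, h2, h3, h4, h5, h6⟩ := h
  have h1 := Z.geN_le _ _ h1
  have h2 := Z.geN_le _ _ h2
  have h3 := ble_le h3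
  obtain ⟨k1, l1⟩ := chkS_sound _ _ _ _ _ _ _ _ h4
  obtain ⟨k2, l2⟩ := chkS_sound _ _ _ _ _ _ _ _ h5
  obtain ⟨k3, l3⟩ := chkS_sound _ _ _ _ _ _ _ _ h6
  rw [Z.toR_mul] at h2
  have hr : (Z.p r).toR = r := rfl
  rw [hr] at h2
  push_cast at h2
  have h2' : (β.al : ℝ) + fE β.l σ ≤ (fM β.l σ).toR * r / sc := by
    rw [le_div_iff₀ sc_pos]; exact h2
  have hM : ((fM β.l σ).abs : ℝ) = (fM β.l σ).toR := by
    rw [← Z.abs_toR, abs_of_nonneg]; exact (Nat.cast_nonneg _).trans h1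
  have hle : fU β.l σ ≤ (fM β.l σ).abs := by
    have : (fU β.l σ : ℝ) ≤ (fM β.l σ).abs := by rw [hM]; exact h1
    exact_mod_cast this
  set uq := (fM β.l σ).abs - fU β.l σ with huq
  have huq' : (uq : ℝ) = (fM β.l σ).toR - fU β.l σ := by
    rw [huq, Nat.cast_sub hle, hM]
  refine ⟨k1, k2, k3, ?_, ?_, ?_⟩
  · intro t v ht0 ht1 hE
    have e1 := (abs_le.1 (fE_sound r β.l σ t r v ht0 ht1 hE)).1
    have : (r : ℝ) * (fM β.l σ).toR / sc = (fM β.l σ).toR * r / sc := by ring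
    linarith
  · intro t v ht0 ht1 hE
    have e1 := (abs_le.1 (fE_sound r β.l σ t (-r) v ht0 ht1 hE)).2
    have : -(r : ℝ) * (fM β.l σ).toR / sc = -((fM β.l σ).toR * r / sc) := by ring
    linarith
  · rintro δ v v' ⟨x, y, w, hx, hy, hw, hU⟩
    have eL := (abs_le.1 (fU_sound β.l σ x y w hU)).1
    have q1 : (uq : ℝ) ≤ β.l.ev (x, y, w) := by linarith
    have q0 : (0 : ℝ) ≤ uq := Nat.cast_nonneg _
    have q2 : |β.l.ev v - β.l.ev v'| = |δ| * β.l.ev (x, y, w) := by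
      rw [Fn.ev_diff _ _ _ _ _ _ _ hx hy hw, abs_mul, abs_of_nonneg (q0.trans q1)]
    rw [q2]
    have d0 := abs_nonneg δ
    have gen : ∀ (φ : Fn) (A B : ℝ), 0 ≤ A → 0 ≤ B → |φ.ev (x, y, w)| * A ≤ uq * B →
        |φ.ev v - φ.ev v'| * A ≤ |δ| * β.l.ev (x, y, w) * B := by
      intro φ A B hA hB hh
      rw [Fn.ev_diff _ _ _ _ _ _ _ hx hy hw, abs_mul]
      have h8 : (uq : ℝ) * B ≤ β.l.ev (x, y, w) * B := mul_le_mul_of_nonneg_right q1 hB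
      nlinarith [mul_le_mul_of_nonneg_left (hh.trans h8) d0]
    refine ⟨?_, ?_, ?_, ?_⟩
    · push_cast at h3
      nlinarith
    · refine gen _ _ _ (by positivity) (by positivity) ?_
      have := l1 x y w hU
      push_cast at this
      linarith
    · exact gen _ _ _ (by positivity) (by positivity) (l2 x y w hU)
    · refine gen _ _ _ (by positivity) (by positivity) ?_
      have := l3 x y w hU
      push_cast at this
      exact this

end Lom

namespace Lom

/-! ### Soundness of the initial states -/

theorem zS_toR : zS.toR = sc := by simp [Z.toR]
theorem z0_toR : (Z.p 0).toR = 0 := by simp [Z.toR]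

theorem hwE_sound (g : ℕ) (μ d : ℝ) (hμ : |μ| ≤ rF) (hd : |d| ≤ g) : |μ * d / sc| ≤ hwE g := by
  have h := nat_lt_div (rF * g) 1099511627776 (by norm_num)
  have : (hwE g : ℝ) = ((rF * g / 1099511627776 : ℕ) : ℝ) + 1 := by unfold hwE; push_cast; rfl
  rw [this]
  refine le_trans ?_ h
  rw [abs_div, abs_mul, abs_of_pos sc_pos, Nat.cast_mul]
  have : |μ| * |d| ≤ (rF : ℝ) * g := mul_le_mul hμ hd (abs_nonneg _) (Nat.cast_nonneg _)
  push_cast at this ⊢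
  gcongr

theorem mul_sound (M : Z) (μ : ℝ) (hμ : |μ| ≤ rF) :
    |μ * M.toR / sc| ≤ ((M.abs * rF / 1099511627776 : ℕ) : ℝ) + 1 := by
  have h := nat_lt_div (M.abs * rF) 1099511627776 (by norm_num)
  refine le_trans ?_ h
  rw [abs_div, abs_mul, abs_of_pos sc_pos, Nat.cast_mul, Z.abs_toR, mul_comm]
  push_cast at hμ ⊢
  gcongr

/-- the initial triple -/
noncomputable def iniV (X Y : Node) (D0 D1 D2 t μ ν : ℝ) : ℝ × ℝ × ℝ :=
  ((1 - t) * X.x0.toR + t * Y.x0.toR + μ * D0 / sc,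
   (1 - t) * X.x1.toR + t * Y.x1.toR + μ * D1 / sc,
   (1 - t) * X.x2.toR + t * Y.x2.toR + μ * D2 / sc + ν)

def rev (v : ℝ × ℝ × ℝ) : ℝ × ℝ × ℝ := (v.2.2, v.2.1, v.1)

section
variable (X Y : Node) (M0 M1 M2 : Z) (g0 g1 g2 : ℕ) (D0 D1 D2 t : ℝ)

theorem initF_E (μ ν : ℝ) (hD0 : |D0 - M0.toR| ≤ g0) (hD1 : |D1 - M1.toR| ≤ g1)
    (hD2 : |D2 - M2.toR| ≤ g2) (hμ : |μ| ≤ rF) (hν : |ν| ≤ rB) :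
    EI rF (initF X Y M0 M1 M2 g0 g1 g2) t μ (iniV X Y D0 D1 D2 t μ ν) := by
  have a0 := hwE_sound g0 μ _ hμ hD0
  have a1 := hwE_sound g1 μ _ hμ hD1
  have a2 := hwE_sound g2 μ _ hμ hD2
  have m0 := mul_sound M0 μ hμ
  have m1 := mul_sound M1 μ hμ
  have hs := sc_pos.ne'
  refine ⟨⟨μ * (D0 - M0.toR) / sc, μ * (D1 - M1.toR) / sc, μ * (D2 - M2.toR) / sc + ν,
    ⟨ν, by simpa [mg] using hν, _, by simpa [mg] using a0, _, by simpa [mg] using a1,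
      _, by simpa [mg] using a2, ?_, ?_, ?_⟩, ?_, ?_, ?_⟩, ?_, ?_, ?_⟩
  · simp only [zS_toR, z0_toR]; field_simp; ring
  · simp only [zS_toR, z0_toR]; field_simp; ring
  · simp only [zS_toR, z0_toR]; field_simp; ring
  · simp only [iniV, initF, mkSt, z0_toR]; ring
  · simp only [iniV, initF, mkSt, z0_toR]; ring
  · simp only [iniV, initF, mkSt, z0_toR]; ring
  · change |_| ≤ ((M0.abs * rF / 1099511627776 + 1 + hwE g0 : ℕ) : ℝ)
    rw [Nat.cast_add, Nat.cast_add, Nat.cast_one]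
    refine le_trans ?_ (add_le_add m0 a0)
    refine le_trans (le_of_eq ?_) (abs_add_le _ _)
    congr 1
    simp only [iniV, initF, mkSt]; ring
  · change |_| ≤ ((M1.abs * rF / 1099511627776 + 1 + hwE g1 : ℕ) : ℝ)
    rw [Nat.cast_add, Nat.cast_add, Nat.cast_one]
    refine le_trans ?_ (add_le_add m1 a1)
    refine le_trans (le_of_eq ?_) (abs_add_le _ _)
    congr 1
    simp only [iniV, initF, mkSt]; ring
  · simp only [initF, mkSt, tot, mg, Bool.false_eq_true, if_false, sc]
    push_cast
    linarith

theorem initB_E (μ ν : ℝ) (hD0 : |D0 - M0.toR| ≤ g0) (hD1 : |D1 - M1.toR| ≤ g1)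
    (hD2 : |D2 - M2.toR| ≤ g2) (hμ : |μ| ≤ rF) (hν : |ν| ≤ rB) :
    EI rB (initB X Y M0 M1 M2 g0 g1 g2) t ν (rev (iniV X Y D0 D1 D2 t μ ν)) := by
  have a0 := hwE_sound g0 μ _ hμ hD0
  have a1 := hwE_sound g1 μ _ hμ hD1
  have a2 := hwE_sound g2 μ _ hμ hD2
  have m2 := mul_sound M2 μ hμ
  have m1 := mul_sound M1 μ hμ
  have hs := sc_pos.ne'
  refine ⟨⟨μ * D2 / sc, μ * D1 / sc, μ * D0 / sc,
    ⟨μ, by simpa [mg] using hμ, _, by simpa [mg] using a0, _, by simpa [mg] using a1,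
      _, by simpa [mg] using a2, ?_, ?_, ?_⟩, ?_, ?_, ?_⟩, ?_, ?_, ?_⟩
  · simp only [zS_toR, z0_toR]; field_simp; ring
  · simp only [zS_toR, z0_toR]; field_simp; ring
  · simp only [zS_toR, z0_toR]; field_simp; ring
  · simp only [rev, iniV, initB, mkSt, z0_toR, zS_toR]; field_simp; ring
  · simp only [rev, iniV, initB, mkSt, z0_toR]; ring
  · simp only [rev, iniV, initB, mkSt, z0_toR]; ring
  · change |_| ≤ ((rB + (M2.abs * rF / 1099511627776 + 1 + hwE g2) : ℕ) : ℝ)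
    rw [Nat.cast_add, Nat.cast_add, Nat.cast_add, Nat.cast_one, ← add_assoc]
    refine abs_le_add3 ?_ hν m2 a2
    simp only [rev, iniV, initB, mkSt]; ring
  · change |_| ≤ ((M1.abs * rF / 1099511627776 + 1 + hwE g1 : ℕ) : ℝ)
    rw [Nat.cast_add, Nat.cast_add, Nat.cast_one]
    refine le_trans ?_ (add_le_add m1 a1)
    refine le_trans (le_of_eq ?_) (abs_add_le _ _)
    congr 1
    simp only [rev, iniV, initB, mkSt]; ring
  · simp only [initB, mkSt, tot, mg, Bool.false_eq_true, if_false, sc]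
    push_cast
    linarith

theorem initF_U (μ ν μ' ν' : ℝ) (hD0 : |D0 - M0.toR| ≤ g0) (hD1 : |D1 - M1.toR| ≤ g1)
    (hD2 : |D2 - M2.toR| ≤ g2) (h : |ν - ν'| ≤ 1 / 100 * |μ - μ'|) :
    UI (initF X Y M0 M1 M2 g0 g1 g2) ((μ - μ') / sc) (iniV X Y D0 D1 D2 t μ ν) (iniV X Y D0 D1 D2 t μ' ν') := by
  have hs := sc_pos.ne'
  have hρ : ∃ ρ : ℝ, |ρ| ≤ 1 / 100 ∧ ν - ν' = ρ * (μ - μ') := by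
    by_cases h0 : μ - μ' = 0
    · refine ⟨0, by norm_num, ?_⟩
      rw [h0, abs_zero, mul_zero] at h
      rw [abs_nonpos_iff.1 h]; ring
    · refine ⟨(ν - ν') / (μ - μ'), ?_, by field_simp⟩
      rw [abs_div, div_le_iff₀ (abs_pos.2 h0)]; exact h
  obtain ⟨ρ, hρ, hρe⟩ := hρ
  have hb : ∀ (M : Z) (D : ℝ) (g : ℕ), |D - M.toR| ≤ g → |D| ≤ ((M.abs + g : ℕ) : ℝ) := by
    intro M D g h
    rw [Nat.cast_add, ← Z.abs_toR]
    calc |D| = |M.toR + (D - M.toR)| := by ring_nf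
      _ ≤ _ := (abs_add_le _ _).trans (by linarith)
  refine ⟨D0, D1, D2 + ρ * sc, ?_, ?_, ?_, ⟨(D0 - M0.toR), (D1 - M1.toR), (D2 - M2.toR) + ρ * sc,
    ⟨ρ * sc, ?_, _, by simpa [mg] using hD0, _, by simpa [mg] using hD1,
      _, by simpa [mg] using hD2, ?_, ?_, ?_⟩, ?_, ?_, ?_⟩, hb _ _ _ hD0, hb _ _ _ hD1, ?_⟩
  · simp only [iniV]; ring
  · simp only [iniV]; ring
  · simp only [iniV]
    have : (μ - μ') / sc * (D2 + ρ * sc) = (μ - μ') / sc * D2 + ρ * (μ - μ') := by field_simp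
    rw [this, ← hρe]; ring
  · simp only [mg, if_true]
    rw [abs_mul, abs_of_pos sc_pos]
    refine (mul_le_mul_of_nonneg_right hρ sc_pos.le).trans ?_
    norm_num [sc]
  · simp only [zS_toR, z0_toR]; field_simp; ring
  · simp only [zS_toR, z0_toR]; field_simp; ring
  · simp only [zS_toR, z0_toR]; field_simp; ring
  · simp only [initF, mkSt]; ring
  · simp only [initF, mkSt]; ring
  · simp only [initF, mkSt]; ring
  · simp only [initF, mkSt, tot, mg, if_true, sc]
    push_cast
    linarith

theorem initB_U (μ ν μ' ν' : ℝ) (hD0 : |D0 - M0.toR| ≤ g0) (hD1 : |D1 - M1.toR| ≤ g1)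
    (hD2 : |D2 - M2.toR| ≤ g2) (h : |μ - μ'| ≤ 100 * |ν - ν'|) :
    UI (initB X Y M0 M1 M2 g0 g1 g2) ((ν - ν') / sc) (rev (iniV X Y D0 D1 D2 t μ ν))
      (rev (iniV X Y D0 D1 D2 t μ' ν')) := by
  have hs := sc_pos.ne'
  have hρ : ∃ ρ : ℝ, |ρ| ≤ 100 ∧ μ - μ' = ρ * (ν - ν') := by
    by_cases h0 : ν - ν' = 0
    · refine ⟨0, by norm_num, ?_⟩
      rw [h0, abs_zero, mul_zero] at h
      rw [abs_nonpos_iff.1 h]; ring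
    · refine ⟨(μ - μ') / (ν - ν'), ?_, by field_simp⟩
      rw [abs_div, div_le_iff₀ (abs_pos.2 h0)]; exact h
  obtain ⟨ρ, hρ, hρe⟩ := hρ
  have hb1 : ∀ (M : Z) (D : ℝ) (g : ℕ), |D - M.toR| ≤ g → |ρ * D| ≤ ((100 * M.abs + 100 * g : ℕ) : ℝ) := by
    intro M D g h
    push_cast
    rw [← Z.abs_toR, abs_mul]
    have : |D| ≤ |M.toR| + g := by
      calc |D| = |M.toR + (D - M.toR)| := by ring_nf
        _ ≤ _ := (abs_add_le _ _).trans (by linarith)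
    calc |ρ| * |D| ≤ 100 * (|M.toR| + g) := mul_le_mul hρ this (abs_nonneg _) (by norm_num)
      _ = _ := by ring
  have hb2 : ∀ (M : Z) (D : ℝ) (g : ℕ), |D - M.toR| ≤ g → |ρ * (D - M.toR)| ≤ 100 * g := by
    intro M D g h
    rw [abs_mul]
    exact mul_le_mul hρ h (abs_nonneg _) (by norm_num)
  refine ⟨sc + ρ * D2, ρ * D1, ρ * D0, ?_, ?_, ?_, ⟨ρ * D2, ρ * D1, ρ * D0,
    ⟨ρ * sc, ?_, ρ * (D0 - M0.toR), by simpa [mg] using hb2 _ _ _ hD0, ρ * (D1 - M1.toR), by simpa [mg] using hb2 _ _ _ hD1,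
      ρ * (D2 - M2.toR), by simpa [mg] using hb2 _ _ _ hD2, ?_, ?_, ?_⟩, ?_, ?_, ?_⟩, ?_, hb1 _ _ _ hD1, ?_⟩
  · simp only [rev, iniV]
    have : (ν - ν') / sc * (sc + ρ * D2) = (ν - ν') + ρ * (ν - ν') * D2 / sc := by field_simp
    rw [this, ← hρe]; ring
  · simp only [rev, iniV]
    have : (ν - ν') / sc * (ρ * D1) = ρ * (ν - ν') * D1 / sc := by ring
    rw [this, ← hρe]; ring
  · simp only [rev, iniV]
    have : (ν - ν') / sc * (ρ * D0) = ρ * (ν - ν') * D0 / sc := by ring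
    rw [this, ← hρe]; ring
  · simp only [mg, if_true]
    rw [abs_mul, abs_of_pos sc_pos]
    refine (mul_le_mul_of_nonneg_right hρ sc_pos.le).trans ?_
    norm_num [sc]
  · simp only [zS_toR, z0_toR]; field_simp; ring
  · simp only [zS_toR, z0_toR]; field_simp; ring
  · simp only [zS_toR, z0_toR]; field_simp; ring
  · simp only [initB, mkSt, zS_toR]
  · simp only [initB, mkSt, z0_toR, zero_add]
  · simp only [initB, mkSt, z0_toR, zero_add]
  · change |_| ≤ ((1099511627776 + (100 * M2.abs + 100 * g2) : ℕ) : ℝ)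
    rw [Nat.cast_add]
    refine (abs_add_le _ _).trans (add_le_add ?_ (hb1 _ _ _ hD2))
    rw [abs_of_pos sc_pos]; norm_num [sc]
  · simp only [initB, mkSt, tot, mg, if_true, sc]
    push_cast
    linarith

end

theorem hw_sound (x y : Z) (a b t : ℝ) (s : Z) (hs : s.toR = a + b) (hxy : x.toR - y.toR = a - b)
    (ht0 : 0 ≤ t) (ht1 : t ≤ 1) :
    |(1 - t) * a + t * b - (s.dv 2).toR| ≤ hw x y := by
  have h1 := Z.dv_err s 2 (by norm_num)
  have h2 := half_nat (Z.abs (Z.sub x y))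
  have h3 : ((hw x y : ℕ) : ℝ) = ((Z.abs (Z.sub x y) / 2 + 1 : ℕ) : ℝ) + 1 := by
    unfold hw; push_cast; ring
  rw [h3]
  rw [← Z.abs_toR, Z.toR_sub, hxy] at h2
  rw [hs] at h1
  have e : (1 - t) * a + t * b - (s.dv 2).toR = (1 / 2 - t) * (a - b) + ((a + b) / 2 - (s.dv 2).toR) := by ring
  have e2 : |(1 / 2 - t) * (a - b)| ≤ 1 / 2 * |a - b| := by
    rw [abs_mul]; gcongr; rw [abs_le]; constructor <;> linarith
  rw [abs_sub_comm] at h1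
  push_cast at h1
  rw [e]
  refine (abs_add_le _ _).trans ?_
  linarith

/-- direction vectors -/
noncomputable def dir0 (X Y : Node) (t : ℝ) : ℝ := (1 - t) * (X.x0.toR - C0.toR) + t * (Y.x0.toR - C0.toR)
noncomputable def dir1 (X Y : Node) (t : ℝ) : ℝ := (1 - t) * (X.x1.toR - C1.toR) + t * (Y.x1.toR - C1.toR)
noncomputable def dir2 (X Y : Node) (t : ℝ) : ℝ := (1 - t) * X.w.toR + t * Y.w.toR

noncomputable def cellV (X Y : Node) (t μ ν : ℝ) : ℝ × ℝ × ℝ :=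
  iniV X Y (dir0 X Y t) (dir1 X Y t) (dir2 X Y t) t μ ν

/-- what a verified cell gives -/
structure CellOK (X Y : Node) : Prop where
  F : ∃ σ, EndOK rF blkF σ ∧ ∀ t : ℝ, 0 ≤ t → t ≤ 1 →
    (∀ μ ν : ℝ, |μ| ≤ rF → |ν| ≤ rB → EI rF σ t μ ((mp parF)^[30] (cellV X Y t μ ν)) ∧
      ((mp parF)^[2] (cellV X Y t μ ν)).1 ≤ -1374389534720 ∧
      ∀ j, 3 ≤ j → j ≤ 30 → -1319413953331 ≤ ((mp parF)^[j] (cellV X Y t μ ν)).1) ∧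
    (∀ μ ν μ' ν' : ℝ, |μ| ≤ rF → |ν| ≤ rB → |μ'| ≤ rF → |ν'| ≤ rB → |ν - ν'| ≤ 1 / 100 * |μ - μ'| →
      UI σ ((μ - μ') / sc) ((mp parF)^[30] (cellV X Y t μ ν)) ((mp parF)^[30] (cellV X Y t μ' ν')))
  B : ∃ σ, EndOK rB blkB σ ∧ ∀ t : ℝ, 0 ≤ t → t ≤ 1 →
    (∀ μ ν : ℝ, |μ| ≤ rF → |ν| ≤ rB → EI rB σ t ν ((mp parB)^[17] (rev (cellV X Y t μ ν)))) ∧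
    (∀ μ ν μ' ν' : ℝ, |μ| ≤ rF → |ν| ≤ rB → |μ'| ≤ rF → |ν'| ≤ rB → |μ - μ'| ≤ 100 * |ν - ν'| →
      UI σ ((ν - ν') / sc) ((mp parB)^[17] (rev (cellV X Y t μ ν))) ((mp parB)^[17] (rev (cellV X Y t μ' ν'))))

theorem cellOK_sound (X Y : Node) (h : cellOK X Y = true) : CellOK X Y := by
  unfold cellOK at h
  have H0 : ∀ t : ℝ, 0 ≤ t → t ≤ 1 → |dir0 X Y t - (Z.dv (Z.add (Z.sub X.x0 C0) (Z.sub Y.x0 C0)) 2).toR| ≤ hw X.x0 Y.x0 :=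
    fun t h0 h1 => hw_sound _ _ _ _ t _ (by rw [Z.toR_add, Z.toR_sub, Z.toR_sub]) (by ring) h0 h1
  have H1 : ∀ t : ℝ, 0 ≤ t → t ≤ 1 → |dir1 X Y t - (Z.dv (Z.add (Z.sub X.x1 C1) (Z.sub Y.x1 C1)) 2).toR| ≤ hw X.x1 Y.x1 :=
    fun t h0 h1 => hw_sound _ _ _ _ t _ (by rw [Z.toR_add, Z.toR_sub, Z.toR_sub]) (by ring) h0 h1
  have H2 : ∀ t : ℝ, 0 ≤ t → t ≤ 1 → |dir2 X Y t - (Z.dv (Z.add X.w Y.w) 2).toR| ≤ hw X.w Y.w :=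
    fun t h0 h1 => hw_sound _ _ _ _ t _ (by rw [Z.toR_add]) (by ring) h0 h1
  generalize Z.dv (Z.add (Z.sub X.x0 C0) (Z.sub Y.x0 C0)) 2 = M0 at h H0
  generalize Z.dv (Z.add (Z.sub X.x1 C1) (Z.sub Y.x1 C1)) 2 = M1 at h H1
  generalize Z.dv (Z.add X.w Y.w) 2 = M2 at h H2
  generalize hw X.x0 Y.x0 = g0 at h H0
  generalize hw X.x1 Y.x1 = g1 at h H1
  generalize hw X.w Y.w = g2 at h H2
  unfold cellFB at h
  rw [Bool.and_eq_true] at h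
  obtain ⟨hF, hB⟩ := h
  constructor
  · obtain ⟨σ1, hk1, R1⟩ := run_sound _ _ _ _ _ _ hF
    simp only [Bool.and_eq_true] at hk1
    obtain ⟨hhi, hk1⟩ := hk1
    obtain ⟨σ2, hk2, R2⟩ := run_sound _ _ _ _ _ _ hk1
    refine ⟨σ2, endA_sound _ _ _ hk2, fun t ht0 ht1 => ⟨fun μ ν hμ hν => ?_, fun μ ν μ' ν' hμ hν hμ' hν' hh => ?_⟩⟩
    · have e0 := initF_E X Y M0 M1 M2 g0 g1 g2 _ _ _ t μ ν (H0 t ht0 ht1) (H1 t ht0 ht1) (H2 t ht0 ht1) hμ hν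
      obtain ⟨e1, -⟩ := (R1 t ht0 ht1).1 μ _ hμ e0
      obtain ⟨e2, e3⟩ := (R2 t ht0 ht1).1 μ _ hμ e1
      rw [← Function.iterate_add_apply] at e2
      refine ⟨e2, ?_, fun j h3 h30 => ?_⟩
      · have := okHi_sound _ _ _ _ _ _ hhi ht0 ht1 e1
        exact_mod_cast this
      · have := e3 (j - 2) (by omega) (by omega)
        rw [← Function.iterate_add_apply, show j - 2 + 2 = j by omega] at this
        exact_mod_cast this
    · have e0 := initF_E X Y M0 M1 M2 g0 g1 g2 _ _ _ t μ ν (H0 t ht0 ht1) (H1 t ht0 ht1) (H2 t ht0 ht1) hμ hν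
      have e0' := initF_E X Y M0 M1 M2 g0 g1 g2 _ _ _ t μ' ν' (H0 t ht0 ht1) (H1 t ht0 ht1) (H2 t ht0 ht1) hμ' hν'
      have u0 := initF_U X Y M0 M1 M2 g0 g1 g2 _ _ _ t μ ν μ' ν' (H0 t ht0 ht1) (H1 t ht0 ht1) (H2 t ht0 ht1) hh
      have u1 := (R1 t ht0 ht1).2 μ μ' _ _ _ hμ hμ' e0 e0' u0
      have u2 := (R2 t ht0 ht1).2 μ μ' _ _ _ hμ hμ' ((R1 t ht0 ht1).1 μ _ hμ e0).1 ((R1 t ht0 ht1).1 μ' _ hμ' e0').1 u1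
      rw [← Function.iterate_add_apply, ← Function.iterate_add_apply] at u2
      exact u2
  · obtain ⟨σ1, hk1, R1⟩ := run_sound _ _ _ _ _ _ hB
    refine ⟨σ1, endA_sound _ _ _ hk1, fun t ht0 ht1 => ⟨fun μ ν hμ hν => ?_, fun μ ν μ' ν' hμ hν hμ' hν' hh => ?_⟩⟩
    · have e0 := initB_E X Y M0 M1 M2 g0 g1 g2 _ _ _ t μ ν (H0 t ht0 ht1) (H1 t ht0 ht1) (H2 t ht0 ht1) hμ hν
      exact ((R1 t ht0 ht1).1 ν _ hν e0).1
    · have e0 := initB_E X Y M0 M1 M2 g0 g1 g2 _ _ _ t μ ν (H0 t ht0 ht1) (H1 t ht0 ht1) (H2 t ht0 ht1) hμ hν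
      have e0' := initB_E X Y M0 M1 M2 g0 g1 g2 _ _ _ t μ' ν' (H0 t ht0 ht1) (H1 t ht0 ht1) (H2 t ht0 ht1) hμ' hν'
      have u0 := initB_U X Y M0 M1 M2 g0 g1 g2 _ _ _ t μ ν μ' ν' (H0 t ht0 ht1) (H1 t ht0 ht1) (H2 t ht0 ht1) hh
      exact (R1 t ht0 ht1).2 ν ν' _ _ _ hν hν' e0 e0' u0

end Lom

/-! ### Abstract hyperbolic blocks -/

theorem cross_lemma (g : ℝ → ℝ) (u w a : ℝ) (huw : u ≤ w) (ha : 0 ≤ a) (hg : ContinuousOn g (Set.Icc u w))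
    (hu : g u ≤ -a) (hw : a ≤ g w) :
    ∃ u' w', u ≤ u' ∧ u' ≤ w' ∧ w' ≤ w ∧ g u' ≤ -a ∧ a ≤ g w' ∧ ∀ s ∈ Set.Icc u' w', |g s| ≤ a := by
  have hK : IsCompact (Set.Icc u w ∩ g ⁻¹' Set.Ici a) :=
    isCompact_Icc.of_isClosed_subset (hg.preimage_isClosed_of_isClosed isClosed_Icc isClosed_Ici)
      Set.inter_subset_left
  obtain ⟨w', ⟨⟨hw1, hw2⟩, hw3⟩, hwl⟩ := hK.exists_isLeast ⟨w, ⟨huw, le_rfl⟩, hw⟩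
  have hK2 : IsCompact (Set.Icc u w' ∩ g ⁻¹' Set.Iic (-a)) :=
    isCompact_Icc.of_isClosed_subset ((hg.mono (Set.Icc_subset_Icc_right hw2)).preimage_isClosed_of_isClosed
      isClosed_Icc isClosed_Iic) Set.inter_subset_left
  obtain ⟨u', ⟨⟨hu1, hu2⟩, hu3⟩, hul⟩ := hK2.exists_isGreatest ⟨u, ⟨le_rfl, hw1⟩, hu⟩
  have hcont : ContinuousOn g (Set.Icc u' w') := hg.mono (Set.Icc_subset_Icc hu1 hw2)
  have hwa : g w' = a := by
    apply le_antisymm _ hw3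
    by_contra hc
    push Not at hc
    obtain ⟨s, hs, hsa⟩ := intermediate_value_Icc hu2 hcont (show a ∈ Set.Icc (g u') (g w') from
      ⟨le_trans hu3 (by linarith), hc.le⟩)
    have h1 := hwl (show s ∈ Set.Icc u w ∩ g ⁻¹' Set.Ici a from
      ⟨⟨hu1.trans hs.1, hs.2.trans hw2⟩, hsa.ge⟩)
    have : s = w' := le_antisymm hs.2 h1
    rw [this] at hsa; linarith
  have hua : g u' = -a := by
    apply le_antisymm hu3
    by_contra hc
    push Not at hc
    obtain ⟨s, hs, hsa⟩ := intermediate_value_Icc hu2 hcont (show -a ∈ Set.Icc (g u') (g w') from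
      ⟨hc.le, by linarith⟩)
    have h1 := hul (show s ∈ Set.Icc u w' ∩ g ⁻¹' Set.Iic (-a) from
      ⟨⟨hu1.trans hs.1, hs.2⟩, hsa.le⟩)
    have : s = u' := le_antisymm h1 hs.1
    rw [this] at hsa; linarith
  refine ⟨u', w', hu1, hu2, hw2, hu3, hw3, fun s hs => abs_le.2 ⟨?_, ?_⟩⟩
  · by_contra hc
    push Not at hc
    have h1 := hul (show s ∈ Set.Icc u w' ∩ g ⁻¹' Set.Iic (-a) from ⟨⟨hu1.trans hs.1, hs.2⟩, hc.le⟩)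
    have : s = u' := le_antisymm h1 hs.1
    rw [this] at hc; linarith
  · by_contra hc
    push Not at hc
    have h1 := hwl (show s ∈ Set.Icc u w ∩ g ⁻¹' Set.Ici a from
      ⟨⟨hu1.trans hs.1, hs.2.trans hw2⟩, hc.le⟩)
    have : s = w' := le_antisymm hs.2 h1
    rw [this] at hc; linarith

namespace Lom

structure HB where
  T : ℝ × ℝ × ℝ → ℝ × ℝ × ℝ
  L : ℝ × ℝ × ℝ → ℝ
  S1 : ℝ × ℝ × ℝ → ℝ
  S0 : ℝ × ℝ × ℝ → ℝ
  Tt : ℝ × ℝ × ℝ → ℝ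
  p : ℝ × ℝ × ℝ
  a : ℝ
  b : ℝ
  ρ : ℝ
  lam : ℝ
  k0 : ℝ
  k1 : ℝ
  l1 : ℝ
  E : ℝ
  Eh : ℝ
  e0 : ℝ
  θ : ℝ
  gr : ℝ

/-- horizontal (stable) bounds -/
def HB.hset (B : HB) (v : ℝ × ℝ × ℝ) : Prop := |B.S1 v| ≤ B.b ∧ |B.S0 v| ≤ B.ρ * B.b ∧ |B.Tt v| ≤ B.ρ ^ 2 * B.b
def HB.U (B : HB) (v : ℝ × ℝ × ℝ) : Prop := |B.L v| ≤ B.a ∧ B.hset v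

/-- difference bounds -/
def HB.bd (B : HB) (v v' : ℝ × ℝ × ℝ) (N : ℝ) : Prop :=
  |B.S1 v - B.S1 v'| ≤ N ∧ |B.S0 v - B.S0 v'| ≤ B.ρ * N ∧ |B.Tt v - B.Tt v'| ≤ B.ρ ^ 2 * N

structure HB.OK (B : HB) : Prop where
  cT : Continuous B.T
  cL : Continuous B.L
  cS1 : Continuous B.S1
  cS0 : Continuous B.S0
  cTt : Continuous B.Tt
  Tp : B.T B.p = B.p
  Lp : B.L B.p = 0
  S1p : B.S1 B.p = 0
  S0p : B.S0 B.p = 0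
  Ttp : B.Tt B.p = 0
  dyn : ∀ v v', ∃ e, B.L (B.T v) - B.L (B.T v') = B.lam * (B.L v - B.L v') + e ∧
    B.S1 (B.T v) - B.S1 (B.T v') = B.S0 v - B.S0 v' ∧
    B.S0 (B.T v) - B.S0 (B.T v') = -(B.Tt v - B.Tt v') + e ∧
    B.Tt (B.T v) - B.Tt (B.T v') = B.k0 * (B.S0 v - B.S0 v') - B.k1 * (B.S1 v - B.S1 v') + B.l1 * e ∧
    (B.U v → B.U v' → ∀ N, |B.L v - B.L v'| ≤ N → B.bd v v' N → |e| ≤ B.E * N) ∧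
    (v' = B.p → B.U v → |e| ≤ B.e0 ∧ ∀ N, |B.L v - B.L v'| ≤ N → B.bd v v' N → |e| ≤ B.Eh * N)
  a0 : 0 < B.a
  b0 : 0 < B.b
  l10 : 0 ≤ B.l1
  k10 : 0 ≤ B.k1
  ρ0 : 0 < B.ρ
  ρ1 : B.ρ ≤ 1
  lam0 : 0 ≤ B.lam
  ineq1 : B.ρ ^ 2 * B.b + B.e0 ≤ B.ρ * B.b
  ineq2 : |B.k0| * (B.ρ * B.b) + B.k1 * B.b + B.l1 * B.e0 ≤ B.ρ ^ 2 * B.b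
  ineq3 : B.a ≤ B.lam * B.a - B.e0
  gr1 : 1 < B.gr
  ineq4 : B.gr ≤ B.lam - B.E
  ineq4' : B.gr ≤ B.lam - B.Eh
  ineq5 : B.ρ ^ 2 + B.E ≤ B.ρ * B.gr
  ineq6 : |B.k0| * B.ρ + B.k1 + B.l1 * B.E ≤ B.ρ ^ 2 * B.gr
  θ0 : 0 < B.θ
  θ1 : B.θ < 1
  ineq7 : B.ρ ≤ B.θ
  ineq8 : B.ρ ^ 2 + B.Eh ≤ B.ρ * B.θ
  ineq9 : |B.k0| * B.ρ + B.k1 + B.l1 * B.Eh ≤ B.ρ ^ 2 * B.θ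

theorem abs_lin (k0 k1 l1 x y e X Y Z : ℝ) (hk : 0 ≤ k1) (hl : 0 ≤ l1) (hx : |x| ≤ X) (hy : |y| ≤ Y)
    (he : |e| ≤ Z) : |k0 * x - k1 * y + l1 * e| ≤ |k0| * X + k1 * Y + l1 * Z := by
  have q1 : |k0 * x| ≤ |k0| * X := by rw [abs_mul]; gcongr
  have q2 : |-(k1 * y)| ≤ k1 * Y := by rw [abs_neg, abs_mul, abs_of_nonneg hk]; gcongr
  have q3 : |l1 * e| ≤ l1 * Z := by rw [abs_mul, abs_of_nonneg hl]; gcongr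
  exact abs_le_add3 (by ring) q1 q2 q3

namespace HB.OK

theorem pU {B : HB} (h : B.OK) : B.U B.p := by
  have := h.a0; have := h.b0; have := h.ρ0
  refine ⟨?_, ?_, ?_, ?_⟩
  · rw [h.Lp, abs_zero]; positivity
  · rw [h.S1p, abs_zero]; positivity
  · rw [h.S0p, abs_zero]; positivity
  · rw [h.Ttp, abs_zero]; positivity

/-- the `h`-bounds are invariant, and the exit faces are mapped outside. -/
theorem step {B : HB} (h : B.OK) (v : ℝ × ℝ × ℝ) (hv : B.U v) : B.hset (B.T v) ∧ (B.L v ≤ -B.a → B.L (B.T v) ≤ -B.a) ∧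
    (B.a ≤ B.L v → B.a ≤ B.L (B.T v)) := by
  obtain ⟨e, d1, d2, d3, d4, -, d6⟩ := h.dyn v B.p
  rw [h.Tp] at d1 d2 d3 d4
  simp only [h.Lp, h.S1p, h.S0p, h.Ttp, sub_zero] at d1 d2 d3 d4
  obtain ⟨he, -⟩ := d6 rfl hv
  obtain ⟨hL, h1, h2, h3⟩ := hv
  have i1 := h.ineq1; have i2 := h.ineq2; have i3 := h.ineq3
  have hb := h.b0
  refine ⟨⟨?_, ?_, ?_⟩, ?_, ?_⟩
  · rw [d2]; nlinarith [h.ρ1]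
  · rw [d3]
    refine (abs_add_le _ _).trans ?_
    rw [abs_neg]; linarith
  · rw [d4]
    exact (abs_lin _ _ _ _ _ _ _ _ _ h.k10 h.l10 h2 h1 he).trans i2
  · intro hl
    have := (abs_le.1 he).2
    rw [d1]; nlinarith [h.lam0]
  · intro hl
    have := (abs_le.1 he).1
    rw [d1]; nlinarith [h.lam0]

theorem U_closed {B : HB} (h : B.OK) : IsClosed {v | B.U v} := by
  have c1 := h.cL; have c2 := h.cS1; have c3 := h.cS0; have c4 := h.cTt
  have : {v | B.U v} = {v | |B.L v| ≤ B.a} ∩ ({v | |B.S1 v| ≤ B.b} ∩ ({v | |B.S0 v| ≤ B.ρ * B.b} ∩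
    {v | |B.Tt v| ≤ B.ρ ^ 2 * B.b})) := rfl
  rw [this]
  refine (isClosed_le (by fun_prop) (by fun_prop)).inter ((isClosed_le (by fun_prop) (by fun_prop)).inter
    ((isClosed_le (by fun_prop) (by fun_prop)).inter (isClosed_le (by fun_prop) (by fun_prop))))

theorem iter_cont {B : HB} (h : B.OK) (n : ℕ) : Continuous (B.T^[n]) := h.cT.iterate n

/-- set of points staying in `U` forever is closed -/
theorem stay_closed {B : HB} (h : B.OK) : IsClosed {v | ∀ n, B.U (B.T^[n] v)} := by
  have : {v | ∀ n, B.U (B.T^[n] v)} = ⋂ n, (B.T^[n]) ⁻¹' {v | B.U v} := by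
    ext v; simp
  rw [this]
  exact isClosed_iInter fun n => h.U_closed.preimage (h.iter_cont n)

theorem exit {B : HB} (h : B.OK) (c : ℝ → ℝ × ℝ × ℝ) (x0 x1 : ℝ) (hx : x0 ≤ x1) (hc : Continuous c)
    (hh : ∀ s ∈ Set.Icc x0 x1, B.hset (c s)) (h0 : B.L (c x0) ≤ -B.a) (h1 : B.a ≤ B.L (c x1)) :
    ∃ s ∈ Set.Icc x0 x1, ∀ n, B.U (B.T^[n] (c s)) := by
  have key : ∀ n : ℕ, ∃ u w, x0 ≤ u ∧ u ≤ w ∧ w ≤ x1 ∧ (∀ s ∈ Set.Icc u w, ∀ k ≤ n, B.U (B.T^[k] (c s))) ∧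
      B.L (B.T^[n] (c u)) ≤ -B.a ∧ B.a ≤ B.L (B.T^[n] (c w)) := by
    intro n
    induction n with
    | zero =>
      obtain ⟨u, w, k1, k2, k3, k4, k5, k6⟩ := cross_lemma (fun s => B.L (c s)) x0 x1 B.a hx h.a0.le
        (h.cL.comp hc).continuousOn h0 h1
      refine ⟨u, w, k1, k2, k3, fun s hs k hk => ?_, k4, k5⟩
      obtain rfl : k = 0 := by omega
      exact ⟨k6 s hs, hh s ⟨k1.trans hs.1, hs.2.trans k3⟩⟩
    | succ n ih =>
      obtain ⟨u, w, k1, k2, k3, k4, k5, k6⟩ := ih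
      have a1 := (h.step _ (k4 u ⟨le_rfl, k2⟩ n le_rfl)).2.1 k5
      have a2 := (h.step _ (k4 w ⟨k2, le_rfl⟩ n le_rfl)).2.2 k6
      rw [← Function.iterate_succ_apply' B.T] at a1 a2
      obtain ⟨u', w', m1, m2, m3, m4, m5, m6⟩ := cross_lemma (fun s => B.L (B.T^[n + 1] (c s))) u w B.a k2 h.a0.le
        (h.cL.comp ((h.iter_cont _).comp hc)).continuousOn a1 a2
      refine ⟨u', w', k1.trans m1, m2, m3.trans k3, fun s hs k hk => ?_, m4, m5⟩
      have hs' : s ∈ Set.Icc u w := ⟨m1.trans hs.1, hs.2.trans m3⟩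
      rcases Nat.lt_or_ge n k with hk' | hk'
      · obtain rfl : k = n + 1 := by omega
        refine ⟨m6 s hs, ?_⟩
        rw [Function.iterate_succ_apply']
        exact (h.step _ (k4 s hs' n le_rfl)).1
      · exact k4 s hs' k hk'
  have hcl : ∀ n : ℕ, IsClosed (Set.Icc x0 x1 ∩ {s | ∀ k ≤ n, B.U (B.T^[k] (c s))}) := by
    intro n
    refine isClosed_Icc.inter ?_
    have : {s | ∀ k ≤ n, B.U (B.T^[k] (c s))} = ⋂ k, ⋂ (_ : k ≤ n), (fun s => B.T^[k] (c s)) ⁻¹' {v | B.U v} := by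
      ext s; simp
    rw [this]
    exact isClosed_iInter fun k => isClosed_iInter fun _ => h.U_closed.preimage ((h.iter_cont k).comp hc)
  obtain ⟨s, hs⟩ := IsCompact.nonempty_iInter_of_sequence_nonempty_isCompact_isClosed
    (fun n : ℕ => Set.Icc x0 x1 ∩ {s | ∀ k ≤ n, B.U (B.T^[k] (c s))})
    (fun n s hs => ⟨hs.1, fun k hk => hs.2 k (by omega)⟩)
    (fun n => by
      obtain ⟨u, w, k1, k2, k3, k4, -, -⟩ := key n
      exact ⟨u, ⟨k1, k2.trans k3⟩, k4 u ⟨le_rfl, k2⟩⟩)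
    (isCompact_Icc.of_isClosed_subset (hcl 0) Set.inter_subset_left) hcl
  rw [Set.mem_iInter] at hs
  exact ⟨s, (hs 0).1, fun n => (hs n).2 n le_rfl⟩

/-- cones are preserved and expanded -/
theorem cone {B : HB} (h : B.OK) (v v' : ℝ × ℝ × ℝ) (hv : B.U v) (hv' : B.U v') (hc : B.bd v v' |B.L v - B.L v'|) :
    B.gr * |B.L v - B.L v'| ≤ |B.L (B.T v) - B.L (B.T v')| ∧
    B.bd (B.T v) (B.T v') |B.L (B.T v) - B.L (B.T v')| := by
  obtain ⟨e, d1, d2, d3, d4, d5, -⟩ := h.dyn v v'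
  have he := d5 hv hv' _ le_rfl hc
  obtain ⟨c1, c2, c3⟩ := hc
  set N := |B.L v - B.L v'| with hN
  have hN0 : 0 ≤ N := abs_nonneg _
  have i4 := h.ineq4; have i5 := h.ineq5; have i6 := h.ineq6
  have hρ := h.ρ0
  have g : B.gr * N ≤ |B.L (B.T v) - B.L (B.T v')| := by
    rw [d1]
    have := abs_sub_abs_le_abs_sub (B.lam * (B.L v - B.L v')) (-e)
    rw [sub_neg_eq_add, abs_mul, abs_neg, abs_of_nonneg h.lam0, ← hN] at this
    nlinarith
  set N' := |B.L (B.T v) - B.L (B.T v')|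
  refine ⟨g, ?_, ?_, ?_⟩
  · rw [d2]
    have := h.gr1; have := h.ρ1
    nlinarith
  · rw [d3]
    refine (abs_add_le _ _).trans ?_
    rw [abs_neg]
    nlinarith
  · rw [d4]
    refine (abs_lin _ _ _ _ _ _ _ _ _ h.k10 h.l10 c2 c1 he).trans ?_
    have q1 : (|B.k0| * B.ρ + B.k1 + B.l1 * B.E) * N ≤ B.ρ ^ 2 * B.gr * N := mul_le_mul_of_nonneg_right i6 hN0
    have q2 : B.ρ ^ 2 * (B.gr * N) ≤ B.ρ ^ 2 * N' := mul_le_mul_of_nonneg_left g (by positivity)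
    nlinarith

theorem unique {B : HB} (h : B.OK) (v v' : ℝ × ℝ × ℝ) (hv : ∀ n, B.U (B.T^[n] v)) (hv' : ∀ n, B.U (B.T^[n] v'))
    (hc : B.bd v v' |B.L v - B.L v'|) : B.L v = B.L v' := by
  have key : ∀ n : ℕ, B.gr ^ n * |B.L v - B.L v'| ≤ |B.L (B.T^[n] v) - B.L (B.T^[n] v')| ∧
      B.bd (B.T^[n] v) (B.T^[n] v') |B.L (B.T^[n] v) - B.L (B.T^[n] v')| := by
    intro n
    induction n with
    | zero => simpa using hc
    | succ n ih =>
      have := h.cone _ _ (hv n) (hv' n) ih.2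
      rw [← Function.iterate_succ_apply' B.T, ← Function.iterate_succ_apply' B.T] at this
      refine ⟨?_, this.2⟩
      refine le_trans ?_ this.1
      rw [pow_succ', mul_assoc]
      exact mul_le_mul_of_nonneg_left ih.1 (by linarith [h.gr1])
  by_contra hne
  have hpos : 0 < |B.L v - B.L v'| := abs_pos.2 (sub_ne_zero.2 hne)
  obtain ⟨n, hn⟩ := pow_unbounded_of_one_lt (2 * B.a / |B.L v - B.L v'|) h.gr1
  rw [div_lt_iff₀ hpos] at hn
  have h1 := (key n).1
  have h2 := (hv n).1
  have h3 := (hv' n).1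
  have h4 := abs_sub (B.L (B.T^[n] v)) (B.L (B.T^[n] v'))
  linarith

theorem iter_p {B : HB} (h : B.OK) (n : ℕ) : B.T^[n] B.p = B.p := Function.iterate_fixed h.Tp n

theorem conv_bd {B : HB} (h : B.OK) (v : ℝ × ℝ × ℝ) (hv : ∀ n, B.U (B.T^[n] v)) : ∃ N0 : ℝ, ∀ n : ℕ,
    |B.L (B.T^[n] v)| ≤ N0 * B.θ ^ n ∧ |B.S1 (B.T^[n] v)| ≤ N0 * B.θ ^ n ∧
    |B.S0 (B.T^[n] v)| ≤ B.ρ * (N0 * B.θ ^ n) ∧ |B.Tt (B.T^[n] v)| ≤ B.ρ ^ 2 * (N0 * B.θ ^ n) := by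
  have hb := h.b0
  have ha := h.a0
  have hρ := h.ρ0
  have hsm : ∀ N : ℝ, ∀ n : ℕ, 0 ≤ N → B.bd (B.T^[n] v) B.p N → |B.L (B.T^[n] v)| ≤ N := by
    intro N n hN hbd
    by_contra hc
    push Not at hc
    have hcone : B.bd (B.T^[n] v) B.p |B.L (B.T^[n] v) - B.L B.p| := by
      rw [h.Lp, sub_zero]
      exact ⟨hbd.1.trans hc.le, hbd.2.1.trans (by gcongr), hbd.2.2.trans (by gcongr)⟩
    have := h.unique (B.T^[n] v) B.p (fun k => by rw [← Function.iterate_add_apply]; exact hv _)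
      (fun k => by rw [h.iter_p]; exact h.pU) hcone
    rw [this, h.Lp, abs_zero] at hc
    linarith
  refine ⟨B.b + B.a, fun n => ?_⟩
  have hθ := h.θ0
  suffices hs : B.bd (B.T^[n] v) B.p ((B.b + B.a) * B.θ ^ n) by
    refine ⟨hsm _ n (by positivity) hs, ?_⟩
    obtain ⟨s1, s2, s3⟩ := hs
    rw [h.S1p, sub_zero] at s1
    rw [h.S0p, sub_zero] at s2
    rw [h.Ttp, sub_zero] at s3
    exact ⟨s1, s2, s3⟩
  induction n with
  | zero =>
    obtain ⟨-, s1, s2, s3⟩ := hv 0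
    rw [pow_zero, mul_one]
    refine ⟨?_, ?_, ?_⟩
    · rw [h.S1p, sub_zero]; linarith
    · rw [h.S0p, sub_zero]; nlinarith
    · rw [h.Ttp, sub_zero]; nlinarith [mul_pos (pow_pos hρ 2) ha]
  | succ n ih =>
    have hL := hsm _ n (by positivity) ih
    obtain ⟨e, d1, d2, d3, d4, -, d6⟩ := h.dyn (B.T^[n] v) B.p
    have he := (d6 rfl (hv n)).2 _ (by rw [h.Lp, sub_zero]; exact hL) ih
    obtain ⟨c1, c2, c3⟩ := ih
    rw [h.Tp] at d2 d3 d4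
    rw [← Function.iterate_succ_apply' B.T] at d2 d3 d4
    set N := (B.b + B.a) * B.θ ^ n with hNdef
    have hN0 : 0 ≤ N := by positivity
    have hN' : (B.b + B.a) * B.θ ^ (n + 1) = B.θ * N := by rw [pow_succ, hNdef]; ring
    rw [hN']
    have i7 := h.ineq7; have i8 := h.ineq8; have i9 := h.ineq9
    refine ⟨?_, ?_, ?_⟩
    · rw [d2]; nlinarith
    · rw [d3]
      refine (abs_add_le _ _).trans ?_
      rw [abs_neg]
      nlinarith
    · rw [d4]
      refine (abs_lin _ _ _ _ _ _ _ _ _ h.k10 h.l10 c2 c1 he).trans ?_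
      nlinarith [mul_le_mul_of_nonneg_right i9 hN0]

end HB.OK

end Lom

namespace Lom

/-! ### The two concrete blocks -/

noncomputable def mkHB (q : Par) (p lam l1 l2 ρ aL bS E Eh e0 θ gr : ℝ) : HB where
  T := mp q
  L := fun v => (v.1 + l1 * v.2.1 + l2 * v.2.2) / sc - (1 + l1 + l2) * p
  S1 := fun v => (v.2.1 - lam * v.2.2) / sc - (1 - lam) * p
  S0 := fun v => (v.1 - lam * v.2.1) / sc - (1 - lam) * p
  Tt := fun v => (l1 * v.1 - (lam * l1 - l2) * v.2.1 - v.2.2) / sc - (l1 - (lam * l1 - l2) - 1) * p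
  p := (sc * p, sc * p, sc * p)
  a := aL
  b := bS
  ρ := ρ
  lam := lam
  k0 := l2 - l1 ^ 2
  k1 := l1 * l2
  l1 := l1
  E := E
  Eh := Eh
  e0 := e0
  θ := θ
  gr := gr

/-- numerical hypotheses for a block -/
structure BNum (q : Par) (p lam l1 l2 ρ aL bS E Eh e0 θ gr : ℝ) : Prop where
  fix : Hs q (sc * p) (sc * p) = 0
  ll : lam * l2 = 1
  lam0 : 0 < lam
  l10 : 0 ≤ l1
  l20 : 0 < l2
  num : ∃ eA eB D0 D1 c0 c1 : ℝ, 0 ≤ eA ∧ 0 ≤ eB ∧ 0 ≤ D0 ∧ 0 ≤ D1 ∧ 0 ≤ c0 ∧ 0 ≤ c1 ∧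
    |(q.t1.toR + 2 * q.a.toR * p + q.b.toR * p) / 100000 - (lam - l1)| ≤ eA ∧
    |(q.t2.toR + q.b.toR * p + 2 * q.c.toR * p) / 100000 - (lam * l1 - l2)| ≤ eB ∧
    lam ^ 2 * aL + bS + (l1 * lam + l2) * (ρ * bS) ≤ D0 * (lam ^ 2 + l1 * lam + l2) ∧
    lam * aL + l2 * bS + lam * (ρ * bS) ≤ D1 * (lam ^ 2 + l1 * lam + l2) ∧
    lam ^ 2 + 1 + (l1 * lam + l2) * ρ ≤ c0 * (lam ^ 2 + l1 * lam + l2) ∧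
    lam + l2 + lam * ρ ≤ c1 * (lam ^ 2 + l1 * lam + l2) ∧
    (eA + (2 * (q.a.abs / 100000) * D0 + q.b.abs / 100000 * D1)) * c0 +
      (eB + (q.b.abs / 100000 * D0 + 2 * (q.c.abs / 100000) * D1)) * c1 ≤ E ∧
    (eA + (2 * (q.a.abs / 100000) * (D0 / 2) + q.b.abs / 100000 * (D1 / 2))) * c0 +
      (eB + (q.b.abs / 100000 * (D0 / 2) + 2 * (q.c.abs / 100000) * (D1 / 2))) * c1 ≤ Eh ∧
    (eA + (2 * (q.a.abs / 100000) * (D0 / 2) + q.b.abs / 100000 * (D1 / 2))) * D0 +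
      (eB + (q.b.abs / 100000 * (D0 / 2) + 2 * (q.c.abs / 100000) * (D1 / 2))) * D1 ≤ e0
  a0 : 0 < aL
  b0 : 0 < bS
  ρ0 : 0 < ρ
  ρ1 : ρ ≤ 1
  ineq1 : ρ ^ 2 * bS + e0 ≤ ρ * bS
  ineq2 : |l2 - l1 ^ 2| * (ρ * bS) + l1 * l2 * bS + l1 * e0 ≤ ρ ^ 2 * bS
  ineq3 : aL ≤ lam * aL - e0
  gr1 : 1 < gr
  ineq4 : gr ≤ lam - E
  ineq4' : gr ≤ lam - Eh
  ineq5 : ρ ^ 2 + E ≤ ρ * gr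
  ineq6 : |l2 - l1 ^ 2| * ρ + l1 * l2 + l1 * E ≤ ρ ^ 2 * gr
  θ0 : 0 < θ
  θ1 : θ < 1
  ineq7 : ρ ≤ θ
  ineq8 : ρ ^ 2 + Eh ≤ ρ * θ
  ineq9 : |l2 - l1 ^ 2| * ρ + l1 * l2 + l1 * Eh ≤ ρ ^ 2 * θ

/-- recovering the coordinates -/
theorem rec_bd (lam l1 l2 d0 d1 d2 N1 N2 N3 : ℝ) (ll : lam * l2 = 1) (lam0 : 0 < lam) (l10 : 0 ≤ l1)
    (l20 : 0 < l2) (h1 : |d0 + l1 * d1 + l2 * d2| ≤ N1) (h2 : |d1 - lam * d2| ≤ N2) (h3 : |d0 - lam * d1| ≤ N3) :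
    |d0| * (lam ^ 2 + l1 * lam + l2) ≤ lam ^ 2 * N1 + N2 + (l1 * lam + l2) * N3 ∧
    |d1| * (lam ^ 2 + l1 * lam + l2) ≤ lam * N1 + l2 * N2 + lam * N3 := by
  have hQ : 0 < lam ^ 2 + l1 * lam + l2 := by positivity
  have e0 : d0 * (lam ^ 2 + l1 * lam + l2) = lam ^ 2 * (d0 + l1 * d1 + l2 * d2) + (d1 - lam * d2) +
      (l1 * lam + l2) * (d0 - lam * d1) := by
    linear_combination (d1 - lam * d2) * ll
  have e1 : d1 * (lam ^ 2 + l1 * lam + l2) = lam * (d0 + l1 * d1 + l2 * d2) + l2 * (d1 - lam * d2) +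
      -(lam * (d0 - lam * d1)) := by
    ring
  constructor
  · have hh : |d0| * (lam ^ 2 + l1 * lam + l2) = |d0 * (lam ^ 2 + l1 * lam + l2)| := by rw [abs_mul, abs_of_pos hQ]
    rw [hh]
    refine abs_le_add3 e0 ?_ h2 ?_
    · rw [abs_mul, abs_of_nonneg (by positivity : 0 ≤ lam ^ 2)]; gcongr
    · rw [abs_mul, abs_of_nonneg (by positivity : 0 ≤ l1 * lam + l2)]; gcongr
  · have hh : |d1| * (lam ^ 2 + l1 * lam + l2) = |d1 * (lam ^ 2 + l1 * lam + l2)| := by rw [abs_mul, abs_of_pos hQ]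
    rw [hh]
    refine abs_le_add3 e1 ?_ ?_ ?_
    · rw [abs_mul, abs_of_pos lam0]; gcongr
    · rw [abs_mul, abs_of_pos l20]; gcongr
    · rw [abs_neg, abs_mul, abs_of_pos lam0]; gcongr

theorem e_bd (a b c x y A0 B0 eA eB X Y u v C0 C1 : ℝ) (hA : |A0| ≤ eA) (hB : |B0| ≤ eB) (hx : |x| ≤ X)
    (hy : |y| ≤ Y) (hu : |u| ≤ C0) (hv : |v| ≤ C1) :
    |(A0 + (2 * a * x + b * y)) * u + (B0 + (b * x + 2 * c * y)) * v| ≤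
      (eA + (2 * |a| * X + |b| * Y)) * C0 + (eB + (|b| * X + 2 * |c| * Y)) * C1 := by
  have hX : 0 ≤ X := (abs_nonneg _).trans hx
  have hY : 0 ≤ Y := (abs_nonneg _).trans hy
  have q1 : |A0 + (2 * a * x + b * y)| ≤ eA + (2 * |a| * X + |b| * Y) := by
    refine (abs_add_le _ _).trans (add_le_add hA ((abs_add_le _ _).trans ?_))
    rw [abs_mul, abs_mul, abs_mul, abs_two]; gcongr
  have q2 : |B0 + (b * x + 2 * c * y)| ≤ eB + (|b| * X + 2 * |c| * Y) := by
    refine (abs_add_le _ _).trans (add_le_add hB ((abs_add_le _ _).trans ?_))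
    rw [abs_mul, abs_mul, abs_mul, abs_two]; gcongr
  refine (abs_add_le _ _).trans ?_
  rw [abs_mul, abs_mul]
  have z1 := (abs_nonneg _).trans q1
  have z2 := (abs_nonneg _).trans q2
  gcongr

set_option maxHeartbeats 1000000 in
theorem mkHB_OK (q : Par) (p lam l1 l2 ρ aL bS E Eh e0 θ gr : ℝ)
    (H : BNum q p lam l1 l2 ρ aL bS E Eh e0 θ gr) : (mkHB q p lam l1 l2 ρ aL bS E Eh e0 θ gr).OK := by
  have hs : sc ≠ 0 := sc_pos.ne'
  refine ⟨?_, ?_, ?_, ?_, ?_, ?_, ?_, ?_, ?_, ?_, ?_, H.a0, H.b0, H.l10, mul_nonneg H.l10 H.l20.le, H.ρ0, H.ρ1,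
    H.lam0.le, H.ineq1, H.ineq2, H.ineq3, H.gr1, H.ineq4, H.ineq4', H.ineq5, H.ineq6, H.θ0, H.θ1, H.ineq7, H.ineq8, H.ineq9⟩
  · simp only [mkHB]; unfold mp Hs; fun_prop
  · simp only [mkHB]; fun_prop
  · simp only [mkHB]; fun_prop
  · simp only [mkHB]; fun_prop
  · simp only [mkHB]; fun_prop
  · simp only [mkHB, mp, H.fix, add_zero]
  · simp only [mkHB]; field_simp; ring
  · simp only [mkHB]; field_simp; ring
  · simp only [mkHB]; field_simp; ring
  · simp only [mkHB]; field_simp; ring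
  rintro ⟨X, Y, W⟩ ⟨X', Y', W'⟩
  obtain ⟨eA, eB, D0, D1, c0, c1, heA, heB, hD0, hD1, hc0, hc1, kA, kB, n1, n2, n3, n4, n5, n6, n7⟩ := H.num
  have hQ : 0 < lam ^ 2 + l1 * lam + l2 := by
    have := H.lam0; have := H.l10; have := H.l20; positivity
  set A0 := (q.t1.toR + 2 * q.a.toR * p + q.b.toR * p) / 100000 - (lam - l1) with hA0
  set B0 := (q.t2.toR + q.b.toR * p + 2 * q.c.toR * p) / 100000 - (lam * l1 - l2) with hB0
  set x := ((X / sc - p) + (X' / sc - p)) / 2 with hx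
  set y := ((Y / sc - p) + (Y' / sc - p)) / 2 with hy
  set u := (X - X') / sc with hu
  set w := (Y - Y') / sc with hw
  set z := (W - W') / sc with hz
  set e := (A0 + (2 * (q.a.toR / 100000) * x + q.b.toR / 100000 * y)) * u +
    (B0 + (q.b.toR / 100000 * x + 2 * (q.c.toR / 100000) * y)) * w with he
  have hX : X / sc = X' / sc + u := by rw [hu]; ring
  have hY : Y / sc = Y' / sc + w := by rw [hw]; ring
  have hW : W / sc = W' / sc + z := by rw [hz]; ring
  have hH : Hs q X Y / sc - Hs q X' Y' / sc = (lam - l1) * u + (lam * l1 - l2) * w + e := by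
    rw [← sub_div, Hs_diff, he, hA0, hB0, hx, hy, hu, hw]
    simp only [dA, dB]
    field_simp
    ring
  have hH' : Hs q X Y / sc = Hs q X' Y' / sc + ((lam - l1) * u + (lam * l1 - l2) * w + e) := by linarith
  have ll := H.ll
  -- deviations in U
  have dev : ∀ a b c : ℝ, (mkHB q p lam l1 l2 ρ aL bS E Eh e0 θ gr).U (a, b, c) →
      |a / sc - p| ≤ D0 ∧ |b / sc - p| ≤ D1 := by
    rintro a b c ⟨q1, q2, q3, -⟩
    simp only [mkHB] at q1 q2 q3
    have := rec_bd lam l1 l2 (a / sc - p) (b / sc - p) (c / sc - p) aL bS (ρ * bS) ll H.lam0 H.l10 H.l20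
      (by convert q1 using 2; ring) (by convert q2 using 2; ring) (by convert q3 using 2; ring)
    exact ⟨le_of_mul_le_mul_right (this.1.trans n1) hQ, le_of_mul_le_mul_right (this.2.trans n2) hQ⟩
  have dif : ∀ N, |(mkHB q p lam l1 l2 ρ aL bS E Eh e0 θ gr).L (X, Y, W) -
      (mkHB q p lam l1 l2 ρ aL bS E Eh e0 θ gr).L (X', Y', W')| ≤ N →
      (mkHB q p lam l1 l2 ρ aL bS E Eh e0 θ gr).bd (X, Y, W) (X', Y', W') N → 0 ≤ N ∧ |u| ≤ c0 * N ∧ |w| ≤ c1 * N := by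
    rintro N q1 ⟨q2, q3, -⟩
    simp only [mkHB] at q1 q2 q3
    have hN : 0 ≤ N := (abs_nonneg _).trans q1
    have := rec_bd lam l1 l2 u w z N N (ρ * N) ll H.lam0 H.l10 H.l20
      (by convert q1 using 2; rw [hu, hw, hz]; ring) (by convert q2 using 2; rw [hw, hz]; ring)
      (by convert q3 using 2; rw [hu, hw]; ring)
    refine ⟨hN, le_of_mul_le_mul_right (this.1.trans ?_) hQ, le_of_mul_le_mul_right (this.2.trans ?_) hQ⟩
    · have m := mul_le_mul_of_nonneg_right n3 hN
      linear_combination m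
    · have m := mul_le_mul_of_nonneg_right n4 hN
      linear_combination m
  have ea : ∀ a : Z, |a.toR / 100000| = (a.abs : ℝ) / 100000 := by
    intro a; rw [abs_div, Z.abs_toR]; norm_num
  refine ⟨e, ?_, ?_, ?_, ?_, ?_, ?_⟩
  · simp only [mkHB, mp]
    simp only [add_div, mul_div_assoc]
    rw [hH', hX, hY, hW]
    linear_combination (-z) * ll
  · simp only [mkHB, mp]
  · simp only [mkHB, mp]
    simp only [add_div, sub_div, mul_div_assoc]
    rw [hH', hX, hY, hW]
    ring
  · simp only [mkHB, mp]
    simp only [add_div, sub_div, mul_div_assoc]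
    rw [hH', hX, hY, hW]
    linear_combination (w - l1 * z) * ll
  · intro hU hU' N hL hb
    obtain ⟨hN, du, dw⟩ := dif N hL hb
    obtain ⟨a1, a2⟩ := dev _ _ _ hU
    obtain ⟨b1, b2⟩ := dev _ _ _ hU'
    have hx' : |x| ≤ D0 := by
      rw [hx, abs_div, abs_two]; have := abs_add_le (X / sc - p) (X' / sc - p); linarith
    have hy' : |y| ≤ D1 := by
      rw [hy, abs_div, abs_two]; have := abs_add_le (Y / sc - p) (Y' / sc - p); linarith
    have := e_bd (q.a.toR / 100000) (q.b.toR / 100000) (q.c.toR / 100000) x y A0 B0 eA eB D0 D1 u w _ _ kA kB hx' hy' du dw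
    rw [ea, ea, ea] at this
    rw [he]
    refine this.trans ?_
    simp only [mkHB]
    have m := mul_le_mul_of_nonneg_right n5 hN
    linear_combination m
  · intro hp hU
    simp only [mkHB, Prod.mk.injEq] at hp
    obtain ⟨p1, p2, p3⟩ := hp
    obtain ⟨a1, a2⟩ := dev _ _ _ hU
    have p1' : X' / sc - p = 0 := by rw [p1]; field_simp; ring
    have p2' : Y' / sc - p = 0 := by rw [p2]; field_simp; ring
    have hx' : |x| ≤ D0 / 2 := by
      rw [hx, p1', add_zero, abs_div, abs_two]; linarith
    have hy' : |y| ≤ D1 / 2 := by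
      rw [hy, p2', add_zero, abs_div, abs_two]; linarith
    constructor
    · have hu' : |u| ≤ D0 := by
        have : u = X / sc - p := by linarith
        rw [this]; exact a1
      have hw' : |w| ≤ D1 := by
        have : w = Y / sc - p := by linarith
        rw [this]; exact a2
      have := e_bd (q.a.toR / 100000) (q.b.toR / 100000) (q.c.toR / 100000) x y A0 B0 eA eB _ _ u w _ _ kA kB hx' hy' hu' hw'
      rw [ea, ea, ea] at this
      rw [he]
      exact this.trans n7
    · intro N hL hb
      obtain ⟨hN, du, dw⟩ := dif N hL hb
      have := e_bd (q.a.toR / 100000) (q.b.toR / 100000) (q.c.toR / 100000) x y A0 B0 eA eB _ _ u w _ _ kA kB hx' hy' du dw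
      rw [ea, ea, ea] at this
      rw [he]
      refine this.trans ?_
      simp only [mkHB]
      have m := mul_le_mul_of_nonneg_right n6 hN
      linear_combination m

end Lom

namespace Lom

/-- the square root entering the fixed points -/
noncomputable def sq : ℝ := Real.sqrt (24999 / 100000)

theorem sq_sq : sq * sq = 24999 / 100000 := Real.mul_self_sqrt (by norm_num)

theorem sq_lo : 0.499989999899997999949998 ≤ sq := Real.le_sqrt_of_sq_le (by norm_num)

theorem sq_hi : sq ≤ 0.499989999899997999949999 := Real.sqrt_le_iff.2 ⟨by norm_num, by norm_num⟩

noncomputable def fpF : ℝ := -(2 / 5) + sq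
noncomputable def fpB : ℝ := -(2 / 5) - sq

noncomputable def HF : HB := mkHB parF fpF (23 / 16) (147 / 250) (16 / 23) (177 / 200) (6 / 1000) (1 / 20)
  (34187 / 250000) (34431 / 500000) (1051 / 500000) (97 / 100) (13 / 10)
noncomputable def HBk : HB := mkHB parB fpB (54 / 35) (193 / 1000) (35 / 54) (9 / 10) (16 / 10000) (33 / 1000)
  (48289 / 500000) (48571 / 1000000) (163 / 200000) (96 / 100) (723 / 500)

theorem HF_OK : HF.OK := by
  have h1 := sq_lo; have h2 := sq_hi
  apply mkHB_OK
  refine ⟨?_, by norm_num, by norm_num, by norm_num, by norm_num,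
    ⟨31 / 62500, 97 / 250000, 181 / 5000, 29667 / 1000000, 307023 / 250000, 236003 / 250000, by norm_num, by norm_num,
      by norm_num, by norm_num, by norm_num, by norm_num, ?_, ?_, by norm_num, by norm_num, by norm_num, by norm_num,
      ?_, ?_, ?_⟩, by norm_num, by norm_num, by norm_num, by norm_num, by norm_num, ?_, by norm_num, by norm_num,
    by norm_num, by norm_num, by norm_num, ?_, by norm_num, by norm_num, by norm_num, by norm_num, ?_⟩
  · simp only [Hs, parF, Z.toR, fpF]; push_cast
    have := sq_sq
    have e : sc * (-8999 * sc + (80000 * (sc * (-(2 / 5) + sq)) + 0 * (sc * (-(2 / 5) + sq)))) +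
      (50000 * (sc * (-(2 / 5) + sq) * (sc * (-(2 / 5) + sq))) + (-50000 * (sc * (-(2 / 5) + sq) * (sc * (-(2 / 5) + sq))) +
      100000 * (sc * (-(2 / 5) + sq) * (sc * (-(2 / 5) + sq))))) = 0 := by
      linear_combination (100000 * sc ^ 2) * this
    rw [e, zero_div]
  · simp only [parF, Z.toR, fpF]; push_cast; rw [abs_le]; constructor <;> linarith
  · simp only [parF, Z.toR, fpF]; push_cast; rw [abs_le]; constructor <;> linarith
  · simp only [parF, Z.abs]; norm_num
  · simp only [parF, Z.abs]; norm_num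
  · simp only [parF, Z.abs]; norm_num
  all_goals rw [abs_of_nonneg (by norm_num)]; norm_num

theorem HBk_OK : HBk.OK := by
  have h1 := sq_lo; have h2 := sq_hi
  apply mkHB_OK
  refine ⟨?_, by norm_num, by norm_num, by norm_num, by norm_num,
    ⟨2 / 15625, 93 / 250000, 2439 / 125000, 20949 / 1000000, 254439 / 200000, 215227 / 200000, by norm_num, by norm_num,
      by norm_num, by norm_num, by norm_num, by norm_num, ?_, ?_, by norm_num, by norm_num, by norm_num, by norm_num,
      ?_, ?_, ?_⟩, by norm_num, by norm_num, by norm_num, by norm_num, by norm_num, ?_, by norm_num, by norm_num,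
    by norm_num, by norm_num, by norm_num, ?_, by norm_num, by norm_num, by norm_num, by norm_num, ?_⟩
  · simp only [Hs, parB, Z.toR, fpB]; push_cast
    have := sq_sq
    have e : sc * (8999 * sc + (0 * (sc * (-(2 / 5) - sq)) + -80000 * (sc * (-(2 / 5) - sq)))) +
      (-100000 * (sc * (-(2 / 5) - sq) * (sc * (-(2 / 5) - sq))) + (50000 * (sc * (-(2 / 5) - sq) * (sc * (-(2 / 5) - sq))) +
      -50000 * (sc * (-(2 / 5) - sq) * (sc * (-(2 / 5) - sq))))) = 0 := by
      linear_combination (-100000 * sc ^ 2) * this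
    rw [e, zero_div]
  · simp only [parB, Z.toR, fpB]; push_cast; rw [abs_le]; constructor <;> linarith
  · simp only [parB, Z.toR, fpB]; push_cast; rw [abs_le]; constructor <;> linarith
  · simp only [parB, Z.abs]; norm_num
  · simp only [parB, Z.abs]; norm_num
  · simp only [parB, Z.abs]; norm_num
  all_goals rw [abs_of_nonneg (by norm_num)]; norm_num

/-- compatibility between a block and its integer version -/
structure Link (B : HB) (β : Blk) : Prop where
  h1 : ∀ v, |β.s1.ev v - β.s1.cp.toR| ≤ β.b1 → |B.S1 v| ≤ B.b
  h0 : ∀ v, |β.s0.ev v - β.s0.cp.toR| ≤ β.b0 → |B.S0 v| ≤ B.ρ * B.b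
  ht : ∀ v, |β.t.ev v - β.t.cp.toR| ≤ β.bt → |B.Tt v| ≤ B.ρ ^ 2 * B.b
  hi : ∀ v, (β.al : ℝ) ≤ β.l.ev v - β.l.cp.toR → B.a ≤ B.L v
  lo : ∀ v, β.l.ev v - β.l.cp.toR ≤ -(β.al : ℝ) → B.L v ≤ -B.a
  d1 : ∀ v v', β.s1.ev v - β.s1.ev v' = (B.S1 v - B.S1 v') * (β.s1.d * sc)
  d0 : ∀ v v', β.s0.ev v - β.s0.ev v' = (B.S0 v - B.S0 v') * (β.s0.d * sc)
  dt : ∀ v v', β.t.ev v - β.t.ev v' = (B.Tt v - B.Tt v') * (β.t.d * sc)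
  dl : ∀ v v', β.l.ev v - β.l.ev v' = (B.L v - B.L v') * (β.l.d * sc)
  p1 : 0 < β.s1.d
  p0 : 0 < β.s0.d
  pt : 0 < β.t.d
  pl : 0 < β.l.d
  pc : 0 < β.cd
  hρ : B.ρ * β.cd = β.cn

theorem linkF : Link HF blkF := by
  have h1 := sq_lo; have h2 := sq_hi
  constructor
  · intro v h
    simp only [blkF, Fn.ev, Z.toR, abs_le] at h
    simp only [HF, mkHB, fpF, abs_le, sc]; push_cast at h
    constructor <;> linarith
  · intro v h
    simp only [blkF, Fn.ev, Z.toR, abs_le] at h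
    simp only [HF, mkHB, fpF, abs_le, sc]; push_cast at h
    constructor <;> linarith
  · intro v h
    simp only [blkF, Fn.ev, Z.toR, abs_le] at h
    simp only [HF, mkHB, fpF, abs_le, sc]; push_cast at h
    constructor <;> linarith
  · intro v h
    simp only [blkF, Fn.ev, Z.toR] at h
    simp only [HF, mkHB, fpF, sc]; push_cast at h
    linarith
  · intro v h
    simp only [blkF, Fn.ev, Z.toR] at h
    simp only [HF, mkHB, fpF, sc]; push_cast at h
    linarith
  · intro v v'; simp only [blkF, Fn.ev, Z.toR, HF, mkHB, sc]; push_cast; ring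
  · intro v v'; simp only [blkF, Fn.ev, Z.toR, HF, mkHB, sc]; push_cast; ring
  · intro v v'; simp only [blkF, Fn.ev, Z.toR, HF, mkHB, sc]; push_cast; ring
  · intro v v'; simp only [blkF, Fn.ev, Z.toR, HF, mkHB, sc]; push_cast; ring
  all_goals simp only [blkF, HF, mkHB]; norm_num

theorem linkB : Link HBk blkB := by
  have h1 := sq_lo; have h2 := sq_hi
  constructor
  · intro v h
    simp only [blkB, Fn.ev, Z.toR, abs_le] at h
    simp only [HBk, mkHB, fpB, abs_le, sc]; push_cast at h
    constructor <;> linarith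
  · intro v h
    simp only [blkB, Fn.ev, Z.toR, abs_le] at h
    simp only [HBk, mkHB, fpB, abs_le, sc]; push_cast at h
    constructor <;> linarith
  · intro v h
    simp only [blkB, Fn.ev, Z.toR, abs_le] at h
    simp only [HBk, mkHB, fpB, abs_le, sc]; push_cast at h
    constructor <;> linarith
  · intro v h
    simp only [blkB, Fn.ev, Z.toR] at h
    simp only [HBk, mkHB, fpB, sc]; push_cast at h
    linarith
  · intro v h
    simp only [blkB, Fn.ev, Z.toR] at h
    simp only [HBk, mkHB, fpB, sc]; push_cast at h
    linarith
  · intro v v'; simp only [blkB, Fn.ev, Z.toR, HBk, mkHB, sc]; push_cast; ring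
  · intro v v'; simp only [blkB, Fn.ev, Z.toR, HBk, mkHB, sc]; push_cast; ring
  · intro v v'; simp only [blkB, Fn.ev, Z.toR, HBk, mkHB, sc]; push_cast; ring
  · intro v v'; simp only [blkB, Fn.ev, Z.toR, HBk, mkHB, sc]; push_cast; ring
  all_goals simp only [blkB, HBk, mkHB]; norm_num

/-- the conclusion of the end check, in terms of the block -/
structure EndHB (B : HB) (r : ℕ) (σ : St) : Prop where
  hs : ∀ (t μ : ℝ) (v : ℝ × ℝ × ℝ), 0 ≤ t → t ≤ 1 → |μ| ≤ r → EI r σ t μ v → B.hset v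
  hi : ∀ (t : ℝ) (v : ℝ × ℝ × ℝ), 0 ≤ t → t ≤ 1 → EI r σ t r v → B.a ≤ B.L v
  lo : ∀ (t : ℝ) (v : ℝ × ℝ × ℝ), 0 ≤ t → t ≤ 1 → EI r σ t (-r) v → B.L v ≤ -B.a
  bd : ∀ (δ : ℝ) (v v' : ℝ × ℝ × ℝ), UI σ δ v v' → B.bd v v' |B.L v - B.L v'|
  eq : ∀ (δ : ℝ) (v v' : ℝ × ℝ × ℝ), UI σ δ v v' → B.L v = B.L v' → δ = 0

theorem endHB_of {B : HB} {β : Blk} (l : Link B β) {r : ℕ} {σ : St} (h : EndOK r β σ) : EndHB B r σ := by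
  have hs := sc_pos
  have p1 : (0 : ℝ) < β.s1.d := by exact_mod_cast l.p1
  have p0 : (0 : ℝ) < β.s0.d := by exact_mod_cast l.p0
  have pt : (0 : ℝ) < β.t.d := by exact_mod_cast l.pt
  have pl : (0 : ℝ) < β.l.d := by exact_mod_cast l.pl
  have pc : (0 : ℝ) < β.cd := by exact_mod_cast l.pc
  have aux : ∀ x d : ℝ, 0 < d → |x * (d * sc)| = |x| * (d * sc) := by
    intro x d hd
    rw [abs_mul, abs_of_pos (mul_pos hd hs)]
  refine ⟨fun t μ v h0 h1 hμ hE => ⟨l.h1 v (h.s1 t μ v h0 h1 hμ hE), l.h0 v (h.s0 t μ v h0 h1 hμ hE),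
    l.ht v (h.st t μ v h0 h1 hμ hE)⟩, fun t v h0 h1 hE => l.hi v (h.hi t v h0 h1 hE),
    fun t v h0 h1 hE => l.lo v (h.lo t v h0 h1 hE), ?_, ?_⟩
  · intro δ v v' hU
    obtain ⟨-, c1, c2, c3⟩ := h.c δ v v' hU
    rw [l.d1, l.dl, aux _ _ p1, aux _ _ pl] at c1
    rw [l.d0, l.dl, aux _ _ p0, aux _ _ pl] at c2
    rw [l.dt, l.dl, aux _ _ pt, aux _ _ pl] at c3
    have hρ := l.hρ
    rw [← hρ] at c2 c3
    refine ⟨?_, ?_, ?_⟩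
    · refine le_of_mul_le_mul_right (a := β.s1.d * sc * β.l.d) ?_ (by positivity)
      linear_combination c1
    · refine le_of_mul_le_mul_right (a := β.s0.d * sc * (β.l.d * β.cd)) ?_ (by positivity)
      linear_combination c2
    · refine le_of_mul_le_mul_right (a := β.t.d * sc * (β.l.d * (β.cd * β.cd))) ?_ (by positivity)
      linear_combination c3
  · intro δ v v' hU he
    obtain ⟨c1, -⟩ := h.c δ v v' hU
    rw [l.dl, he, sub_self, zero_mul, abs_zero] at c1
    exact abs_nonpos_iff.1 c1

end Lom

namespace Lom

/-! ### Global selection -/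

theorem cont_of_closed {X Y : Type*} [TopologicalSpace X] [TopologicalSpace Y] (S : Set (X × Y)) (K : Set Y)
    (hS : IsClosed S) (hK : IsCompact K) (h : X → Y) (h1 : ∀ x, (x, h x) ∈ S ∧ h x ∈ K)
    (h2 : ∀ x y, (x, y) ∈ S → y ∈ K → y = h x) : Continuous h := by
  rw [continuous_iff_ultrafilter]
  intro x g hg
  obtain ⟨y, hy, hgy⟩ := hK.ultrafilter_le_nhds (g.map h) (by
    rw [Filter.le_principal_iff]
    exact Filter.mem_map.2 (Filter.univ_mem' fun x => (h1 x).2))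
  have ht : Filter.Tendsto (fun x => (x, h x)) (g : Filter X) (nhds (x, y)) := by
    rw [nhds_prod_eq]
    exact Filter.Tendsto.prodMk hg hgy
  have hm : (x, y) ∈ S := hS.mem_of_tendsto ht (Filter.Eventually.of_forall fun x => (h1 x).1)
  rw [← h2 x y hm hy]
  exact hgy

theorem clamp_mem (r s : ℝ) (hr : 0 ≤ r) : |max (-r) (min r s)| ≤ r :=
  abs_le.2 ⟨le_max_left _ _, max_le (by linarith) (min_le_left _ _)⟩

theorem clamp_of (r s : ℝ) (h : |s| ≤ r) : max (-r) (min r s) = s := by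
  rw [abs_le] at h
  rw [min_eq_right h.2, max_eq_right h.1]

structure Glob (F B : HB) (kF kB : ℕ) (R : ℝ × ℝ × ℝ → ℝ × ℝ × ℝ) (V : ℝ → ℝ → ℝ → ℝ × ℝ × ℝ) (rF rB : ℝ) : Prop where
  rF0 : 0 ≤ rF
  rB0 : 0 ≤ rB
  cR : Continuous R
  cV : Continuous (fun p : ℝ × ℝ × ℝ => V p.1 p.2.1 p.2.2)
  Fh : ∀ θ μ ν, |μ| ≤ rF → |ν| ≤ rB → F.hset (F.T^[kF] (V θ μ ν))
  Flo : ∀ θ ν, |ν| ≤ rB → F.L (F.T^[kF] (V θ (-rF) ν)) ≤ -F.a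
  Fhi : ∀ θ ν, |ν| ≤ rB → F.a ≤ F.L (F.T^[kF] (V θ rF ν))
  Bh : ∀ θ μ ν, |μ| ≤ rF → |ν| ≤ rB → B.hset (B.T^[kB] (R (V θ μ ν)))
  Blo : ∀ θ μ, |μ| ≤ rF → B.L (B.T^[kB] (R (V θ μ (-rB)))) ≤ -B.a
  Bhi : ∀ θ μ, |μ| ≤ rF → B.a ≤ B.L (B.T^[kB] (R (V θ μ rB)))
  Fc : ∀ θ μ ν μ' ν', |μ| ≤ rF → |ν| ≤ rB → |μ'| ≤ rF → |ν'| ≤ rB → |ν - ν'| ≤ 1 / 100 * |μ - μ'| →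
    F.bd (F.T^[kF] (V θ μ ν)) (F.T^[kF] (V θ μ' ν')) |F.L (F.T^[kF] (V θ μ ν)) - F.L (F.T^[kF] (V θ μ' ν'))| ∧
    (F.L (F.T^[kF] (V θ μ ν)) = F.L (F.T^[kF] (V θ μ' ν')) → μ = μ')
  Bc : ∀ θ μ ν μ' ν', |μ| ≤ rF → |ν| ≤ rB → |μ'| ≤ rF → |ν'| ≤ rB → |μ - μ'| ≤ 100 * |ν - ν'| →
    B.bd (B.T^[kB] (R (V θ μ ν))) (B.T^[kB] (R (V θ μ' ν')))
      |B.L (B.T^[kB] (R (V θ μ ν))) - B.L (B.T^[kB] (R (V θ μ' ν')))| ∧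
    (B.L (B.T^[kB] (R (V θ μ ν))) = B.L (B.T^[kB] (R (V θ μ' ν'))) → ν = ν')

def stay (B : HB) (v : ℝ × ℝ × ℝ) : Prop := ∀ n, B.U (B.T^[n] v)

section
variable {F B : HB} {kF kB : ℕ} {R : ℝ × ℝ × ℝ → ℝ × ℝ × ℝ} {V : ℝ → ℝ → ℝ → ℝ × ℝ × ℝ} {rF rB : ℝ}

theorem Glob.uniq (G : Glob F B kF kB R V rF rB) (hF : F.OK) (hB : B.OK) (θ μ ν μ' ν' : ℝ) (h1 : |μ| ≤ rF) (h2 : |ν| ≤ rB)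
    (h3 : |μ'| ≤ rF) (h4 : |ν'| ≤ rB) (a : stay F (F.T^[kF] (V θ μ ν))) (a' : stay F (F.T^[kF] (V θ μ' ν')))
    (b : stay B (B.T^[kB] (R (V θ μ ν)))) (b' : stay B (B.T^[kB] (R (V θ μ' ν')))) : μ = μ' ∧ ν = ν' := by
  by_cases hc : |ν - ν'| ≤ 1 / 100 * |μ - μ'|
  · obtain ⟨k1, k2⟩ := G.Fc θ μ ν μ' ν' h1 h2 h3 h4 hc
    have e := k2 (hF.unique _ _ a a' k1)
    refine ⟨e, ?_⟩
    rw [e, sub_self, abs_zero, mul_zero] at hc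
    exact sub_eq_zero.1 (abs_nonpos_iff.1 hc)
  · push Not at hc
    obtain ⟨k1, k2⟩ := G.Bc θ μ ν μ' ν' h1 h2 h3 h4 (by linarith)
    have e := k2 (hB.unique _ _ b b' k1)
    rw [e, sub_self, abs_zero] at hc
    have := abs_nonneg (μ - μ')
    linarith

theorem Glob.ex (G : Glob F B kF kB R V rF rB) (hF : F.OK) (hB : B.OK) (θ : ℝ) : ∃ μ ν, |μ| ≤ rF ∧ |ν| ≤ rB ∧
    stay F (F.T^[kF] (V θ μ ν)) ∧ stay B (B.T^[kB] (R (V θ μ ν))) := by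
  have cV := G.cV
  have cR := G.cR
  have s1 : ∀ s : ℝ, ∃ ν, |ν| ≤ rB ∧ stay B (B.T^[kB] (R (V θ (max (-rF) (min rF s)) ν))) := by
    intro s
    have hm := clamp_mem rF s G.rF0
    have hr := G.rB0
    have cc : Continuous (fun ν : ℝ => V θ (max (-rF) (min rF s)) ν) :=
      cV.comp (f := fun ν : ℝ => (θ, max (-rF) (min rF s), ν)) (by fun_prop)
    obtain ⟨ν, hν, h⟩ := hB.exit (fun ν => B.T^[kB] (R (V θ (max (-rF) (min rF s)) ν))) (-rB) rB (by linarith)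
      ((hB.iter_cont kB).comp (cR.comp cc)) (fun ν hν => G.Bh _ _ _ hm (abs_le.2 hν)) (G.Blo _ _ hm) (G.Bhi _ _ hm)
    exact ⟨ν, abs_le.2 hν, h⟩
  choose ψ hψ hψ' using s1
  have lip : ∀ s s', |ψ s - ψ s'| ≤ 1 / 100 * |s - s'| := by
    intro s s'
    have hm := clamp_mem rF s G.rF0
    have hm' := clamp_mem rF s' G.rF0
    have hcl : |max (-rF) (min rF s) - max (-rF) (min rF s')| ≤ |s - s'| := by
      refine (abs_max_sub_max_le_max _ _ _ _).trans (max_le (by simp) ((abs_min_sub_min_le_max _ _ _ _).trans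
        (max_le (by simp) le_rfl)))
    by_contra hc
    push Not at hc
    obtain ⟨k1, k2⟩ := G.Bc θ _ _ _ _ hm (hψ s) hm' (hψ s') (by linarith)
    have e := k2 (hB.unique _ _ (hψ' s) (hψ' s') k1)
    rw [e, sub_self, abs_zero] at hc
    have := abs_nonneg (s - s')
    linarith
  have cψ : Continuous ψ := by
    refine (LipschitzWith.of_dist_le_mul (K := 1 / 100) fun s s' => ?_).continuous
    rw [Real.dist_eq, Real.dist_eq]
    simpa using lip s s'
  have hr := G.rF0
  have cc : Continuous (fun s : ℝ => V θ (max (-rF) (min rF s)) (ψ s)) :=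
    cV.comp (f := fun s : ℝ => (θ, max (-rF) (min rF s), ψ s)) (by fun_prop)
  obtain ⟨s, hs, h⟩ := hF.exit (fun s => F.T^[kF] (V θ (max (-rF) (min rF s)) (ψ s))) (-rF) rF (by linarith)
    ((hF.iter_cont kF).comp cc) (fun s hs => G.Fh _ _ _ (clamp_mem _ _ hr) (hψ s))
    (by have := G.Flo θ _ (hψ (-rF)); rwa [clamp_of rF (-rF) (by rw [abs_neg, abs_of_nonneg hr])])
    (by have := G.Fhi θ _ (hψ rF); rwa [clamp_of rF rF (by rw [abs_of_nonneg hr])])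
  exact ⟨_, ψ s, clamp_mem _ _ hr, hψ s, h, hψ' s⟩

theorem Glob.sel (G : Glob F B kF kB R V rF rB) (hF : F.OK) (hB : B.OK) : ∃ m n : ℝ → ℝ, Continuous m ∧ Continuous n ∧
    ∀ θ, |m θ| ≤ rF ∧ |n θ| ≤ rB ∧ stay F (F.T^[kF] (V θ (m θ) (n θ))) ∧ stay B (B.T^[kB] (R (V θ (m θ) (n θ)))) := by
  have hx := G.ex hF hB
  choose m n h1 h2 h3 h4 using hx
  have hc : Continuous (fun θ => (m θ, n θ)) := by
    refine cont_of_closed ((fun p : ℝ × ℝ × ℝ => F.T^[kF] (V p.1 p.2.1 p.2.2)) ⁻¹' {v | ∀ n, F.U (F.T^[n] v)} ∩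
      (fun p : ℝ × ℝ × ℝ => B.T^[kB] (R (V p.1 p.2.1 p.2.2))) ⁻¹' {v | ∀ n, B.U (B.T^[n] v)})
      (Set.Icc (-rF) rF ×ˢ Set.Icc (-rB) rB) ?_ (isCompact_Icc.prod isCompact_Icc) _ ?_ ?_
    · exact (hF.stay_closed.preimage ((hF.iter_cont kF).comp G.cV)).inter
        (hB.stay_closed.preimage ((hB.iter_cont kB).comp (G.cR.comp G.cV)))
    · intro θ
      exact ⟨⟨h3 θ, h4 θ⟩, abs_le.1 (h1 θ), abs_le.1 (h2 θ)⟩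
    · rintro θ ⟨μ, ν⟩ ⟨a, b⟩ ⟨c, d⟩
      obtain ⟨e1, e2⟩ := G.uniq hF hB θ μ ν (m θ) (n θ) (abs_le.2 c) (abs_le.2 d) (h1 θ) (h2 θ) a (h3 θ) b (h4 θ)
      rw [Prod.mk.injEq]; exact ⟨e1, e2⟩
  exact ⟨m, n, hc.fst, hc.snd, fun θ => ⟨h1 θ, h2 θ, h3 θ, h4 θ⟩⟩

end

/-! ### Piecewise linear interpolation -/

noncomputable def pl (s : ℤ → ℝ) (θ : ℝ) : ℝ := (1 - Int.fract θ) * s ⌊θ⌋ + Int.fract θ * s (⌊θ⌋ + 1)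

theorem pl_on (s : ℤ → ℝ) (n : ℤ) (θ : ℝ) (h : θ ∈ Set.Icc (n : ℝ) (n + 1)) :
    pl s θ = (1 - (θ - n)) * s n + (θ - n) * s (n + 1) := by
  rcases h.2.lt_or_eq with hl | he
  · have : ⌊θ⌋ = n := Int.floor_eq_iff.2 ⟨h.1, hl⟩
    rw [pl, Int.fract, this]
  · have hf : ⌊θ⌋ = n + 1 := by rw [he]; simp
    rw [pl, Int.fract, hf, he]; push_cast; ring

theorem pl_cont (s : ℤ → ℝ) : Continuous (pl s) := by
  have lf : LocallyFinite (fun n : ℤ => Set.Icc (n : ℝ) (n + 1)) := by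
    intro x
    refine ⟨Set.Ioo (x - 1) (x + 1), Ioo_mem_nhds (by linarith) (by linarith), ?_⟩
    refine (Set.finite_Icc (⌊x⌋ - 3) (⌊x⌋ + 3)).subset ?_
    rintro n ⟨y, ⟨y1, y2⟩, y3, y4⟩
    have f1 := Int.floor_le x
    have f2 := Int.lt_floor_add_one x
    constructor
    · by_contra hc
      push Not at hc
      have : n + 1 ≤ ⌊x⌋ - 3 := by omega
      have : (n : ℝ) + 1 ≤ ⌊x⌋ - 3 := by exact_mod_cast this
      linarith
    · by_contra hc
      push Not at hc
      have : ⌊x⌋ + 3 + 1 ≤ n := by omega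
      have : (⌊x⌋ : ℝ) + 3 + 1 ≤ n := by exact_mod_cast this
      linarith
  refine lf.continuous ?_ (fun _ => isClosed_Icc) fun n => ?_
  · ext x
    simp only [Set.mem_iUnion, Set.mem_univ, iff_true]
    exact ⟨⌊x⌋, Int.floor_le x, (Int.lt_floor_add_one x).le⟩
  · refine ContinuousOn.congr (f := fun θ => (1 - (θ - n)) * s n + (θ - n) * s (n + 1)) (by fun_prop) fun θ hθ => ?_
    exact pl_on s n θ hθ

theorem pl_per (s : ℤ → ℝ) (P : ℤ) (h : ∀ k, s (k + P) = s k) (θ : ℝ) : pl s (θ + P) = pl s θ := by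
  rw [pl, pl, Int.fract_add_intCast, Int.floor_add_intCast, h, show ⌊θ⌋ + P + 1 = ⌊θ⌋ + 1 + P by ring, h]

end Lom

namespace Lom

/-! ### The verified cells -/

noncomputable def NL.len (l : NL) : Nat := NL.rec (motive := fun _ => Nat) 0 (fun _ _ _ _ _ ih => ih + 1) l

theorem chk_sound (l : NL) : ∀ (x0 x1 x2 w : Z) (k : ℕ), chk l ⟨x0, x1, x2, w⟩ k = true → ∀ j, j < l.len →
    cellK (k + j) ((NL.cons x0 x1 x2 w l).get j) ((NL.cons x0 x1 x2 w l).get (j + 1)) = true := by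
  induction l with
  | nil => intro _ _ _ _ _ _ j hj; exact absurd hj (Nat.not_lt_zero j)
  | cons y0 y1 y2 z t ih =>
    intro x0 x1 x2 w k h j hj
    have h' : (Bool.rec (motive := fun _ => Bool) false (chk t ⟨y0, y1, y2, z⟩ (Nat.succ k))
      (cellK k ⟨x0, x1, x2, w⟩ ⟨y0, y1, y2, z⟩)) = true := h
    cases hc : cellK k ⟨x0, x1, x2, w⟩ ⟨y0, y1, y2, z⟩ with
    | false => rw [hc] at h'; exact Bool.noConfusion h'
    | true =>
      rw [hc] at h'
      cases j with
      | zero => exact hc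
      | succ j =>
        have := ih y0 y1 y2 z (k + 1) h' j (Nat.lt_of_succ_lt_succ hj)
        rw [show k + (j + 1) = k + 1 + j by omega]
        exact this

theorem chkC_sound (l : NL) (k : ℕ) (h : chkC l k = true) (hl : l.len = 20) : ∀ j, j < 19 →
    cellK (k + j) (l.get j) (l.get (j + 1)) = true := by
  cases l with
  | nil => exact Bool.noConfusion h
  | cons x0 x1 x2 w t =>
    intro j hj
    refine chk_sound t x0 x1 x2 w k h j ?_
    have : t.len + 1 = 20 := hl
    omega

theorem cell_chunk (i : ℕ) (hi : i < 20) : ∀ j, j < 19 →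
    cellK (19 * i + j) ((chunk i).get j) ((chunk i).get (j + 1)) = true := by
  interval_cases i
  · exact chkC_sound _ _ chunk_ok0 rfl
  · exact chkC_sound _ _ chunk_ok1 rfl
  · exact chkC_sound _ _ chunk_ok2 rfl
  · exact chkC_sound _ _ chunk_ok3 rfl
  · exact chkC_sound _ _ chunk_ok4 rfl
  · exact chkC_sound _ _ chunk_ok5 rfl
  · exact chkC_sound _ _ chunk_ok6 rfl
  · exact chkC_sound _ _ chunk_ok7 rfl
  · exact chkC_sound _ _ chunk_ok8 rfl
  · exact chkC_sound _ _ chunk_ok9 rfl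
  · exact chkC_sound _ _ chunk_ok10 rfl
  · exact chkC_sound _ _ chunk_ok11 rfl
  · exact chkC_sound _ _ chunk_ok12 rfl
  · exact chkC_sound _ _ chunk_ok13 rfl
  · exact chkC_sound _ _ chunk_ok14 rfl
  · exact chkC_sound _ _ chunk_ok15 rfl
  · exact chkC_sound _ _ chunk_ok16 rfl
  · exact chkC_sound _ _ chunk_ok17 rfl
  · exact chkC_sound _ _ chunk_ok18 rfl
  · exact chkC_sound _ _ chunk_ok19 rfl

theorem chunk_glue (i : ℕ) (hi : i < 20) : (chunk i).get 19 = (chunk (i + 1)).get 0 := by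
  interval_cases i <;> rfl

theorem nd_cell (k : ℕ) (hk : k < 380) : cellK k (nd k) (nd (k + 1)) = true := by
  have hi : k / 19 < 20 := by omega
  have hj : k % 19 < 19 := Nat.mod_lt _ (by norm_num)
  have h := cell_chunk (k / 19) hi (k % 19) hj
  rw [Nat.div_add_mod] at h
  have e : nd (k + 1) = (chunk (k / 19)).get (k % 19 + 1) := by
    unfold nd
    by_cases hc : k % 19 = 18
    · rw [hc, show (k + 1) / 19 = k / 19 + 1 by omega, show (k + 1) % 19 = 0 by omega, ← chunk_glue _ hi]
    · rw [show (k + 1) / 19 = k / 19 by omega, show (k + 1) % 19 = k % 19 + 1 by omega]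
  rw [e]
  exact h

theorem nd_380 : nd 380 = nd 0 := rfl

noncomputable def nz (k : ℤ) : Node := nd (k % 380).toNat

theorem nz_per (k : ℤ) : nz (k + 380) = nz k := by
  unfold nz
  rw [Int.add_emod_right]

theorem nz_cell (k : ℤ) : CellOK (nz k) (nz (k + 1)) := by
  have h : (k % 380).toNat < 380 := by omega
  have e : nz (k + 1) = nd ((k % 380).toNat + 1) := by
    unfold nz
    by_cases hc : (k % 380).toNat = 379
    · rw [hc, show ((k + 1) % 380).toNat = 0 by omega, ← nd_380]
    · rw [show ((k + 1) % 380).toNat = (k % 380).toNat + 1 by omega]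
  rw [e]
  have := nd_cell _ h
  unfold cellK at this
  rw [Bool.and_eq_true] at this
  exact cellOK_sound _ _ this.2

/-! ### Injectivity of the projected polygon -/

noncomputable def rU (j : ℕ) (x y : ℝ) : ℝ := match j with
  | 0 => y
  | 1 => -x
  | 2 => -y
  | _ => x
noncomputable def rV (j : ℕ) (x y : ℝ) : ℝ := match j with
  | 0 => -x
  | 1 => -y
  | 2 => x
  | _ => y

theorem qd_lt (k : ℕ) : qd k < 4 := by
  unfold qd
  cases Nat.blt k 91 <;> cases Nat.blt k 220 <;> cases Nat.blt k 263 <;> decide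

theorem qd_mono (k l : ℕ) (h : k ≤ l) : qd k ≤ qd l := by
  unfold qd
  have e : ∀ a b : ℕ, Nat.blt a b = decide (a < b) := by
    intro a b
    rw [Bool.eq_iff_iff, Nat.blt_eq, decide_eq_true_iff]
  simp only [e, Bool.cond_decide]
  split_ifs <;> omega

noncomputable def E0 (k : ℕ) : ℝ := (nd k).x0.toR - C0.toR
noncomputable def E1 (k : ℕ) : ℝ := (nd k).x1.toR - C1.toR

theorem rotU_toR (j : ℕ) (hj : j < 4) (X : Node) : (rotU j X).toR = rU j (X.x0.toR - C0.toR) (X.x1.toR - C1.toR) := by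
  interval_cases j
  · change (Z.sub X.x1 C1).toR = _
    simp only [rU, Z.toR_sub, neg_sub]
  · change (Z.sub C0 X.x0).toR = _
    simp only [rU, Z.toR_sub, neg_sub]
  · change (Z.sub C1 X.x1).toR = _
    simp only [rU, Z.toR_sub, neg_sub]
  · change (Z.sub X.x0 C0).toR = _
    simp only [rU, Z.toR_sub, neg_sub]

theorem rotV_toR (j : ℕ) (hj : j < 4) (X : Node) : (rotV j X).toR = rV j (X.x0.toR - C0.toR) (X.x1.toR - C1.toR) := by
  interval_cases j
  · change (Z.sub C0 X.x0).toR = _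
    simp only [rV, Z.toR_sub, neg_sub]
  · change (Z.sub C1 X.x1).toR = _
    simp only [rV, Z.toR_sub, neg_sub]
  · change (Z.sub X.x0 C0).toR = _
    simp only [rV, Z.toR_sub, neg_sub]
  · change (Z.sub X.x1 C1).toR = _
    simp only [rV, Z.toR_sub, neg_sub]

theorem nd_or (k : ℕ) (hk : k < 380) : 1 ≤ rU (qd k) (E0 k) (E1 k) ∧ 0 ≤ rV (qd k) (E0 k) (E1 k) ∧
    0 ≤ rU (qd k) (E0 (k + 1)) (E1 (k + 1)) ∧ 0 ≤ rV (qd k) (E0 (k + 1)) (E1 (k + 1)) ∧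
    1 ≤ rU (qd k) (E0 k) (E1 k) * rV (qd k) (E0 (k + 1)) (E1 (k + 1)) -
      rV (qd k) (E0 k) (E1 k) * rU (qd k) (E0 (k + 1)) (E1 (k + 1)) := by
  have := nd_cell _ hk
  unfold cellK orOK orient at this
  simp only [Bool.and_eq_true] at this
  obtain ⟨⟨h1, h2, h3, h4, h5⟩, -⟩ := this
  have h1 := Z.geN_le _ _ h1
  have h2 := Z.geN_le _ _ h2
  have h3 := Z.geN_le _ _ h3
  have h4 := Z.geN_le _ _ h4
  have h5 := Z.geN_le _ _ h5
  have hq := qd_lt k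
  simp only [Z.toR_sub, Z.toR_mul, rotU_toR _ hq, rotV_toR _ hq, Nat.cast_one, Nat.cast_zero] at h1 h2 h3 h4 h5
  exact ⟨h2, h3, h4, h5, h1⟩

theorem rU_lin (j : ℕ) (a b x y x' y' : ℝ) : rU j (a * x + b * x') (a * y + b * y') = a * rU j x y + b * rU j x' y' := by
  unfold rU; split <;> ring
theorem rV_lin (j : ℕ) (a b x y x' y' : ℝ) : rV j (a * x + b * x') (a * y + b * y') = a * rV j x y + b * rV j x' y' := by
  unfold rV; split <;> ring
theorem rU_mul (j : ℕ) (a x y : ℝ) : rU j (a * x) (a * y) = a * rU j x y := by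
  unfold rU; split <;> ring
theorem rV_mul (j : ℕ) (a x y : ℝ) : rV j (a * x) (a * y) = a * rV j x y := by
  unfold rV; split <;> ring

theorem quad_eq (j j' : ℕ) (hj : j < 4) (hj' : j' < 4) (x y : ℝ) (h1 : 0 < rU j x y) (h2 : 0 ≤ rV j x y)
    (h3 : 0 < rU j' x y) (h4 : 0 ≤ rV j' x y) : j = j' := by
  interval_cases j <;> interval_cases j' <;> simp only [rU, rV] at h1 h2 h3 h4 <;> first | rfl | (exfalso; linarith)

/-- the position in the cell -/
noncomputable def P0 (k : ℕ) (t : ℝ) : ℝ := (1 - t) * E0 k + t * E0 (k + 1)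
noncomputable def P1 (k : ℕ) (t : ℝ) : ℝ := (1 - t) * E1 k + t * E1 (k + 1)

/-- slope function -/
noncomputable def slp (j : ℕ) (x y : ℝ) : ℝ := rV j x y / (rU j x y + rV j x y)

theorem slp_le (j : ℕ) (x y x' y' : ℝ) (h : 0 < rU j x y + rV j x y) (h' : 0 < rU j x' y' + rV j x' y')
    (hc : 0 ≤ rU j x y * rV j x' y' - rV j x y * rU j x' y') : slp j x y ≤ slp j x' y' := by
  unfold slp
  rw [div_le_div_iff₀ h h']
  nlinarith

theorem slp_lt (j : ℕ) (x y x' y' : ℝ) (h : 0 < rU j x y + rV j x y) (h' : 0 < rU j x' y' + rV j x' y')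
    (hc : 0 < rU j x y * rV j x' y' - rV j x y * rU j x' y') : slp j x y < slp j x' y' := by
  unfold slp
  rw [div_lt_div_iff₀ h h']
  nlinarith

theorem pos_next (k : ℕ) (hk : k < 380) : 0 < rU (qd k) (E0 (k + 1)) (E1 (k + 1)) + rV (qd k) (E0 (k + 1)) (E1 (k + 1)) := by
  obtain ⟨a, b, c, d, e⟩ := nd_or k hk
  by_contra hc
  push Not at hc
  have c0 : rU (qd k) (E0 (k + 1)) (E1 (k + 1)) = 0 := by linarith
  have d0 : rV (qd k) (E0 (k + 1)) (E1 (k + 1)) = 0 := by linarith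
  rw [c0, d0] at e
  linarith

theorem pos_cell (k : ℕ) (hk : k < 380) (t : ℝ) (h0 : 0 ≤ t) (h1 : t < 1) :
    0 < rU (qd k) (P0 k t) (P1 k t) ∧ 0 ≤ rV (qd k) (P0 k t) (P1 k t) := by
  obtain ⟨a, b, c, d, e⟩ := nd_or k hk
  unfold P0 P1
  rw [rU_lin, rV_lin]
  constructor
  · nlinarith [mul_nonneg h0 c]
  · nlinarith [mul_nonneg h0 d]

theorem slp_chain (j k l : ℕ) (hl : l < 380) (hk : qd k = j) (hlj : qd l = j) (hkl : k ≤ l) :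
    slp j (E0 k) (E1 k) ≤ slp j (E0 l) (E1 l) := by
  induction l, hkl using Nat.le_induction with
  | base => exact le_rfl
  | succ l hkl ih =>
    have hq : qd l = j := le_antisymm (hlj ▸ qd_mono _ _ (Nat.le_succ l)) (hk ▸ qd_mono _ _ hkl)
    refine (ih (by omega) hq).trans ?_
    obtain ⟨a, b, c, d, e⟩ := nd_or l (by omega)
    have := pos_next l (by omega)
    rw [hq] at a b c d e this
    exact slp_le _ _ _ _ _ (by linarith) this (by linarith)

theorem cell_cross (k : ℕ) (s t : ℝ) (j : ℕ) :
    rU j (P0 k s) (P1 k s) * rV j (P0 k t) (P1 k t) - rV j (P0 k s) (P1 k s) * rU j (P0 k t) (P1 k t) =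
    (t - s) * (rU j (E0 k) (E1 k) * rV j (E0 (k + 1)) (E1 (k + 1)) - rV j (E0 k) (E1 k) * rU j (E0 (k + 1)) (E1 (k + 1))) := by
  unfold P0 P1
  rw [rU_lin, rV_lin, rU_lin, rV_lin]
  ring

theorem P0_zero (k : ℕ) : P0 k 0 = E0 k := by simp [P0]
theorem P1_zero (k : ℕ) : P1 k 0 = E1 k := by simp [P1]
theorem P0_one (k : ℕ) : P0 k 1 = E0 (k + 1) := by simp [P0]
theorem P1_one (k : ℕ) : P1 k 1 = E1 (k + 1) := by simp [P1]

theorem inj_aux (k l : ℕ) (s t r r' : ℝ) (hl : l < 380) (s0 : 0 ≤ s) (s1 : s < 1) (t0 : 0 ≤ t)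
    (t1 : t < 1) (hr : 0 < r) (hr' : 0 < r') (h0 : r * P0 k s = r' * P0 l t) (h1 : r * P1 k s = r' * P1 l t) :
    ¬ (k < l ∨ k = l ∧ s < t) := by
  intro hlt
  have hkl : k ≤ l := by omega
  have hk : k < 380 := by omega
  obtain ⟨a, b⟩ := pos_cell k hk s s0 s1
  obtain ⟨a', b'⟩ := pos_cell l hl t t0 t1
  have hq : qd k = qd l := by
    refine quad_eq _ _ (qd_lt _) (qd_lt _) (r * P0 k s) (r * P1 k s) ?_ ?_ ?_ ?_
    · rw [rU_mul]; positivity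
    · rw [rV_mul]; positivity
    · rw [h0, h1, rU_mul]; positivity
    · rw [h0, h1, rV_mul]; positivity
  rw [← hq] at a' b'
  have hcr : rU (qd k) (P0 k s) (P1 k s) * rV (qd k) (P0 l t) (P1 l t) -
      rV (qd k) (P0 k s) (P1 k s) * rU (qd k) (P0 l t) (P1 l t) = 0 := by
    have e1 := rU_mul (qd k) r (P0 k s) (P1 k s)
    have e2 := rV_mul (qd k) r (P0 k s) (P1 k s)
    have e3 := rU_mul (qd k) r' (P0 l t) (P1 l t)
    have e4 := rV_mul (qd k) r' (P0 l t) (P1 l t)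
    rw [h0, h1] at e1 e2
    rw [e3] at e1
    rw [e4] at e2
    have : r * (rU (qd k) (P0 k s) (P1 k s) * rV (qd k) (P0 l t) (P1 l t) -
      rV (qd k) (P0 k s) (P1 k s) * rU (qd k) (P0 l t) (P1 l t)) = 0 := by
      linear_combination (-rV (qd k) (P0 l t) (P1 l t)) * e1 + rU (qd k) (P0 l t) (P1 l t) * e2
    exact (mul_eq_zero.1 this).resolve_left hr.ne'
  have hok := nd_or k hk
  have hsl : slp (qd k) (P0 k s) (P1 k s) < slp (qd k) (P0 l t) (P1 l t) := by
    rcases hlt with hlt | ⟨rfl, hst⟩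
    · -- different cells
      have c1 : slp (qd k) (P0 k s) (P1 k s) < slp (qd k) (E0 (k + 1)) (E1 (k + 1)) := by
        refine slp_lt _ _ _ _ _ (by linarith) (pos_next k hk) ?_
        rw [← P0_one, ← P1_one, cell_cross]
        exact mul_pos (by linarith) (by linarith [hok.2.2.2.2])
      have hqn : qd (k + 1) = qd k := le_antisymm (hq ▸ qd_mono _ _ hlt) (qd_mono _ _ (Nat.le_succ k))
      have c2 := slp_chain (qd k) (k + 1) l hl hqn hq.symm hlt
      have c3 : slp (qd k) (E0 l) (E1 l) ≤ slp (qd k) (P0 l t) (P1 l t) := by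
        have hol := nd_or l hl
        rw [← hq] at hol
        refine slp_le _ _ _ _ _ (by linarith [hol.1, hol.2.1]) (by linarith) ?_
        rw [← P0_zero l, ← P1_zero l, cell_cross]
        exact mul_nonneg (by linarith) (by linarith [hol.2.2.2.2])
      linarith
    · refine slp_lt _ _ _ _ _ (by linarith) (by linarith) ?_
      rw [cell_cross]
      exact mul_pos (by linarith) (by linarith [hok.2.2.2.2])
  have := slp_le (qd k) _ _ _ _ (show 0 < rU (qd k) (P0 l t) (P1 l t) + rV (qd k) (P0 l t) (P1 l t) by linarith)
    (show 0 < rU (qd k) (P0 k s) (P1 k s) + rV (qd k) (P0 k s) (P1 k s) by linarith) (by linarith)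
  linarith

theorem inj_poly (k l : ℕ) (s t r r' : ℝ) (hk : k < 380) (hl : l < 380) (s0 : 0 ≤ s) (s1 : s < 1) (t0 : 0 ≤ t)
    (t1 : t < 1) (hr : 0 < r) (hr' : 0 < r') (h0 : r * P0 k s = r' * P0 l t) (h1 : r * P1 k s = r' * P1 l t) :
    k = l ∧ s = t := by
  have a := inj_aux k l s t r r' hl s0 s1 t0 t1 hr hr' h0 h1
  have b := inj_aux l k t s r' r hk t0 t1 s0 s1 hr' hr h0.symm h1.symm
  have hkl : k = l := by omega
  refine ⟨hkl, ?_⟩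
  by_contra hne
  rcases lt_or_gt_of_ne hne with h | h
  · exact a (Or.inr ⟨hkl, h⟩)
  · exact b (Or.inr ⟨hkl.symm, h⟩)

end Lom

namespace Lom

/-! ### The loop in scaled coordinates -/

noncomputable def VV (θ μ ν : ℝ) : ℝ × ℝ × ℝ := cellV (nz ⌊θ⌋) (nz (⌊θ⌋ + 1)) (Int.fract θ) μ ν

theorem VV_eq (θ μ ν : ℝ) : VV θ μ ν =
    (pl (fun k => (nz k).x0.toR) θ + μ * pl (fun k => (nz k).x0.toR - C0.toR) θ / sc,
     pl (fun k => (nz k).x1.toR) θ + μ * pl (fun k => (nz k).x1.toR - C1.toR) θ / sc,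
     pl (fun k => (nz k).x2.toR) θ + μ * pl (fun k => (nz k).w.toR) θ / sc + ν) := rfl

theorem VV_cont : Continuous (fun p : ℝ × ℝ × ℝ => VV p.1 p.2.1 p.2.2) := by
  simp only [VV_eq]
  have h1 := pl_cont (fun k => (nz k).x0.toR)
  have h2 := pl_cont (fun k => (nz k).x0.toR - C0.toR)
  have h3 := pl_cont (fun k => (nz k).x1.toR)
  have h4 := pl_cont (fun k => (nz k).x1.toR - C1.toR)
  have h5 := pl_cont (fun k => (nz k).x2.toR)
  have h6 := pl_cont (fun k => (nz k).w.toR)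
  fun_prop

theorem VV_per (θ μ ν : ℝ) : VV (θ + 380) μ ν = VV θ μ ν := by
  have h : θ + 380 = θ + ((380 : ℤ) : ℝ) := by norm_num
  rw [h]
  unfold VV
  rw [Int.fract_add_intCast, Int.floor_add_intCast, nz_per, show ⌊θ⌋ + 380 + 1 = ⌊θ⌋ + 1 + 380 by ring, nz_per]

theorem rev_cont : Continuous rev := by
  unfold rev; fun_prop

theorem sub_sc_zero {a b : ℝ} (h : (a - b) / sc = 0) : a = b := by
  rcases div_eq_zero_iff.1 h with h | h
  · exact sub_eq_zero.1 h
  · exact absurd h sc_pos.ne'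

theorem glob : Glob HF HBk 30 17 rev VV (rF : ℕ) (rB : ℕ) := by
  have hcF : ∀ θ : ℝ, ∃ σ, EndHB HF rF σ ∧
    (∀ μ ν : ℝ, |μ| ≤ (rF : ℕ) → |ν| ≤ (rB : ℕ) → EI rF σ (Int.fract θ) μ (HF.T^[30] (VV θ μ ν))) ∧
    (∀ μ ν μ' ν' : ℝ, |μ| ≤ (rF : ℕ) → |ν| ≤ (rB : ℕ) → |μ'| ≤ (rF : ℕ) → |ν'| ≤ (rB : ℕ) →
      |ν - ν'| ≤ 1 / 100 * |μ - μ'| →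
      UI σ ((μ - μ') / sc) (HF.T^[30] (VV θ μ ν)) (HF.T^[30] (VV θ μ' ν'))) := by
    intro θ
    obtain ⟨σ, h1, h2⟩ := (nz_cell ⌊θ⌋).F
    obtain ⟨h3, h4⟩ := h2 (Int.fract θ) (Int.fract_nonneg θ) (Int.fract_lt_one θ).le
    exact ⟨σ, endHB_of linkF h1, fun μ ν a b => (h3 μ ν a b).1, h4⟩
  have hcB : ∀ θ : ℝ, ∃ σ, EndHB HBk rB σ ∧
    (∀ μ ν : ℝ, |μ| ≤ (rF : ℕ) → |ν| ≤ (rB : ℕ) → EI rB σ (Int.fract θ) ν (HBk.T^[17] (rev (VV θ μ ν)))) ∧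
    (∀ μ ν μ' ν' : ℝ, |μ| ≤ (rF : ℕ) → |ν| ≤ (rB : ℕ) → |μ'| ≤ (rF : ℕ) → |ν'| ≤ (rB : ℕ) →
      |μ - μ'| ≤ 100 * |ν - ν'| →
      UI σ ((ν - ν') / sc) (HBk.T^[17] (rev (VV θ μ ν))) (HBk.T^[17] (rev (VV θ μ' ν')))) := by
    intro θ
    obtain ⟨σ, h1, h2⟩ := (nz_cell ⌊θ⌋).B
    obtain ⟨h3, h4⟩ := h2 (Int.fract θ) (Int.fract_nonneg θ) (Int.fract_lt_one θ).le
    exact ⟨σ, endHB_of linkB h1, h3, h4⟩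
  have t0 := fun θ : ℝ => Int.fract_nonneg θ
  have t1 := fun θ : ℝ => (Int.fract_lt_one θ).le
  have aF : |((rF : ℕ) : ℝ)| ≤ (rF : ℕ) := by rw [Nat.abs_cast]
  have aB : |((rB : ℕ) : ℝ)| ≤ (rB : ℕ) := by rw [Nat.abs_cast]
  have nF : |-((rF : ℕ) : ℝ)| ≤ (rF : ℕ) := by rw [abs_neg, Nat.abs_cast]
  have nB : |-((rB : ℕ) : ℝ)| ≤ (rB : ℕ) := by rw [abs_neg, Nat.abs_cast]
  refine ⟨Nat.cast_nonneg _, Nat.cast_nonneg _, rev_cont, VV_cont, ?_, ?_, ?_, ?_, ?_, ?_, ?_, ?_⟩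
  · intro θ μ ν hμ hν
    obtain ⟨σ, h1, h2, -⟩ := hcF θ
    exact h1.hs _ _ _ (t0 θ) (t1 θ) hμ (h2 μ ν hμ hν)
  · intro θ ν hν
    obtain ⟨σ, h1, h2, -⟩ := hcF θ
    exact h1.lo _ _ (t0 θ) (t1 θ) (h2 _ ν nF hν)
  · intro θ ν hν
    obtain ⟨σ, h1, h2, -⟩ := hcF θ
    exact h1.hi _ _ (t0 θ) (t1 θ) (h2 _ ν aF hν)
  · intro θ μ ν hμ hν
    obtain ⟨σ, h1, h2, -⟩ := hcB θ
    exact h1.hs _ _ _ (t0 θ) (t1 θ) hν (h2 μ ν hμ hν)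
  · intro θ μ hμ
    obtain ⟨σ, h1, h2, -⟩ := hcB θ
    exact h1.lo _ _ (t0 θ) (t1 θ) (h2 μ _ hμ nB)
  · intro θ μ hμ
    obtain ⟨σ, h1, h2, -⟩ := hcB θ
    exact h1.hi _ _ (t0 θ) (t1 θ) (h2 μ _ hμ aB)
  · intro θ μ ν μ' ν' h1 h2 h3 h4 h5
    obtain ⟨σ, k1, -, k2⟩ := hcF θ
    have u := k2 μ ν μ' ν' h1 h2 h3 h4 h5
    exact ⟨k1.bd _ _ _ u, fun e => sub_sc_zero (k1.eq _ _ _ u e)⟩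
  · intro θ μ ν μ' ν' h1 h2 h3 h4 h5
    obtain ⟨σ, k1, -, k2⟩ := hcB θ
    have u := k2 μ ν μ' ν' h1 h2 h3 h4 h5
    exact ⟨k1.bd _ _ _ u, fun e => sub_sc_zero (k1.eq _ _ _ u e)⟩

/-- position bound inside the forward block -/
theorem UF_lo (v : ℝ × ℝ × ℝ) (h : HF.U v) : -1319413953331 ≤ v.1 := by
  obtain ⟨q1, q2, q3, -⟩ := h
  simp only [HF, mkHB] at q1 q2 q3
  have := (rec_bd (23 / 16) (147 / 250) (16 / 23) (v.1 / sc - fpF) (v.2.1 / sc - fpF) (v.2.2 / sc - fpF) _ _ _ (by norm_num)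
    (by norm_num) (by norm_num) (by norm_num)
      (by convert q1 using 2; ring) (by convert q2 using 2; ring) (by convert q3 using 2; ring)).1
  have h1 := neg_abs_le (v.1 / sc - fpF)
  have h2 := sq_lo
  have h3 : -1 ≤ v.1 / sc := by
    simp only [fpF] at this h1
    norm_num at this
    linarith
  rw [le_div_iff₀ sc_pos] at h3
  have : sc = 1099511627776 := rfl
  linarith

theorem first_lim (q : Par) (p lam l1 l2 ρ aL bS E Eh e0 θ gr : ℝ)
    (h : (mkHB q p lam l1 l2 ρ aL bS E Eh e0 θ gr).OK) (ll : lam * l2 = 1) (lam0 : 0 < lam) (l10 : 0 ≤ l1)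
    (l20 : 0 < l2) (v : ℝ × ℝ × ℝ) (k : ℕ) (hv : stay (mkHB q p lam l1 l2 ρ aL bS E Eh e0 θ gr) ((mp q)^[k] v)) :
    Filter.Tendsto (fun n => ((mp q)^[n] v).1) Filter.atTop (nhds (sc * p)) := by
  rw [← Filter.tendsto_add_atTop_iff_nat k]
  obtain ⟨N0, hN⟩ := h.conv_bd _ hv
  have hQ : 0 < lam ^ 2 + l1 * lam + l2 := by positivity
  have hb : ∀ n : ℕ, |((mp q)^[n + k] v).1 - sc * p| ≤
      (sc * ((lam ^ 2 * N0 + N0 + (l1 * lam + l2) * (ρ * N0)) / (lam ^ 2 + l1 * lam + l2))) * θ ^ n := by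
    intro n
    obtain ⟨q1, q2, q3, -⟩ := hN n
    have et : (mkHB q p lam l1 l2 ρ aL bS E Eh e0 θ gr).T = mp q := rfl
    rw [et, ← Function.iterate_add_apply] at q1 q2 q3
    set w := (mp q)^[n + k] v
    simp only [mkHB] at q1 q2 q3
    have := (rec_bd lam l1 l2 (w.1 / sc - p) (w.2.1 / sc - p) (w.2.2 / sc - p) _ _ _ ll lam0 l10 l20
      (by convert q1 using 2; ring) (by convert q2 using 2; ring) (by convert q3 using 2; ring)).1
    have e1 : w.1 - sc * p = sc * (w.1 / sc - p) := by field_simp [sc_pos.ne']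
    rw [e1, abs_mul, abs_of_pos sc_pos, mul_assoc]
    refine mul_le_mul_of_nonneg_left ?_ sc_pos.le
    rw [div_mul_eq_mul_div, le_div_iff₀ hQ]
    linarith
  have hθ : Filter.Tendsto (fun n : ℕ => (sc * ((lam ^ 2 * N0 + N0 + (l1 * lam + l2) * (ρ * N0)) /
      (lam ^ 2 + l1 * lam + l2))) * θ ^ n) Filter.atTop (nhds 0) := by
    have := (tendsto_pow_atTop_nhds_zero_of_lt_one h.θ0.le h.θ1).const_mul
      (sc * ((lam ^ 2 * N0 + N0 + (l1 * lam + l2) * (ρ * N0)) / (lam ^ 2 + l1 * lam + l2)))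
    rwa [mul_zero] at this
  rw [tendsto_iff_norm_sub_tendsto_zero]
  exact squeeze_zero (fun _ => norm_nonneg _) hb hθ

theorem mp_lim (q : Par) (x : ℝ) (v : ℝ × ℝ × ℝ)
    (h : Filter.Tendsto (fun n => ((mp q)^[n] v).1) Filter.atTop (nhds x)) :
    Filter.Tendsto (fun n => (mp q)^[n] v) Filter.atTop (nhds (x, x, x)) := by
  have h1 : Filter.Tendsto (fun n => ((mp q)^[n] v).2.1) Filter.atTop (nhds x) := by
    rw [← Filter.tendsto_add_atTop_iff_nat 1]
    refine h.congr fun n => ?_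
    rw [Function.iterate_succ_apply']; rfl
  have h2 : Filter.Tendsto (fun n => ((mp q)^[n] v).2.2) Filter.atTop (nhds x) := by
    rw [← Filter.tendsto_add_atTop_iff_nat 1]
    refine h1.congr fun n => ?_
    rw [Function.iterate_succ_apply']; rfl
  exact h.prodMk_nhds (h1.prodMk_nhds h2)

/-- the loop -/
theorem loop_ex : ∃ W : ℝ → ℝ × ℝ × ℝ, Continuous W ∧ (∀ θ, W (θ + 380) = W θ) ∧ Set.InjOn W (Set.Ico 0 380) ∧
    ∀ θ, Filter.Tendsto (fun n => (mp parF)^[n] (W θ)) Filter.atTop (nhds (sc * fpF, sc * fpF, sc * fpF)) ∧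
      Filter.Tendsto (fun n => (mp parB)^[n] (rev (W θ))) Filter.atTop (nhds (sc * fpB, sc * fpB, sc * fpB)) ∧
      ((mp parF)^[2] (W θ)).1 ≤ -1374389534720 ∧ ∀ j, 3 ≤ j → -1319413953331 ≤ ((mp parF)^[j] (W θ)).1 := by
  obtain ⟨m, n, cm, cn, h⟩ := glob.sel HF_OK HBk_OK
  have hper : ∀ θ, m (θ + 380) = m θ ∧ n (θ + 380) = n θ := by
    intro θ
    obtain ⟨a1, a2, a3, a4⟩ := h (θ + 380)
    obtain ⟨b1, b2, b3, b4⟩ := h θ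
    rw [VV_per] at a3 a4
    exact glob.uniq HF_OK HBk_OK θ _ _ _ _ a1 a2 b1 b2 a3 b3 a4 b4
  refine ⟨fun θ => VV θ (m θ) (n θ), ?_, ?_, ?_, ?_⟩
  · exact VV_cont.comp (f := fun θ : ℝ => (θ, m θ, n θ)) (by fun_prop)
  · intro θ
    change VV (θ + 380) (m (θ + 380)) (n (θ + 380)) = _
    rw [VV_per, (hper θ).1, (hper θ).2]
  · have key : ∀ θ : ℝ, θ ∈ Set.Ico (0 : ℝ) 380 → ∃ (k : ℕ) (t : ℝ), k < 380 ∧ 0 ≤ t ∧ t < 1 ∧ θ = k + t ∧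
        ∀ μ ν, (VV θ μ ν).1 = C0.toR + (1 + μ / sc) * P0 k t ∧ (VV θ μ ν).2.1 = C1.toR + (1 + μ / sc) * P1 k t := by
      intro θ hθ
      have f0 : 0 ≤ ⌊θ⌋ := Int.floor_nonneg.2 hθ.1
      have f1 : ⌊θ⌋ < 380 := Int.floor_lt.2 (by exact_mod_cast hθ.2)
      obtain ⟨k, hk⟩ := Int.eq_ofNat_of_zero_le f0
      have hk3 : k < 380 := by omega
      have n0 : nz ⌊θ⌋ = nd k := by
        unfold nz; rw [hk]; congr 1; omega
      have n1 : nz (⌊θ⌋ + 1) = nd (k + 1) := by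
        unfold nz; rw [hk]
        by_cases hc : k = 379
        · rw [show (((k : ℤ) + 1) % 380).toNat = 0 by omega, hc]; exact nd_380.symm
        · congr 1; omega
      refine ⟨k, Int.fract θ, hk3, Int.fract_nonneg θ, Int.fract_lt_one θ, ?_, fun μ ν => ?_⟩
      · have := Int.floor_add_fract θ
        rw [hk] at this
        exact this.symm
      · rw [VV_eq]
        simp only [pl, n0, n1, P0, P1, E0, E1]
        constructor <;> ring
    intro θ hθ θ' hθ' he
    obtain ⟨k, t, k1, t0, t1, e, ke⟩ := key θ hθ
    obtain ⟨k', t', k1', t0', t1', e', ke'⟩ := key θ' hθ'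
    change VV θ (m θ) (n θ) = VV θ' (m θ') (n θ') at he
    obtain ⟨a1, a2⟩ := ke (m θ) (n θ)
    obtain ⟨b1, b2⟩ := ke' (m θ') (n θ')
    rw [he] at a1 a2
    have hpos : ∀ θ, 0 < 1 + m θ / sc := by
      intro θ
      have := (abs_le.1 (h θ).1).1
      have hs : sc = 1099511627776 := rfl
      have : -1 < m θ / sc := by
        rw [lt_div_iff₀ sc_pos, hs]
        have : ((rF : ℕ) : ℝ) = 120946279 := by norm_num
        linarith
      linarith
    obtain ⟨r1, r2⟩ := inj_poly k k' t t' _ _ k1 k1' t0 t1 t0' t1' (hpos θ) (hpos θ') (by linarith) (by linarith)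
    rw [e, e', r1, r2]
  · intro θ
    obtain ⟨h1, h2, h3, h4⟩ := h θ
    obtain ⟨σ, -, c2⟩ := (nz_cell ⌊θ⌋).F
    obtain ⟨-, c3, c4⟩ := (c2 (Int.fract θ) (Int.fract_nonneg θ) (Int.fract_lt_one θ).le).1 _ _ h1 h2
    refine ⟨?_, ?_, c3, ?_⟩
    · exact mp_lim _ _ _ (first_lim _ _ _ _ _ _ _ _ _ _ _ _ _ HF_OK (by norm_num) (by norm_num) (by norm_num) (by norm_num) _ 30 h3)
    · exact mp_lim _ _ _ (first_lim _ _ _ _ _ _ _ _ _ _ _ _ _ HBk_OK (by norm_num) (by norm_num) (by norm_num) (by norm_num) _ 17 h4)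
    · intro j hj
      rcases Nat.lt_or_ge 30 j with hj' | hj'
      · have := UF_lo _ (h3 (j - 30))
        have et : HF.T = mp parF := rfl
        rw [et, ← Function.iterate_add_apply, show j - 30 + 30 = j by omega] at this
        exact this
      · exact c4 j hj hj'

end Lom

namespace Lom

/-- Rescaling to the original coordinates. -/
noncomputable def toV (v : ℝ × ℝ × ℝ) : Fin 3 → ℝ := ![v.1 / sc, v.2.1 / sc, v.2.2 / sc]

theorem toV_cont : Continuous toV := by
  unfold toV
  refine continuous_pi fun i => ?_
  fin_cases i
  · exact continuous_fst.div_const _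
  · exact (continuous_fst.comp continuous_snd).div_const _
  · exact (continuous_snd.comp continuous_snd).div_const _

theorem toV_inj {v w : ℝ × ℝ × ℝ} (h : toV v = toV w) : v = w := by
  have h0 : v.1 / sc = w.1 / sc := congrFun h 0
  have h1 : v.2.1 / sc = w.2.1 / sc := congrFun h 1
  have h2 : v.2.2 / sc = w.2.2 / sc := congrFun h 2
  have hs := sc_pos.ne'
  rw [div_left_inj' hs] at h0 h1 h2
  exact Prod.ext h0 (Prod.ext h1 h2)

theorem rev_rev (v : ℝ × ℝ × ℝ) : rev (rev v) = v := rfl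

section conj
variable (f g : (Fin 3 → ℝ) → (Fin 3 → ℝ))

theorem conj_f (hf : ∀ v, f v =
      ![v 2 + (-8999 / 100000 : ℝ) + (8 / 10 : ℝ) * v 0 + (1 / 2 : ℝ) * (v 0) ^ 2 +
          (-1 / 2 : ℝ) * v 0 * v 1 + (1 : ℝ) * (v 1) ^ 2, v 0, v 1])
    (v : ℝ × ℝ × ℝ) : f (toV v) = toV (mp parF v) := by
  rw [hf]
  have e : toV v 2 + (-8999 / 100000 : ℝ) + (8 / 10 : ℝ) * toV v 0 + (1 / 2 : ℝ) * (toV v 0) ^ 2 +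
      (-1 / 2 : ℝ) * toV v 0 * toV v 1 + (1 : ℝ) * (toV v 1) ^ 2 = (mp parF v).1 / sc := by
    change v.2.2 / sc + (-8999 / 100000 : ℝ) + (8 / 10 : ℝ) * (v.1 / sc) + (1 / 2 : ℝ) * (v.1 / sc) ^ 2 +
      (-1 / 2 : ℝ) * (v.1 / sc) * (v.2.1 / sc) + (1 : ℝ) * (v.2.1 / sc) ^ 2 = (v.2.2 + Hs parF v.1 v.2.1) / sc
    simp only [Hs, parF, Z.toR, sc]
    norm_num
    ring
  rw [e]
  rfl

theorem conj_g (hg : ∀ v, g v =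
      ![v 1, v 2, v 0 - (-8999 / 100000 : ℝ) - (8 / 10 : ℝ) * v 1 - (1 / 2 : ℝ) * (v 1) ^ 2 -
          (-1 / 2 : ℝ) * v 1 * v 2 - (1 : ℝ) * (v 2) ^ 2])
    (v : ℝ × ℝ × ℝ) : g (toV v) = toV (rev (mp parB (rev v))) := by
  rw [hg]
  have e : toV v 0 - (-8999 / 100000 : ℝ) - (8 / 10 : ℝ) * toV v 1 - (1 / 2 : ℝ) * (toV v 1) ^ 2 -
          (-1 / 2 : ℝ) * toV v 1 * toV v 2 - (1 : ℝ) * (toV v 2) ^ 2 = (mp parB (rev v)).1 / sc := by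
    change v.1 / sc - (-8999 / 100000 : ℝ) - (8 / 10 : ℝ) * (v.2.1 / sc) - (1 / 2 : ℝ) * (v.2.1 / sc) ^ 2 -
          (-1 / 2 : ℝ) * (v.2.1 / sc) * (v.2.2 / sc) - (1 : ℝ) * (v.2.2 / sc) ^ 2
      = (v.1 + Hs parB v.2.2 v.2.1) / sc
    simp only [Hs, parB, Z.toR, sc]
    norm_num
    ring
  rw [e]
  rfl

end conj

theorem iterZ_add {α : Type*} {f g : α → α} (h : Function.RightInverse g f) (x : α) (n : ℤ) :
    f (iterZ f g n x) = iterZ f g (n + 1) x := by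
  cases n with
  | ofNat n =>
    have : (Int.ofNat n + 1) = Int.ofNat (n + 1) := rfl
    rw [this]
    exact (Function.iterate_succ_apply' f n x).symm
  | negSucc n =>
    cases n with
    | zero => exact h x
    | succ n =>
      have : (Int.negSucc (n + 1) + 1) = Int.negSucc n := rfl
      rw [this]
      change f (g^[n + 1 + 1] x) = g^[n + 1] x
      rw [Function.iterate_succ_apply' g (n + 1), h]

theorem iterZ_addn {α : Type*} {f g : α → α} (h : Function.RightInverse g f) (x : α) (n : ℤ) (a : ℕ) :
    f^[a] (iterZ f g n x) = iterZ f g (n + a) x := by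
  induction a with
  | zero => simp
  | succ a ih =>
    rw [Function.iterate_succ_apply', ih, iterZ_add h]
    congr 1
    push_cast
    ring

/-- Disjointness of iterates from the absence of forward returns. -/
theorem iterZ_disj {α : Type*} {f g : α → α} (hl : Function.LeftInverse g f)
    (hr : Function.RightInverse g f) {S : Set α}
    (hS : ∀ x ∈ S, ∀ y ∈ S, ∀ k : ℕ, f^[k + 1] x ≠ y) (n m : ℤ) (hnm : n ≠ m) :
    Disjoint (iterZ f g n '' S) (iterZ f g m '' S) := by
  have key : ∀ n m : ℤ, n < m → ∀ x ∈ S, ∀ y ∈ S, iterZ f g n x ≠ iterZ f g m y := by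
    intro n m hlt x hx y hy he
    obtain ⟨k, hk⟩ : ∃ k : ℕ, m = n + (k + 1) := ⟨(m - n - 1).toNat, by omega⟩
    obtain ⟨N, hN⟩ : ∃ N : ℕ, n + (n.natAbs : ℤ) = N := ⟨(n + n.natAbs).toNat, by omega⟩
    have h2 := congrArg (f^[n.natAbs]) he
    rw [iterZ_addn hr, iterZ_addn hr, hN, show m + (n.natAbs : ℤ) = ((N + (k + 1) : ℕ) : ℤ) by
      omega] at h2
    change f^[N] x = f^[N + (k + 1)] y at h2
    rw [Function.iterate_add_apply] at h2
    exact hS y hy x hx k (hl.injective.iterate N h2).symm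
  rw [Set.disjoint_left]
  rintro z ⟨x, hx, rfl⟩ ⟨y, hy, he⟩
  rcases lt_or_gt_of_ne hnm with h | h
  · exact key n m h x hx y hy he.symm
  · exact key m n h y hy x hx he

theorem toV_diag (r : ℝ) : toV (sc * r, sc * r, sc * r) = ![r, r, r] := by
  unfold toV
  simp only [mul_div_cancel_left₀ _ sc_pos.ne']

end Lom

/-- Existence of a heteroclinic loop for the Lomelí map with parameters
`a = 1/2, b = −1/2, c = 1, α = −8999/100000, τ = 8/10` (Section 4.3.1 of the paper).
The map `f` is a bijection of `ℝ³` (with explicit inverse `g`), and there exist two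
distinct fixed points `p₁ ≠ p₂` and a Jordan loop `γ` (a continuous `1`-periodic curve,
injective on a fundamental domain) all of whose points are heteroclinic from `p₁` to `p₂`;
consequently the iterates `fⁿ(γ)`, `n ∈ ℤ`, form a countable family of pairwise disjoint
loops of heteroclinic points. -/
theorem lomeli_heteroclinic_loop
    (f g : (Fin 3 → ℝ) → (Fin 3 → ℝ))
    (hf : ∀ v, f v =
      ![v 2 + (-8999 / 100000 : ℝ) + (8 / 10 : ℝ) * v 0 + (1 / 2 : ℝ) * (v 0) ^ 2 +
          (-1 / 2 : ℝ) * v 0 * v 1 + (1 : ℝ) * (v 1) ^ 2, v 0, v 1])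
    (hg : ∀ v, g v =
      ![v 1, v 2, v 0 - (-8999 / 100000 : ℝ) - (8 / 10 : ℝ) * v 1 - (1 / 2 : ℝ) * (v 1) ^ 2 -
          (-1 / 2 : ℝ) * v 1 * v 2 - (1 : ℝ) * (v 2) ^ 2]) :
    Function.Bijective f ∧
    Function.LeftInverse g f ∧ Function.RightInverse g f ∧
    ∃ p1 p2 : Fin 3 → ℝ, p1 ≠ p2 ∧ f p1 = p1 ∧ f p2 = p2 ∧
      ∃ γ : ℝ → (Fin 3 → ℝ),
        Continuous γ ∧
        (∀ s : ℝ, γ (s + 1) = γ s) ∧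
        Set.InjOn γ (Set.Ico 0 1) ∧
        (∀ s : ℝ,
          Tendsto (fun n => f^[n] (γ s)) atTop (nhds p2) ∧
          Tendsto (fun n => g^[n] (γ s)) atTop (nhds p1)) ∧
        ∀ n m : ℤ, n ≠ m →
          Disjoint (iterZ f g n '' Set.range γ) (iterZ f g m '' Set.range γ) := by
  have hl : Function.LeftInverse g f := by
    intro v
    rw [hg, hf]
    ext i
    fin_cases i
    · rfl
    · rfl
    · simp
      ring
  have hr : Function.RightInverse g f := by
    intro v
    rw [hf, hg]
    ext i
    fin_cases i
    · simp
      ring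
    · rfl
    · rfl
  refine ⟨⟨hl.injective, hr.surjective⟩, hl, hr, ![Lom.fpB, Lom.fpB, Lom.fpB],
    ![Lom.fpF, Lom.fpF, Lom.fpF], ?_, ?_, ?_, ?_⟩
  · intro h
    have h0 : Lom.fpB = Lom.fpF := congrFun h 0
    have h1 := Lom.sq_lo
    unfold Lom.fpB Lom.fpF at h0
    linarith
  · rw [hf]
    have e : Lom.fpB + (-8999 / 100000 : ℝ) + (8 / 10 : ℝ) * Lom.fpB + (1 / 2 : ℝ) * Lom.fpB ^ 2 +
        (-1 / 2 : ℝ) * Lom.fpB * Lom.fpB + (1 : ℝ) * Lom.fpB ^ 2 = Lom.fpB := by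
      have := Lom.sq_sq
      unfold Lom.fpB
      linarith
    exact congrArg (fun r => ![r, Lom.fpB, Lom.fpB]) e
  · rw [hf]
    have e : Lom.fpF + (-8999 / 100000 : ℝ) + (8 / 10 : ℝ) * Lom.fpF + (1 / 2 : ℝ) * Lom.fpF ^ 2 +
        (-1 / 2 : ℝ) * Lom.fpF * Lom.fpF + (1 : ℝ) * Lom.fpF ^ 2 = Lom.fpF := by
      have := Lom.sq_sq
      unfold Lom.fpF
      linarith
    exact congrArg (fun r => ![r, Lom.fpF, Lom.fpF]) e
  have cf : ∀ (n : ℕ) (v : ℝ × ℝ × ℝ), f^[n] (Lom.toV v) = Lom.toV ((Lom.mp Lom.parF)^[n] v) := by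
    intro n v
    induction n with
    | zero => rfl
    | succ n ih =>
      rw [Function.iterate_succ_apply', Function.iterate_succ_apply', ih, Lom.conj_f f hf]
  have cg : ∀ (n : ℕ) (v : ℝ × ℝ × ℝ),
      g^[n] (Lom.toV v) = Lom.toV (Lom.rev ((Lom.mp Lom.parB)^[n] (Lom.rev v))) := by
    intro n v
    induction n with
    | zero => rfl
    | succ n ih =>
      rw [Function.iterate_succ_apply', Function.iterate_succ_apply', ih, Lom.conj_g g hg,
        Lom.rev_rev]
  obtain ⟨W, Wc, Wp, Wi, hW⟩ := Lom.loop_ex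
  refine ⟨fun s => Lom.toV (W (380 * s)), ?_, ?_, ?_, ?_, ?_⟩
  · exact Lom.toV_cont.comp (Wc.comp (continuous_const.mul continuous_id))
  · intro s
    change Lom.toV (W (380 * (s + 1))) = Lom.toV (W (380 * s))
    rw [mul_add, mul_one, Wp]
  · intro s hs t ht h
    have h1 := Wi ⟨by linarith [hs.1], by linarith [hs.2]⟩ ⟨by linarith [ht.1], by linarith [ht.2]⟩
      (Lom.toV_inj h)
    linarith
  · intro s
    obtain ⟨hF, hB, -⟩ := hW (380 * s)
    constructor
    · have h := (Lom.toV_cont.tendsto _).comp hF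
      rw [Lom.toV_diag] at h
      exact h.congr fun n => (cf n _).symm
    · have h := ((Lom.toV_cont.comp Lom.rev_cont).tendsto _).comp hB
      have e : (Lom.toV ∘ Lom.rev) (Lom.sc * Lom.fpB, Lom.sc * Lom.fpB, Lom.sc * Lom.fpB) =
        ![Lom.fpB, Lom.fpB, Lom.fpB] := Lom.toV_diag Lom.fpB
      rw [e] at h
      exact h.congr fun n => (cg n _).symm
  · refine Lom.iterZ_disj hl hr ?_
    rintro x ⟨s, rfl⟩ y ⟨t, rfl⟩ k he
    have h1 := congrArg (f^[2]) he
    rw [← Function.iterate_add_apply] at h1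
    change f^[2 + (k + 1)] (Lom.toV (W (380 * s))) = f^[2] (Lom.toV (W (380 * t))) at h1
    rw [cf, cf] at h1
    have h2 := congrArg Prod.fst (Lom.toV_inj h1)
    have h3 := (hW (380 * s)).2.2.2 (2 + (k + 1)) (by omega)
    have h4 := (hW (380 * t)).2.2.1
    rw [h2] at h3
    linarith
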